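/- There exist positive constants δ₁ and ε₁, depending only on μ, κ, γ₀, γ̄ and C₀, such that if ϱ·(M̄ + M̄⁴) ≤ δ₁ and ε ∈ (0,ε₁), then for every η > 0 there is a constant C₆ > 0 (depending on η but not on ε or n) such that every solution as in the hypotheses satisfies √ε·|ñ|^{1/3}·(‖∂_yŴ‖_{L²} + |ñ|‖Ŵ‖_{L²}) + |ñ|^{2/3}·‖Ŵ‖_{L²} + ε^{-1/4}·|ñ|^{5/6}·‖Z^{1/2}Ŵ‖_{L²} ≤ C₆·|log ε|^{1+η/3}·(‖R‖_{L²} + ε^{-1/4}‖Z^{1/2}R‖_{L²}). -/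

import Mathlib

open MeasureTheory Set Filter

noncomputable section

/-- Squared L² integral on the half line `(0,∞)`. -/
def nsq (f : ℝ → ℂ) : ℝ := ∫ y in Set.Ioi (0:ℝ), ‖f y‖ ^ 2

/-- L² norm of a quadruple of functions on `(0,∞)`. -/
def nrm4 (a b c d : ℝ → ℂ) : ℝ := Real.sqrt (nsq a + nsq b + nsq c + nsq d)

/-- Membership in `L²((0,∞))` (square integrability). -/
def ML2 (f : ℝ → ℂ) : Prop := MeasureTheory.IntegrableOn (fun y => ‖f y‖ ^ 2) (Set.Ioi 0)

/-- Multiplication by the square root of a weight. -/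
def wt (Z : ℝ → ℝ) (f : ℝ → ℂ) : ℝ → ℂ := fun y => (Real.sqrt (Z y) : ℂ) * f y

section Aux
open ComplexConjugate

lemma flux_le {g g' φ : ℝ → ℝ} (hc : ContinuousOn g (Ici 0))
    (hd : ∀ y, 0 < y → HasDerivAt g (g' y) y) (hφ : IntegrableOn φ (Ioi 0))
    (hle : ∀ y, 0 < y → g' y ≤ φ y) (h0 : g 0 = 0) (hT : Tendsto g atTop (nhds 0)) :
    0 ≤ ∫ y in Ioi (0:ℝ), φ y := by
  have h1 : ∀ T : ℝ, 0 ≤ T → g T ≤ ∫ y in (0:ℝ)..T, φ y := by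
    intro T hT0
    have := intervalIntegral.sub_le_integral_of_hasDeriv_right_of_le (g := g) (g' := g') (φ := φ)
      hT0 (hc.mono Icc_subset_Ici_self) (fun x hx => (hd x hx.1).hasDerivWithinAt)
      ((integrableOn_Icc_iff_integrableOn_Ioc).2 (hφ.mono_set Ioc_subset_Ioi_self))
      (fun x hx => hle x hx.1)
    simpa [h0] using this
  have h2 := intervalIntegral_tendsto_integral_Ioi (0:ℝ) hφ tendsto_id
  refine le_of_tendsto_of_tendsto hT h2 ?_
  filter_upwards [eventually_ge_atTop (0:ℝ)] with T hT0 using h1 T hT0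

lemma cs_int {A B : ℝ → ℝ} (hA : IntegrableOn A (Ioi 0)) (hB : IntegrableOn B (Ioi 0))
    (hA0 : ∀ y, 0 < y → 0 ≤ A y) (hB0 : ∀ y, 0 < y → 0 ≤ B y) :
    IntegrableOn (fun y => √(A y) * √(B y)) (Ioi 0) ∧
    ∫ y in Ioi (0:ℝ), √(A y) * √(B y) ≤ √(∫ y in Ioi (0:ℝ), A y) * √(∫ y in Ioi (0:ℝ), B y) := by
  have mA : AEStronglyMeasurable (fun y => √(A y)) (volume.restrict (Ioi 0)) :=
    Real.continuous_sqrt.comp_aestronglyMeasurable hA.aestronglyMeasurable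
  have mB : AEStronglyMeasurable (fun y => √(B y)) (volume.restrict (Ioi 0)) :=
    Real.continuous_sqrt.comp_aestronglyMeasurable hB.aestronglyMeasurable
  have eA : ∀ y ∈ Ioi (0:ℝ), √(A y) ^ 2 = A y := fun y hy => Real.sq_sqrt (hA0 y hy)
  have eB : ∀ y ∈ Ioi (0:ℝ), √(B y) ^ 2 = B y := fun y hy => Real.sq_sqrt (hB0 y hy)
  have lA : MemLp (fun y => √(A y)) 2 (volume.restrict (Ioi 0)) :=
    (memLp_two_iff_integrable_sq mA).2
      ((integrableOn_congr_fun eA measurableSet_Ioi).2 hA)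
  have lB : MemLp (fun y => √(B y)) 2 (volume.restrict (Ioi 0)) :=
    (memLp_two_iff_integrable_sq mB).2
      ((integrableOn_congr_fun eB measurableSet_Ioi).2 hB)
  refine ⟨lA.integrable_mul lB, ?_⟩
  have := integral_mul_le_Lp_mul_Lq_of_nonneg (μ := volume.restrict (Ioi (0:ℝ)))
    (f := fun y => √(A y)) (g := fun y => √(B y)) Real.HolderConjugate.two_two
    (Eventually.of_forall fun y => Real.sqrt_nonneg _)
    (Eventually.of_forall fun y => Real.sqrt_nonneg _) (by simpa using lA) (by simpa using lB)
  refine this.trans (le_of_eq ?_)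
  rw [← Real.sqrt_eq_rpow, ← Real.sqrt_eq_rpow]
  congr 2
  · exact setIntegral_congr_fun measurableSet_Ioi (fun y hy => by simpa using eA y hy)
  · exact setIntegral_congr_fun measurableSet_Ioi (fun y hy => by simpa using eB y hy)

lemma lip0 {ψ : ℝ → ℂ} (hψ : ContDiff ℝ 1 ψ) (h0 : ψ 0 = 0) :
    ∃ C : ℝ, 0 ≤ C ∧ ∀ y ∈ Icc (0:ℝ) 1, ‖ψ y‖ ≤ C * y := by
  have hcd : Continuous (deriv ψ) := hψ.continuous_deriv le_rfl
  obtain ⟨C, hC⟩ := (isCompact_Icc (a := (0:ℝ)) (b := 1)).exists_bound_of_continuousOn hcd.continuousOn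
  refine ⟨C, (norm_nonneg _).trans (hC 0 (by simp)), fun y hy => ?_⟩
  have := (convex_Icc (0:ℝ) 1).norm_image_sub_le_of_norm_deriv_le (f := ψ) (x := 0) (y := y)
    (fun x _ => hψ.differentiable one_ne_zero x) hC (by simp) hy
  simpa [h0, abs_of_nonneg hy.1] using this

lemma ContDiff.ml2_meas {f : ℝ → ℂ} (hf : Continuous f) :
    AEStronglyMeasurable (fun y => ‖f y‖ ^ 2) (volume.restrict (Ioi (0:ℝ))) :=
  (by fun_prop : Continuous (fun y => ‖f y‖ ^ 2)).aestronglyMeasurable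

lemma hardy {ψ : ℝ → ℂ} (hψ : ContDiff ℝ 1 ψ) (h0 : ψ 0 = 0)
    (hi : IntegrableOn (fun y => ‖ψ y‖ ^ 2) (Ioi 0))
    (hi' : IntegrableOn (fun y => ‖deriv ψ y‖ ^ 2) (Ioi 0))
    (hT : Tendsto ψ atTop (nhds 0)) :
    IntegrableOn (fun y => ‖ψ y‖ ^ 2 / y ^ 2) (Ioi 0) ∧
    ∫ y in Ioi (0:ℝ), ‖ψ y‖ ^ 2 / y ^ 2 ≤ 4 * ∫ y in Ioi (0:ℝ), ‖deriv ψ y‖ ^ 2 := by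
  obtain ⟨C, hC0, hC⟩ := lip0 hψ h0
  have hcont := hψ.continuous
  have hco : ContinuousOn (fun y => ‖ψ y‖ ^ 2 / y ^ 2) (Ioi (0:ℝ)) :=
    ContinuousOn.div (by fun_prop) (by fun_prop) (fun y hy => pow_ne_zero _ (ne_of_gt hy))
  have I1 : IntegrableOn (fun y => ‖ψ y‖ ^ 2 / y ^ 2) (Ioi 0) := by
    rw [← Ioc_union_Ioi_eq_Ioi (zero_le_one' ℝ)]
    refine IntegrableOn.union ?_ ?_
    · refine Integrable.mono' (g := fun _ => C ^ 2) (integrableOn_const (by simp))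
        ((hco.mono Ioc_subset_Ioi_self).aestronglyMeasurable measurableSet_Ioc) ?_
      refine (ae_restrict_iff' measurableSet_Ioc).2 (Eventually.of_forall fun y hy => ?_)
      have h2 := hC y ⟨hy.1.le, hy.2⟩
      rw [Real.norm_of_nonneg (by positivity), div_le_iff₀ (by have := hy.1; positivity), ← mul_pow]
      gcongr
    · refine (hi.mono_set (Ioi_subset_Ioi zero_le_one)).mono'
        ((hco.mono (Ioi_subset_Ioi zero_le_one)).aestronglyMeasurable measurableSet_Ioi) ?_
      refine (ae_restrict_iff' measurableSet_Ioi).2 (Eventually.of_forall fun y hy => ?_)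
      have hy1 : (1:ℝ) < y := hy
      rw [Real.norm_of_nonneg (by positivity)]
      exact div_le_self (by positivity) (one_le_pow₀ hy1.le)
  refine ⟨I1, ?_⟩
  have key := flux_le (g := fun y => ‖ψ y‖ ^ 2 / y)
    (g' := fun y => (2 * inner ℝ (ψ y) (deriv ψ y) * y - ‖ψ y‖ ^ 2 * 1) / y ^ 2)
    (φ := fun y => 2 * ‖deriv ψ y‖ ^ 2 - 1 / 2 * (‖ψ y‖ ^ 2 / y ^ 2)) ?_ ?_ ?_ ?_ ?_ ?_
  · rw [integral_sub (hi'.const_mul 2) (I1.const_mul _), integral_const_mul, integral_const_mul] at key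
    linarith
  · intro y hy
    rcases eq_or_lt_of_le (show (0:ℝ) ≤ y from hy) with rfl | hy0
    · have : Tendsto (fun y => ‖ψ y‖ ^ 2 / y) (nhdsWithin 0 (Ici (0:ℝ))) (nhds 0) := by
        have h1 : Tendsto (fun y : ℝ => C ^ 2 * y) (nhdsWithin 0 (Ici (0:ℝ))) (nhds 0) := by
          have : Continuous (fun y : ℝ => C ^ 2 * y) := by fun_prop
          simpa using (this.tendsto 0).mono_left (nhdsWithin_le_nhds (s := Ici (0:ℝ)))
        refine squeeze_zero' ?_ ?_ h1
        · filter_upwards [self_mem_nhdsWithin] with y hy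
          have : (0:ℝ) ≤ y := hy
          positivity
        · filter_upwards [Icc_mem_nhdsGE (zero_lt_one' ℝ)] with y hy
          rcases eq_or_lt_of_le hy.1 with rfl | hy0
          · simp
          · rw [div_le_iff₀ hy0]
            have := hC y hy
            calc ‖ψ y‖ ^ 2 ≤ (C * y) ^ 2 := by gcongr
              _ = _ := by ring
      simpa [ContinuousWithinAt] using this
    · exact (ContinuousAt.div (by fun_prop) (by fun_prop) hy0.ne').continuousWithinAt
  · intro y hy
    exact ((hψ.differentiable one_ne_zero y).hasDerivAt.norm_sq).div (hasDerivAt_id y) hy.ne'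
  · exact (hi'.const_mul 2).sub (I1.const_mul _)
  · intro y hy
    have h1 : inner ℝ (ψ y) (deriv ψ y) ≤ ‖ψ y‖ * ‖deriv ψ y‖ := real_inner_le_norm _ _
    rw [div_le_iff₀ (by positivity)]
    have e : (2 * ‖deriv ψ y‖ ^ 2 - 1 / 2 * (‖ψ y‖ ^ 2 / y ^ 2)) * y ^ 2 =
      2 * (‖deriv ψ y‖ * y) ^ 2 - 1 / 2 * ‖ψ y‖ ^ 2 := by field_simp
    rw [e]
    nlinarith [sq_nonneg (2 * (‖deriv ψ y‖ * y) - ‖ψ y‖), mul_le_mul_of_nonneg_right h1 hy.le]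
  · simp
  · have h1 : Tendsto (fun y => ‖ψ y‖ ^ 2 / y) atTop (nhds (‖(0:ℂ)‖ ^ 2 * 0)) :=
      (hT.norm.pow 2).mul tendsto_inv_atTop_zero
    simpa using h1


lemma interp {f : ℝ → ℂ} (hf : ContDiff ℝ 1 f)
    (hi : IntegrableOn (fun y => ‖f y‖ ^ 2) (Ioi 0))
    (hi' : IntegrableOn (fun y => ‖deriv f y‖ ^ 2) (Ioi 0))
    (hT : Tendsto f atTop (nhds 0)) {ω : ℝ → ℝ} {Γ K t : ℝ} (ht : 0 < t) (htK : t ≤ K)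
    (hω : ∀ y, 0 < y → y * (K / (K + y)) ≤ Γ * ω y)
    (hiω : IntegrableOn (fun y => ω y * ‖f y‖ ^ 2) (Ioi 0)) :
    ∫ y in Ioi (0:ℝ), ‖f y‖ ^ 2 ≤
      2 * t * (√(∫ y in Ioi (0:ℝ), ‖f y‖ ^ 2) * √(∫ y in Ioi (0:ℝ), ‖deriv f y‖ ^ 2))
      + 2 * Γ / t * ∫ y in Ioi (0:ℝ), ω y * ‖f y‖ ^ 2 := by
  have hcont := hf.continuous
  obtain ⟨J1, J2⟩ := cs_int hi hi' (fun y _ => by positivity) (fun y _ => by positivity)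
  have I1 : IntegrableOn (fun y => (2 * t) * (√(‖f y‖ ^ 2) * √(‖deriv f y‖ ^ 2))
      + (2 * Γ / t) * (ω y * ‖f y‖ ^ 2)) (Ioi 0) := (J1.const_mul _).add (hiω.const_mul _)
  have key := flux_le (g := fun y => -(t * y / (t + y) * ‖f y‖ ^ 2))
    (g' := fun y => -(((t * 1) * (t + y) - t * y * 1) / (t + y) ^ 2 * ‖f y‖ ^ 2
        + t * y / (t + y) * (2 * inner ℝ (f y) (deriv f y))))
    (φ := fun y => ((2 * t) * (√(‖f y‖ ^ 2) * √(‖deriv f y‖ ^ 2))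
      + (2 * Γ / t) * (ω y * ‖f y‖ ^ 2)) - ‖f y‖ ^ 2) ?_ ?_ ?_ ?_ ?_ ?_
  · rw [integral_sub I1 hi, integral_add (J1.const_mul _) (hiω.const_mul _),
      integral_const_mul, integral_const_mul] at key
    have := mul_le_mul_of_nonneg_left J2 (by positivity : 0 ≤ 2 * t)
    linarith
  · refine ContinuousOn.neg (ContinuousOn.mul (ContinuousOn.div (by fun_prop) (by fun_prop) ?_) (by fun_prop))
    intro y hy
    have : (0:ℝ) ≤ y := hy
    positivity
  · intro y hy
    have h1 : HasDerivAt (fun y : ℝ => t * y) (t * 1) y := (hasDerivAt_id y).const_mul t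
    have h2 : HasDerivAt (fun y : ℝ => t + y) 1 y := (hasDerivAt_id y).const_add t
    exact ((h1.div h2 (by positivity)).mul (hf.differentiable one_ne_zero y).hasDerivAt.norm_sq).neg
  · exact I1.sub hi
  · intro y hy
    rw [Real.sqrt_sq (norm_nonneg _), Real.sqrt_sq (norm_nonneg _)]
    have hin : -(‖f y‖ * ‖deriv f y‖) ≤ inner ℝ (f y) (deriv f y) :=
      neg_le_of_abs_le (abs_real_inner_le_norm _ _)
    have hθ0 : 0 ≤ t * y / (t + y) := by positivity
    have hθt : t * y / (t + y) ≤ t := by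
      rw [div_le_iff₀ (by positivity)]; nlinarith
    have h3 : -(t * y / (t + y) * (2 * inner ℝ (f y) (deriv f y))) ≤ 2 * t * (‖f y‖ * ‖deriv f y‖) := by
      have hp : 0 ≤ ‖f y‖ * ‖deriv f y‖ := by positivity
      nlinarith [mul_le_mul_of_nonneg_left hin hθ0, mul_le_mul_of_nonneg_right hθt hp]
    have h4 : t * y / (t + y) ≤ Γ * ω y := by
      refine le_trans ?_ (hω y hy)
      have : 0 < K := by linarith
      rw [← mul_div_assoc, div_le_div_iff₀ (by positivity) (by positivity)]
      nlinarith [mul_pos hy hy, mul_nonneg (mul_pos hy hy).le (sub_nonneg.2 htK)]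
    have h5 : 1 - ((t * 1) * (t + y) - t * y * 1) / (t + y) ^ 2 ≤ 2 / t * (t * y / (t + y)) := by
      rw [show 2 / t * (t * y / (t + y)) = 2 * y * (t + y) / (t + y) ^ 2 by field_simp,
        show 1 - ((t * 1) * (t + y) - t * y * 1) / (t + y) ^ 2 = (2 * t * y + y ^ 2) / (t + y) ^ 2 by
          field_simp; ring]
      gcongr
      nlinarith [sq_nonneg y]
    have h6 : 2 / t * (t * y / (t + y)) ≤ 2 / t * (Γ * ω y) := by gcongr
    have h7 := mul_le_mul_of_nonneg_right (h5.trans h6) (sq_nonneg ‖f y‖)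
    have e : 2 / t * (Γ * ω y) * ‖f y‖ ^ 2 = 2 * Γ / t * (ω y * ‖f y‖ ^ 2) := by ring
    linarith
  · simp
  · have h1 : Tendsto (fun y => ‖f y‖ ^ 2) atTop (nhds 0) := by simpa using hT.norm.pow 2
    have h2 : Tendsto (fun y => t * ‖f y‖ ^ 2) atTop (nhds 0) := by simpa using h1.const_mul t
    rw [← neg_zero]
    refine Tendsto.neg (squeeze_zero' ?_ ?_ h2)
    · filter_upwards [eventually_ge_atTop (0:ℝ)] with y hy
      positivity
    · filter_upwards [eventually_ge_atTop (0:ℝ)] with y hy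
      gcongr
      rw [div_le_iff₀ (by positivity)]; nlinarith

lemma log_hardy {ψ : ℝ → ℂ} (hψ : ContDiff ℝ 1 ψ) (h0 : ψ 0 = 0)
    (hi : IntegrableOn (fun y => ‖ψ y‖ ^ 2) (Ioi 0))
    (hT : Tendsto ψ atTop (nhds 0)) {ω : ℝ → ℝ} {Γ K s : ℝ} (hs : 0 < s) (hs1 : s ≤ 1) (hK : 2 ≤ K)
    (hΓ : 1 ≤ Γ)
    (hω : ∀ y, 0 < y → y * (K / (K + y)) ≤ Γ * ω y)
    (hiω : IntegrableOn (fun y => (ω y + s) * ‖deriv ψ y‖ ^ 2) (Ioi 0)) :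
    IntegrableOn (fun y => K / ((y + s) * (y + K)) * ‖ψ y‖ ^ 2) (Ioi 0) ∧
    ∫ y in Ioi (0:ℝ), K / ((y + s) * (y + K)) * ‖ψ y‖ ^ 2 ≤
      16 * Γ * (Real.log (K / s) + 1) ^ 2 * ∫ y in Ioi (0:ℝ), (ω y + s) * ‖deriv ψ y‖ ^ 2 := by
  have hcont := hψ.continuous
  have hK0 : 0 < K := by linarith
  have I1 : IntegrableOn (fun y => K / ((y + s) * (y + K)) * ‖ψ y‖ ^ 2) (Ioi 0) := by
    refine (hi.const_mul (1 / s)).mono' ?_ ?_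
    · refine ContinuousOn.aestronglyMeasurable ?_ measurableSet_Ioi
      refine ContinuousOn.mul (ContinuousOn.div (by fun_prop) (by fun_prop) ?_) (by fun_prop)
      intro y hy
      have : (0:ℝ) < y := hy
      positivity
    · refine (ae_restrict_iff' measurableSet_Ioi).2 (Eventually.of_forall fun y hy => ?_)
      have hy1 : (0:ℝ) < y := hy
      rw [Real.norm_of_nonneg (by positivity)]
      refine mul_le_mul_of_nonneg_right ?_ (by positivity)
      rw [div_le_div_iff₀ (by positivity) hs]
      nlinarith [mul_pos hy1 hs, mul_pos hy1 hK0, mul_pos hy1 hy1]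
  refine ⟨I1, ?_⟩
  have key := flux_le (g := fun y => (Real.log (y + K) - Real.log (y + s)) * ‖ψ y‖ ^ 2)
    (g' := fun y => (1 / (y + K) - 1 / (y + s)) * ‖ψ y‖ ^ 2
        + (Real.log (y + K) - Real.log (y + s)) * (2 * inner ℝ (ψ y) (deriv ψ y)))
    (φ := fun y => (4 * Γ * (Real.log (K / s) + 1) ^ 2) * ((ω y + s) * ‖deriv ψ y‖ ^ 2)
      - 1 / 4 * (K / ((y + s) * (y + K)) * ‖ψ y‖ ^ 2)) ?_ ?_ ?_ ?_ ?_ ?_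
  · rw [integral_sub (hiω.const_mul _) (I1.const_mul _),
      integral_const_mul, integral_const_mul] at key
    linarith
  · refine ContinuousOn.mul (ContinuousOn.sub (ContinuousOn.log (by fun_prop) ?_)
      (ContinuousOn.log (by fun_prop) ?_)) (by fun_prop)
    all_goals
      intro y hy
      have : (0:ℝ) ≤ y := hy
      positivity
  · intro y hy
    have h1 : HasDerivAt (fun y : ℝ => y + K) 1 y := (hasDerivAt_id y).add_const K
    have h2 : HasDerivAt (fun y : ℝ => y + s) 1 y := (hasDerivAt_id y).add_const s
    exact (((h1.log (by positivity)).sub (h2.log (by positivity))).mul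
      (hψ.differentiable one_ne_zero y).hasDerivAt.norm_sq)
  · exact (hiω.const_mul _).sub (I1.const_mul _)
  · intro y hy
    have hin : inner ℝ (ψ y) (deriv ψ y) ≤ ‖ψ y‖ * ‖deriv ψ y‖ := real_inner_le_norm _ _
    have hΘe : Real.log (y + K) - Real.log (y + s) = Real.log ((y + K) / (y + s)) :=
      (Real.log_div (by positivity) (by positivity)).symm
    rw [hΘe]
    set Θ := Real.log ((y + K) / (y + s)) with hΘ
    have hΘ0 : 0 ≤ Θ := Real.log_nonneg (by rw [le_div_iff₀ (by positivity)]; linarith)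
    have hΘ1 : Θ ≤ Real.log (K / s) := by
      refine Real.log_le_log (by positivity) ?_
      rw [div_le_div_iff₀ (by positivity) hs]
      nlinarith
    have hΘ2 : Θ * (y / K) ≤ 1 := by
      have h1 : Θ ≤ (y + K) / (y + s) - 1 := Real.log_le_sub_one_of_pos (by positivity)
      have h2 : (y + K) / (y + s) - 1 ≤ K / y := by
        rw [show (y + K) / (y + s) - 1 = (K - s) / (y + s) by field_simp; ring,
          div_le_div_iff₀ (by positivity) hy]
        nlinarith [mul_pos hy hs, mul_pos hK0 hs]
      calc Θ * (y / K) ≤ K / y * (y / K) := by gcongr; exact h1.trans h2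
        _ = 1 := by field_simp
    set Lg := Real.log (K / s)
    set m := K / ((y + s) * (y + K)) with hm
    have hm0 : 0 < m := by positivity
    have hm1 : 1 / (y + K) - 1 / (y + s) ≤ - (1 / 2) * m := by
      rw [hm, show 1 / (y + K) - 1 / (y + s) = (s - K) / ((y + s) * (y + K)) by field_simp; ring,
        ← mul_div_assoc]
      gcongr
      linarith
    have hA : Θ ^ 2 ≤ m * (Γ * (Lg + 1) ^ 2 * (ω y + s)) := by
      have h1 : Θ * (1 + y / K) ≤ Lg + 1 := by linarith
      have h2 : (Θ * (1 + y / K)) ^ 2 ≤ (Lg + 1) ^ 2 := by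
        gcongr
      have h3 : (y + s) * (K / (K + y)) ≤ Γ * (ω y + s) := by
        have : s * (K / (K + y)) ≤ Γ * s := by
          have : K / (K + y) ≤ 1 := by rw [div_le_one (by positivity)]; linarith
          nlinarith
        linarith [hω y hy]
      have h4 : Θ ^ 2 = m * ((Θ * (1 + y / K)) ^ 2 * ((y + s) * (K / (K + y)))) := by
        rw [hm]; field_simp; ring
      rw [h4, show Γ * (Lg + 1) ^ 2 * (ω y + s) = (Lg + 1) ^ 2 * (Γ * (ω y + s)) by ring]
      gcongr
    have hB : Θ * (2 * inner ℝ (ψ y) (deriv ψ y)) ≤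
        1 / 4 * (m * ‖ψ y‖ ^ 2) + 4 * (Γ * (Lg + 1) ^ 2 * (ω y + s)) * ‖deriv ψ y‖ ^ 2 := by
      have h1 : Θ * (2 * inner ℝ (ψ y) (deriv ψ y)) ≤ 2 * Θ * (‖ψ y‖ * ‖deriv ψ y‖) := by
        nlinarith [mul_le_mul_of_nonneg_left hin hΘ0]
      set Q := Γ * (Lg + 1) ^ 2 * (ω y + s)
      have h2 : Θ ^ 2 * ‖deriv ψ y‖ ^ 2 ≤ m * Q * ‖deriv ψ y‖ ^ 2 := by gcongr
      have h3 : 0 ≤ m * (1 / 4 * (m * ‖ψ y‖ ^ 2) + 4 * Q * ‖deriv ψ y‖ ^ 2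
          - 2 * Θ * (‖ψ y‖ * ‖deriv ψ y‖)) := by
        nlinarith [sq_nonneg (1 / 2 * m * ‖ψ y‖ - 2 * Θ * ‖deriv ψ y‖)]
      have h4 := nonneg_of_mul_nonneg_right h3 hm0
      linarith
    have h5 := mul_le_mul_of_nonneg_right hm1 (sq_nonneg ‖ψ y‖)
    have e : 4 * Γ * (Lg + 1) ^ 2 * ((ω y + s) * ‖deriv ψ y‖ ^ 2) =
      4 * (Γ * (Lg + 1) ^ 2 * (ω y + s)) * ‖deriv ψ y‖ ^ 2 := by ring
    rw [e]
    linarith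
  · simp [h0]
  · have h1 : Tendsto (fun y => ‖ψ y‖ ^ 2) atTop (nhds 0) := by simpa using hT.norm.pow 2
    have h2 : Tendsto (fun y => Real.log (K / s) * ‖ψ y‖ ^ 2) atTop (nhds 0) := by
      simpa using h1.const_mul (Real.log (K / s))
    refine squeeze_zero' ?_ ?_ h2
    · filter_upwards [eventually_ge_atTop (0:ℝ)] with y hy
      have : Real.log (y + s) ≤ Real.log (y + K) := Real.log_le_log (by positivity) (by linarith)
      have := sub_nonneg.2 this
      positivity
    · filter_upwards [eventually_ge_atTop (0:ℝ)] with y hy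
      gcongr
      rw [← Real.log_div (by positivity) (by positivity)]
      refine Real.log_le_log (by positivity) ?_
      rw [div_le_div_iff₀ (by positivity) hs]
      nlinarith


structure Sys where
  (μ κ Γ M ε nt K : ℝ)
  (b b1 G G1 ω ω1 ω2 χ χ1 χ2 τ R2 : ℝ → ℝ)
  (φ ψ u v h g p F1 F2 F3 F4 : ℝ → ℂ)
  hμ0 : 0 < μ
  hκ0 : 0 < κ
  hΓ : 1 ≤ Γ
  hμ : μ ≤ Γ
  hκ : κ ≤ Γ
  hμ' : 1 ≤ Γ * μ
  hκ' : 1 ≤ Γ * κ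
  hM : 0 ≤ M
  hε0 : 0 < ε
  hε1 : ε ≤ 1
  hnt : nt ≠ 0
  hK : 2 ≤ K
  -- derivative relations
  dG : ∀ y, 0 < y → HasDerivAt G (G1 y) y
  db : ∀ y, 0 < y → HasDerivAt b (b1 y) y
  dω : ∀ y, 0 < y → HasDerivAt ω (ω1 y) y
  dω1 : ∀ y, 0 < y → HasDerivAt ω1 (ω2 y) y
  dχ : ∀ y, 0 < y → HasDerivAt χ (χ1 y) y
  dχ1 : ∀ y, 0 < y → HasDerivAt χ1 (χ2 y) y
  cG : ContinuousOn G (Ici 0)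
  cb : ContinuousOn b (Ici 0)
  cω : ContinuousOn ω (Ici 0)
  cω1 : ContinuousOn ω1 (Ici 0)
  cχ : ContinuousOn χ (Ici 0)
  cχ1 : ContinuousOn χ1 (Ici 0)
  ω_zero : ω 0 = 0
  Gω1 : ∀ y, 0 ≤ y → G y * ω1 y = χ y
  -- bounds
  ω_nn : ∀ y, 0 ≤ y → 0 ≤ ω y
  ω_bdd : ∃ B, ∀ y, 0 ≤ y → ω y ≤ B
  ω_le : ∀ y, 0 ≤ y → ω y ≤ Γ * y
  ω_low : ∀ y, 0 < y → y * (K / (K + y)) ≤ Γ * ω y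
  ω1_nn : ∀ y, 0 ≤ y → 0 ≤ ω1 y
  ω1_le : ∀ y, 0 ≤ y → ω1 y ≤ Γ * χ y
  ω2_le : ∀ y, 0 < y → |ω2 y| ≤ Γ * (|nt| + M / y)
  χ_nn : ∀ y, 0 ≤ y → 0 ≤ χ y
  χ_le : ∀ y, 0 ≤ y → χ y ≤ 1
  χ_le' : ∀ y, 0 ≤ y → χ y ≤ K / (K + y)
  χ1_np : ∀ y, 0 ≤ y → χ1 y ≤ 0
  χ1_le : ∀ y, 0 ≤ y → -χ1 y ≤ 2 * |nt| * χ y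
  χ2_le : ∀ y, 0 < y → |χ2 y| ≤ 6 * nt ^ 2
  b_le : ∀ y, 0 ≤ y → |b y| ≤ Γ
  b1_le : ∀ y, 0 < y → |b1 y| * y ≤ Γ * M
  G_low : ∀ y, 0 ≤ y → 1 ≤ Γ * G y
  G_le : ∀ y, 0 ≤ y → G y ≤ Γ
  G1_le : ∀ y, 0 < y → |G1 y| * y ≤ Γ * M
  G1_le' : ∀ y, 0 < y → |G1 y| * √ε ≤ Γ * M
  τ_nn : ∀ y, 0 < y → 0 ≤ τ y
  τ_le : ∀ y, 0 < y → τ y ≤ 1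
  τ_le' : ∀ y, 0 < y → τ y * y ≤ √ε
  -- unknowns
  cu : ContDiff ℝ 2 u
  cv : ContDiff ℝ 2 v
  ch : ContDiff ℝ 2 h
  cg : ContDiff ℝ 2 g
  cφ : ContDiff ℝ 1 φ
  cψ : ContDiff ℝ 1 ψ
  cp : ContDiff ℝ 1 p
  vφ : ∀ y, v y = -(Complex.I * nt) * φ y
  gψ : ∀ y, g y = -(Complex.I * nt) * ψ y
  dφ : ∀ y, 0 < y → HasDerivAt φ (u y) y
  dψ : ∀ y, 0 < y → HasDerivAt ψ (h y) y
  u0 : u 0 = 0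
  φ0 : φ 0 = 0
  ψ0 : ψ 0 = 0
  h0 : deriv h 0 = 0
  iu : IntegrableOn (fun y => ‖u y‖ ^ 2) (Ioi 0)
  iv : IntegrableOn (fun y => ‖v y‖ ^ 2) (Ioi 0)
  ih : IntegrableOn (fun y => ‖h y‖ ^ 2) (Ioi 0)
  ig : IntegrableOn (fun y => ‖g y‖ ^ 2) (Ioi 0)
  iu' : IntegrableOn (fun y => ‖deriv u y‖ ^ 2) (Ioi 0)
  iv' : IntegrableOn (fun y => ‖deriv v y‖ ^ 2) (Ioi 0)
  ih' : IntegrableOn (fun y => ‖deriv h y‖ ^ 2) (Ioi 0)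
  ig' : IntegrableOn (fun y => ‖deriv g y‖ ^ 2) (Ioi 0)
  tW : Tendsto (fun y => ‖u y‖ + ‖v y‖ + ‖h y‖ + ‖g y‖) atTop (nhds 0)
  tW' : Tendsto (fun y => ‖deriv u y‖ + ‖deriv v y‖ + ‖deriv h y‖ + ‖deriv g y‖) atTop (nhds 0)
  tp : Tendsto (fun y => ‖p y‖ * (‖u y‖ + ‖v y‖ + ‖h y‖ + ‖g y‖)) atTop (nhds 0)
  iR : IntegrableOn R2 (Ioi 0)
  R_nn : ∀ y, 0 ≤ R2 y
  e1 : ∀ y, 0 < y → F1 y = Complex.I * nt * (b y * u y - G y * h y) + Complex.I * nt * p y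
    - (μ * ε : ℝ) * (deriv (deriv u) y - (nt : ℂ) ^ 2 * u y)
  e2 : ∀ y, 0 < y → F2 y = Complex.I * nt * (b y * v y - G y * g y) + deriv p y
    - (μ * ε : ℝ) * (deriv (deriv v) y - (nt : ℂ) ^ 2 * v y)
  e3 : ∀ y, 0 < y → F3 y = -(Complex.I * nt * u y)
    - (κ * ε : ℝ) * (deriv (deriv h) y - (nt : ℂ) ^ 2 * h y)
  e4 : ∀ y, 0 < y → F4 y = -(Complex.I * nt * v y)
    - (κ * ε : ℝ) * (deriv (deriv g) y - (nt : ℂ) ^ 2 * g y)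

namespace Sys
variable (S : Sys)

def W2 (y : ℝ) : ℝ := ‖S.u y‖ ^ 2 + ‖S.v y‖ ^ 2 + ‖S.h y‖ ^ 2 + ‖S.g y‖ ^ 2
def D2 (y : ℝ) : ℝ :=
  ‖deriv S.u y‖ ^ 2 + ‖deriv S.v y‖ ^ 2 + ‖deriv S.h y‖ ^ 2 + ‖deriv S.g y‖ ^ 2
def d2 (y : ℝ) : ℝ := S.D2 y + S.nt ^ 2 * S.W2 y
def q2 (y : ℝ) : ℝ := S.W2 y + (‖S.φ y‖ ^ 2 + ‖S.ψ y‖ ^ 2) / y ^ 2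

lemma W2_nn (y : ℝ) : 0 ≤ S.W2 y := by unfold W2; positivity
lemma D2_nn (y : ℝ) : 0 ≤ S.D2 y := by unfold D2; positivity
lemma d2_nn (y : ℝ) : 0 ≤ S.d2 y := by
  have := S.W2_nn y; have := S.D2_nn y; unfold d2; positivity
lemma q2_nn (y : ℝ) : 0 ≤ S.q2 y := by
  have := S.W2_nn y; unfold q2; positivity

lemma iW2 : IntegrableOn S.W2 (Ioi 0) := ((S.iu.add S.iv).add S.ih).add S.ig
lemma iD2 : IntegrableOn S.D2 (Ioi 0) := ((S.iu'.add S.iv').add S.ih').add S.ig'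
lemma id2 : IntegrableOn S.d2 (Ioi 0) := S.iD2.add (S.iW2.const_mul _)

lemma tu : Tendsto (fun y => ‖S.u y‖) atTop (nhds 0) :=
  squeeze_zero (fun _ => norm_nonneg _) (fun y => by
    have := norm_nonneg (S.v y); have := norm_nonneg (S.h y); have := norm_nonneg (S.g y)
    linarith) S.tW
lemma tv : Tendsto (fun y => ‖S.v y‖) atTop (nhds 0) :=
  squeeze_zero (fun _ => norm_nonneg _) (fun y => by
    have := norm_nonneg (S.u y); have := norm_nonneg (S.h y); have := norm_nonneg (S.g y)
    linarith) S.tW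
lemma th : Tendsto (fun y => ‖S.h y‖) atTop (nhds 0) :=
  squeeze_zero (fun _ => norm_nonneg _) (fun y => by
    have := norm_nonneg (S.v y); have := norm_nonneg (S.u y); have := norm_nonneg (S.g y)
    linarith) S.tW
lemma tg : Tendsto (fun y => ‖S.g y‖) atTop (nhds 0) :=
  squeeze_zero (fun _ => norm_nonneg _) (fun y => by
    have := norm_nonneg (S.v y); have := norm_nonneg (S.h y); have := norm_nonneg (S.u y)
    linarith) S.tW

lemma N_pos : 0 < |S.nt| := abs_pos.2 S.hnt

lemma nv (y : ℝ) : ‖S.v y‖ = |S.nt| * ‖S.φ y‖ := by rw [S.vφ]; simp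
lemma ng (y : ℝ) : ‖S.g y‖ = |S.nt| * ‖S.ψ y‖ := by rw [S.gψ]; simp

lemma tφ : Tendsto S.φ atTop (nhds 0) := by
  rw [tendsto_zero_iff_norm_tendsto_zero]
  have := S.tv.const_mul (|S.nt|⁻¹)
  rw [mul_zero] at this
  refine this.congr fun y => ?_
  rw [S.nv, inv_mul_cancel_left₀ S.N_pos.ne']
lemma tψ : Tendsto S.ψ atTop (nhds 0) := by
  rw [tendsto_zero_iff_norm_tendsto_zero]
  have := S.tg.const_mul (|S.nt|⁻¹)
  rw [mul_zero] at this
  refine this.congr fun y => ?_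
  rw [S.ng, inv_mul_cancel_left₀ S.N_pos.ne']
lemma iφ : IntegrableOn (fun y => ‖S.φ y‖ ^ 2) (Ioi 0) := by
  refine (S.iv.const_mul ((|S.nt|⁻¹) ^ 2)).congr (Eventually.of_forall fun y => ?_)
  simp only
  rw [← mul_pow, S.nv, inv_mul_cancel_left₀ S.N_pos.ne']
lemma iψ : IntegrableOn (fun y => ‖S.ψ y‖ ^ 2) (Ioi 0) := by
  refine (S.ig.const_mul ((|S.nt|⁻¹) ^ 2)).congr (Eventually.of_forall fun y => ?_)
  simp only
  rw [← mul_pow, S.ng, inv_mul_cancel_left₀ S.N_pos.ne']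

lemma hardyφ : IntegrableOn (fun y => ‖S.φ y‖ ^ 2 / y ^ 2) (Ioi 0) ∧
    ∫ y in Ioi (0:ℝ), ‖S.φ y‖ ^ 2 / y ^ 2 ≤ 4 * ∫ y in Ioi (0:ℝ), ‖S.u y‖ ^ 2 := by
  have e : ∀ y ∈ Ioi (0:ℝ), ‖deriv S.φ y‖ ^ 2 = ‖S.u y‖ ^ 2 := fun y hy => by
    rw [(S.dφ y hy).deriv]
  have := hardy S.cφ S.φ0 S.iφ ((integrableOn_congr_fun e measurableSet_Ioi).2 S.iu) S.tφ
  rwa [setIntegral_congr_fun measurableSet_Ioi e] at this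
lemma hardyψ : IntegrableOn (fun y => ‖S.ψ y‖ ^ 2 / y ^ 2) (Ioi 0) ∧
    ∫ y in Ioi (0:ℝ), ‖S.ψ y‖ ^ 2 / y ^ 2 ≤ 4 * ∫ y in Ioi (0:ℝ), ‖S.h y‖ ^ 2 := by
  have e : ∀ y ∈ Ioi (0:ℝ), ‖deriv S.ψ y‖ ^ 2 = ‖S.h y‖ ^ 2 := fun y hy => by
    rw [(S.dψ y hy).deriv]
  have := hardy S.cψ S.ψ0 S.iψ ((integrableOn_congr_fun e measurableSet_Ioi).2 S.ih) S.tψ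
  rwa [setIntegral_congr_fun measurableSet_Ioi e] at this

lemma q2_eq : S.q2 = fun y => S.W2 y + (‖S.φ y‖ ^ 2 / y ^ 2 + ‖S.ψ y‖ ^ 2 / y ^ 2) := by
  funext y; unfold q2; ring

lemma iq2 : IntegrableOn S.q2 (Ioi 0) := by
  rw [q2_eq]
  exact S.iW2.add (S.hardyφ.1.add S.hardyψ.1)

lemma intq2 : ∫ y in Ioi (0:ℝ), S.q2 y ≤ 5 * ∫ y in Ioi (0:ℝ), S.W2 y := by
  have I : IntegrableOn (fun y => ‖S.φ y‖ ^ 2 / y ^ 2 + ‖S.ψ y‖ ^ 2 / y ^ 2) (Ioi 0) :=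
    S.hardyφ.1.add S.hardyψ.1
  rw [q2_eq]
  simp only
  rw [integral_add S.iW2 I, integral_add S.hardyφ.1 S.hardyψ.1]
  have h1 : ∫ y in Ioi (0:ℝ), (‖S.u y‖ ^ 2 + ‖S.h y‖ ^ 2) ≤ ∫ y in Ioi (0:ℝ), S.W2 y := by
    refine setIntegral_mono_on (S.iu.add S.ih) S.iW2 measurableSet_Ioi fun y _ => ?_
    unfold W2
    nlinarith [norm_nonneg (S.v y), norm_nonneg (S.g y)]
  rw [integral_add S.iu S.ih] at h1
  linarith [S.hardyφ.2, S.hardyψ.2]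

-- pointwise
lemma W_le {y : ℝ} : ‖S.u y‖ ≤ √(S.W2 y) ∧ ‖S.v y‖ ≤ √(S.W2 y) ∧ ‖S.h y‖ ≤ √(S.W2 y) ∧
    ‖S.g y‖ ≤ √(S.W2 y) := by
  refine ⟨?_, ?_, ?_, ?_⟩ <;>
  · refine Real.le_sqrt_of_sq_le ?_
    unfold W2
    linarith [sq_nonneg ‖S.u y‖, sq_nonneg ‖S.v y‖, sq_nonneg ‖S.h y‖, sq_nonneg ‖S.g y‖]

lemma Wq {y : ℝ} : √(S.W2 y) ≤ √(S.q2 y) := by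
  refine Real.sqrt_le_sqrt ?_
  unfold q2
  have : 0 ≤ (‖S.φ y‖ ^ 2 + ‖S.ψ y‖ ^ 2) / y ^ 2 := by positivity
  linarith

lemma φq {y : ℝ} (hy : 0 < y) : ‖S.φ y‖ ≤ y * √(S.q2 y) := by
  have : ‖S.φ y‖ / y ≤ √(S.q2 y) := by
    refine Real.le_sqrt_of_sq_le ?_
    unfold q2
    have := S.W2_nn y
    have : 0 ≤ ‖S.ψ y‖ ^ 2 / y ^ 2 := by positivity
    rw [div_pow, add_div]; linarith
  rwa [div_le_iff₀' hy] at this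
lemma ψq {y : ℝ} (hy : 0 < y) : ‖S.ψ y‖ ≤ y * √(S.q2 y) := by
  have : ‖S.ψ y‖ / y ≤ √(S.q2 y) := by
    refine Real.le_sqrt_of_sq_le ?_
    unfold q2
    have := S.W2_nn y
    have : 0 ≤ ‖S.φ y‖ ^ 2 / y ^ 2 := by positivity
    rw [div_pow, add_div]; linarith
  rwa [div_le_iff₀' hy] at this

lemma d_le {y : ℝ} : ‖deriv S.u y‖ ≤ √(S.d2 y) ∧ ‖deriv S.v y‖ ≤ √(S.d2 y) ∧
    ‖deriv S.h y‖ ≤ √(S.d2 y) ∧ ‖deriv S.g y‖ ≤ √(S.d2 y) := by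
  have := S.W2_nn y
  have h1 : 0 ≤ S.nt ^ 2 * S.W2 y := by positivity
  refine ⟨?_, ?_, ?_, ?_⟩ <;>
  · refine Real.le_sqrt_of_sq_le ?_
    unfold d2 D2
    linarith [sq_nonneg ‖deriv S.u y‖, sq_nonneg ‖deriv S.v y‖, sq_nonneg ‖deriv S.h y‖,
      sq_nonneg ‖deriv S.g y‖]

lemma Nd_le {y : ℝ} : |S.nt| * ‖S.u y‖ ≤ √(S.d2 y) ∧ |S.nt| * ‖S.v y‖ ≤ √(S.d2 y) ∧
    |S.nt| * ‖S.h y‖ ≤ √(S.d2 y) ∧ |S.nt| * ‖S.g y‖ ≤ √(S.d2 y) := by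
  have := S.D2_nn y
  refine ⟨?_, ?_, ?_, ?_⟩ <;>
  · refine Real.le_sqrt_of_sq_le ?_
    rw [mul_pow, sq_abs]
    unfold d2
    refine le_add_of_nonneg_of_le this (mul_le_mul_of_nonneg_left ?_ (sq_nonneg _))
    unfold W2
    linarith [sq_nonneg ‖S.u y‖, sq_nonneg ‖S.v y‖, sq_nonneg ‖S.h y‖, sq_nonneg ‖S.g y‖]

lemma dv {y : ℝ} (hy : 0 < y) : deriv S.v y = -(Complex.I * S.nt) * S.u y := by
  have : S.v = fun y => -(Complex.I * S.nt) * S.φ y := funext S.vφ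
  rw [this]; exact ((S.dφ y hy).const_mul _).deriv
lemma dg {y : ℝ} (hy : 0 < y) : deriv S.g y = -(Complex.I * S.nt) * S.h y := by
  have : S.g = fun y => -(Complex.I * S.nt) * S.ψ y := funext S.gψ
  rw [this]; exact ((S.dψ y hy).const_mul _).deriv
lemma v0 : S.v 0 = 0 := by rw [S.vφ, S.φ0, mul_zero]
lemma g0 : S.g 0 = 0 := by rw [S.gψ, S.ψ0, mul_zero]

end Sys

namespace Sys
variable (S : Sys)

def flux (T1 T2 T3 T4 : ℝ → ℂ) (y : ℝ) : ℂ :=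
  S.p y * conj (T2 y)
    - (S.μ * S.ε : ℝ) * (deriv S.u y * conj (T1 y) + deriv S.v y * conj (T2 y))
    - (S.κ * S.ε : ℝ) * (deriv S.h y * conj (T3 y) + deriv S.g y * conj (T4 y))

lemma hasDerivAt_conj {f : ℝ → ℂ} {f' : ℂ} {y : ℝ} (h : HasDerivAt f f' y) :
    HasDerivAt (fun y => conj (f y)) (conj f') y := h.star

lemma hasDerivAt_re {f : ℝ → ℂ} {f' : ℂ} {y : ℝ} (h : HasDerivAt f f' y) :
    HasDerivAt (fun y => (f y).re) f'.re y :=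
  (Complex.reCLM.hasFDerivAt.comp_hasDerivAt y h)

lemma test {T1 T2 T3 T4 T1' T3' T4' : ℝ → ℂ} {c c' Q : ℝ → ℝ} {B : ℝ}
    (C1 : ContinuousOn T1 (Ici 0)) (C2 : ContinuousOn T2 (Ici 0)) (C3 : ContinuousOn T3 (Ici 0))
    (C4 : ContinuousOn T4 (Ici 0))
    (D1 : ∀ y, 0 < y → HasDerivAt T1 (T1' y) y)
    (D2 : ∀ y, 0 < y → HasDerivAt T2 (-(Complex.I * S.nt) * T1 y) y)
    (D3 : ∀ y, 0 < y → HasDerivAt T3 (T3' y) y)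
    (D4 : ∀ y, 0 < y → HasDerivAt T4 (T4' y) y)
    (Z1 : T1 0 = 0) (Z2 : T2 0 = 0) (Z4 : T4 0 = 0)
    (B1 : ∀ y, 0 ≤ y → ‖T1 y‖ ≤ B * (‖S.u y‖ + ‖S.v y‖ + ‖S.h y‖ + ‖S.g y‖))
    (B2 : ∀ y, 0 ≤ y → ‖T2 y‖ ≤ B * (‖S.u y‖ + ‖S.v y‖ + ‖S.h y‖ + ‖S.g y‖))
    (B3 : ∀ y, 0 ≤ y → ‖T3 y‖ ≤ B * (‖S.u y‖ + ‖S.v y‖ + ‖S.h y‖ + ‖S.g y‖))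
    (B4 : ∀ y, 0 ≤ y → ‖T4 y‖ ≤ B * (‖S.u y‖ + ‖S.v y‖ + ‖S.h y‖ + ‖S.g y‖))
    (Cc : ContinuousOn c (Ici 0)) (Dc : ∀ y, 0 < y → HasDerivAt c (c' y) y) (c0 : c 0 = 0)
    (ct : Tendsto c atTop (nhds 0)) (iQ : IntegrableOn Q (Ioi 0))
    (hQ : ∀ y, 0 < y →
      (S.F1 y * conj (T1 y) + S.F2 y * conj (T2 y) + S.F3 y * conj (T3 y)
        + S.F4 y * conj (T4 y)).re
      - (Complex.I * S.nt * ((S.b y * S.u y - S.G y * S.h y) * conj (T1 y)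
          + (S.b y * S.v y - S.G y * S.g y) * conj (T2 y)
          - S.u y * conj (T3 y) - S.v y * conj (T4 y))).re
      - S.μ * S.ε * (deriv S.u y * conj (T1' y) + S.nt ^ 2 * (S.u y * conj (T1 y))).re
      - S.μ * S.ε * (deriv S.v y * conj (-(Complex.I * S.nt) * T1 y)
          + S.nt ^ 2 * (S.v y * conj (T2 y))).re
      - S.κ * S.ε * (deriv S.h y * conj (T3' y) + S.nt ^ 2 * (S.h y * conj (T3 y))).re
      - S.κ * S.ε * (deriv S.g y * conj (T4' y) + S.nt ^ 2 * (S.g y * conj (T4 y))).re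
      + c' y ≤ Q y) :
    0 ≤ ∫ y in Ioi (0:ℝ), Q y := by
  have hu' : Continuous (deriv S.u) := S.cu.continuous_deriv (by norm_num)
  have hv' : Continuous (deriv S.v) := S.cv.continuous_deriv (by norm_num)
  have hh' : Continuous (deriv S.h) := S.ch.continuous_deriv (by norm_num)
  have hg' : Continuous (deriv S.g) := S.cg.continuous_deriv (by norm_num)
  have hp := S.cp.continuous
  have hdd : ∀ {f : ℝ → ℂ}, ContDiff ℝ 2 f → ∀ y, HasDerivAt (deriv f) (deriv (deriv f) y) y := by
    intro f hf y
    have : ContDiff ℝ 1 (deriv f) := by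
      have h2 : ContDiff ℝ (1 + 1) f := by simpa [one_add_one_eq_two] using hf
      exact (contDiff_succ_iff_deriv.1 h2).2.2
    exact (this.differentiable one_ne_zero y).hasDerivAt
  have hpd : ∀ y, HasDerivAt S.p (deriv S.p y) y :=
    fun y => (S.cp.differentiable one_ne_zero y).hasDerivAt
  have hF : ∀ y, 0 < y → HasDerivAt (S.flux T1 T2 T3 T4)
      ((deriv S.p y * conj (T2 y) + S.p y * conj (-(Complex.I * S.nt) * T1 y))
       - (S.μ * S.ε : ℝ) * ((deriv (deriv S.u) y * conj (T1 y) + deriv S.u y * conj (T1' y))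
          + (deriv (deriv S.v) y * conj (T2 y) + deriv S.v y * conj (-(Complex.I * S.nt) * T1 y)))
       - (S.κ * S.ε : ℝ) * ((deriv (deriv S.h) y * conj (T3 y) + deriv S.h y * conj (T3' y))
          + (deriv (deriv S.g) y * conj (T4 y) + deriv S.g y * conj (T4' y)))) y := by
    intro y hy
    have t1 := hasDerivAt_conj (D1 y hy)
    have t2 := hasDerivAt_conj (D2 y hy)
    have t3 := hasDerivAt_conj (D3 y hy)
    have t4 := hasDerivAt_conj (D4 y hy)
    exact (((hpd y).mul t2).sub ((((hdd S.cu y).mul t1).add ((hdd S.cv y).mul t2)).const_mul _)).sub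
      ((((hdd S.ch y).mul t3).add ((hdd S.cg y).mul t4)).const_mul _)
  have hcF : ContinuousOn (S.flux T1 T2 T3 T4) (Ici 0) := by
    have t1 : ContinuousOn (fun y => conj (T1 y)) (Ici 0) := Complex.continuous_conj.comp_continuousOn C1
    have t2 : ContinuousOn (fun y => conj (T2 y)) (Ici 0) := Complex.continuous_conj.comp_continuousOn C2
    have t3 : ContinuousOn (fun y => conj (T3 y)) (Ici 0) := Complex.continuous_conj.comp_continuousOn C3
    have t4 : ContinuousOn (fun y => conj (T4 y)) (Ici 0) := Complex.continuous_conj.comp_continuousOn C4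
    exact (((hp.continuousOn).mul t2).sub (continuousOn_const.mul
      ((hu'.continuousOn.mul t1).add (hv'.continuousOn.mul t2)))).sub (continuousOn_const.mul
      ((hh'.continuousOn.mul t3).add (hg'.continuousOn.mul t4)))
  have htF : Tendsto (S.flux T1 T2 T3 T4) atTop (nhds 0) := by
    have key : ∀ {P T : ℝ → ℂ}, (∀ y, 0 ≤ y → ‖T y‖ ≤ B * (‖S.u y‖ + ‖S.v y‖ + ‖S.h y‖ + ‖S.g y‖)) →
        Tendsto (fun y => ‖P y‖ * (‖S.u y‖ + ‖S.v y‖ + ‖S.h y‖ + ‖S.g y‖)) atTop (nhds 0) →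
        Tendsto (fun y => P y * conj (T y)) atTop (nhds 0) := by
      intro P T hT hP
      have h2 := hP.const_mul B
      rw [mul_zero] at h2
      refine squeeze_zero_norm' ?_ h2
      filter_upwards [eventually_ge_atTop 0] with y hy
      rw [norm_mul, RCLike.norm_conj]
      calc _ ≤ ‖P y‖ * (B * (‖S.u y‖ + ‖S.v y‖ + ‖S.h y‖ + ‖S.g y‖)) := by gcongr; exact hT y hy
        _ = _ := by ring
    have key2 : ∀ {P : ℝ → ℂ}, (∀ y, ‖P y‖ ≤ ‖deriv S.u y‖ + ‖deriv S.v y‖ + ‖deriv S.h y‖ + ‖deriv S.g y‖) →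
        Tendsto (fun y => ‖P y‖ * (‖S.u y‖ + ‖S.v y‖ + ‖S.h y‖ + ‖S.g y‖)) atTop (nhds 0) := by
      intro P hP
      have := (squeeze_zero (fun y => norm_nonneg (P y)) hP S.tW').mul S.tW
      simpa using this
    have k1 := key (P := deriv S.u) B1 (key2 fun y => by
      linarith [norm_nonneg (deriv S.v y), norm_nonneg (deriv S.h y), norm_nonneg (deriv S.g y)])
    have k2 := key (P := deriv S.v) B2 (key2 fun y => by
      linarith [norm_nonneg (deriv S.u y), norm_nonneg (deriv S.h y), norm_nonneg (deriv S.g y)])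
    have k3 := key (P := deriv S.h) B3 (key2 fun y => by
      linarith [norm_nonneg (deriv S.v y), norm_nonneg (deriv S.u y), norm_nonneg (deriv S.g y)])
    have k4 := key (P := deriv S.g) B4 (key2 fun y => by
      linarith [norm_nonneg (deriv S.v y), norm_nonneg (deriv S.h y), norm_nonneg (deriv S.u y)])
    have k5 := key (P := S.p) B2 S.tp
    have := (k5.sub ((k1.add k2).const_mul ((S.μ * S.ε : ℝ) : ℂ))).sub
      ((k3.add k4).const_mul ((S.κ * S.ε : ℝ) : ℂ))
    simp only [mul_zero, add_zero, sub_zero] at this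
    exact this
  refine flux_le (g := fun y => (S.flux T1 T2 T3 T4 y).re + c y)
    ((Complex.continuous_re.comp_continuousOn hcF).add Cc)
    (fun y hy => (hasDerivAt_re (hF y hy)).add (Dc y hy)) iQ ?_ ?_ ?_
  · intro y hy
    refine le_trans (le_of_eq ?_) (hQ y hy)
    rw [S.e1 y hy, S.e2 y hy, S.e3 y hy, S.e4 y hy]
    have r : ∀ (x : ℝ) (z : ℂ), x * z.re = ((x : ℂ) * z).re := by intro x z; simp
    simp only [r, ← Complex.sub_re]
    congr 2
    simp only [map_neg, map_mul, Complex.conj_I, Complex.conj_ofReal]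
    push_cast
    ring
  · simp [flux, Z1, Z2, Z4, S.h0, c0]
  · have := ((Complex.continuous_re.tendsto 0).comp htF).add ct
    simpa using this
end Sys


lemma re_le_norm_mul {a b : ℂ} {A B : ℝ} (ha : ‖a‖ ≤ A) (hb : ‖b‖ ≤ B) :
    |(a * conj b).re| ≤ A * B := by
  refine (Complex.abs_re_le_norm _).trans ?_
  rw [norm_mul, RCLike.norm_conj]
  exact mul_le_mul ha hb (norm_nonneg _) ((norm_nonneg _).trans ha)

lemma diff_low {f' f e k : ℂ} {θ nt d B : ℝ} (h1 : ‖f'‖ ≤ d) (h2 : |nt| * ‖f‖ ≤ d)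
    (h3 : ‖e‖ ≤ B) (h4 : |nt| * ‖k‖ ≤ B) :
    θ * (‖f'‖ ^ 2 + nt ^ 2 * ‖f‖ ^ 2) - 2 * B * d ≤
      (f' * conj (θ * f' + e) + nt ^ 2 * (f * conj (θ * f + k))).re := by
  have a1 := neg_le_of_abs_le (re_le_norm_mul h1 h3)
  have hf : ‖(nt : ℂ) * f‖ ≤ d := by simpa using h2
  have hk : ‖(nt : ℂ) * k‖ ≤ B := by simpa using h4
  have a2 := neg_le_of_abs_le (re_le_norm_mul hf hk)
  have e1 : f' * conj (θ * f' + e) + nt ^ 2 * (f * conj (θ * f + k))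
     = ((θ * (‖f'‖ ^ 2 + nt ^ 2 * ‖f‖ ^ 2) : ℝ) : ℂ) + f' * conj e
       + (nt * f) * conj (nt * k) := by
    push_cast
    rw [← Complex.mul_conj' f', ← Complex.mul_conj' f]
    simp only [map_add, map_mul, Complex.conj_ofReal]
    ring
  rw [e1, Complex.add_re, Complex.add_re, Complex.ofReal_re]
  linarith

lemma diff_low' {f' f e k : ℂ} {nt d B : ℝ} (h1 : ‖f'‖ ≤ d) (h2 : |nt| * ‖f‖ ≤ d)
    (h3 : ‖e‖ ≤ B) (h4 : |nt| * ‖k‖ ≤ B) :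
    - (2 * B * d) ≤
      (f' * conj e + nt ^ 2 * (f * conj k)).re := by
  have := diff_low (θ := 0) h1 h2 h3 h4
  simpa using this

lemma int4 {f1 f2 f3 f4 : ℝ → ℝ} (h1 : IntegrableOn f1 (Ioi 0)) (h2 : IntegrableOn f2 (Ioi 0))
    (h3 : IntegrableOn f3 (Ioi 0)) (h4 : IntegrableOn f4 (Ioi 0)) (c1 c2 c3 c4 : ℝ) :
    ∫ y in Ioi (0:ℝ), (c1 * f1 y + c2 * f2 y + c3 * f3 y - c4 * f4 y) =
      c1 * (∫ y in Ioi (0:ℝ), f1 y) + c2 * (∫ y in Ioi (0:ℝ), f2 y)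
      + c3 * (∫ y in Ioi (0:ℝ), f3 y) - c4 * (∫ y in Ioi (0:ℝ), f4 y) := by
  have I1 := h1.const_mul c1
  have I2 := h2.const_mul c2
  have I3 := h3.const_mul c3
  have I4 := h4.const_mul c4
  have I12 : Integrable (fun y => c1 * f1 y + c2 * f2 y) (volume.restrict (Ioi 0)) := I1.add I2
  have I123 : Integrable (fun y => c1 * f1 y + c2 * f2 y + c3 * f3 y) (volume.restrict (Ioi 0)) :=
    I12.add I3
  rw [integral_sub I123 I4, integral_add I12 I3, integral_add I1 I2, integral_const_mul,
    integral_const_mul, integral_const_mul, integral_const_mul]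

namespace Sys
variable (S : Sys)

def d (y : ℝ) : ℝ := √(S.d2 y)
def q (y : ℝ) : ℝ := √(S.q2 y)
def Φ (y : ℝ) : ℝ := √(S.R2 y) + S.Γ * S.τ y *
    (√S.ε * S.M * S.d y + S.M * (1 + S.M) * S.q y)

def FB : Prop := ∀ y, 0 < y → ‖S.F1 y‖ ≤ S.Φ y ∧ ‖S.F2 y‖ ≤ S.Φ y ∧ ‖S.F3 y‖ ≤ S.Φ y ∧
  ‖S.F4 y‖ ≤ S.Φ y

lemma d_nn (y) : 0 ≤ S.d y := Real.sqrt_nonneg _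
lemma q_nn (y) : 0 ≤ S.q y := Real.sqrt_nonneg _
lemma d_sq (y) : S.d y ^ 2 = S.d2 y := Real.sq_sqrt (S.d2_nn y)
lemma q_sq (y) : S.q y ^ 2 = S.q2 y := Real.sq_sqrt (S.q2_nn y)

lemma F_le (hF : S.FB) {y : ℝ} (hy : 0 < y) {T1 T2 T3 T4 : ℂ} :
    (S.F1 y * conj T1 + S.F2 y * conj T2 + S.F3 y * conj T3 + S.F4 y * conj T4).re
      ≤ S.Φ y * (‖T1‖ + ‖T2‖ + ‖T3‖ + ‖T4‖) := by
  obtain ⟨h1, h2, h3, h4⟩ := hF y hy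
  simp only [Complex.add_re]
  have a1 := le_of_abs_le (re_le_norm_mul h1 (le_refl ‖T1‖))
  have a2 := le_of_abs_le (re_le_norm_mul h2 (le_refl ‖T2‖))
  have a3 := le_of_abs_le (re_le_norm_mul h3 (le_refl ‖T3‖))
  have a4 := le_of_abs_le (re_le_norm_mul h4 (le_refl ‖T4‖))
  linarith

lemma Φ_nn {y : ℝ} (hy : 0 < y) : 0 ≤ S.Φ y := by
  have := S.τ_nn y hy; have := S.hΓ; have := S.hM; have := S.d_nn y; have := S.q_nn y
  unfold Φ; positivity

lemma du (y) : HasDerivAt S.u (deriv S.u y) y := (S.cu.differentiable (by norm_num) y).hasDerivAt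
lemma dv' (y) : HasDerivAt S.v (deriv S.v y) y := (S.cv.differentiable (by norm_num) y).hasDerivAt
lemma dh (y) : HasDerivAt S.h (deriv S.h y) y := (S.ch.differentiable (by norm_num) y).hasDerivAt
lemma dg' (y) : HasDerivAt S.g (deriv S.g y) y := (S.cg.differentiable (by norm_num) y).hasDerivAt

lemma dvT {y : ℝ} (hy : 0 < y) : HasDerivAt S.v (-(Complex.I * S.nt) * S.u y) y := by
  rw [← S.dv hy]; exact S.dv' y
lemma dgT {y : ℝ} (hy : 0 < y) : HasDerivAt S.g (-(Complex.I * S.nt) * S.h y) y := by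
  rw [← S.dg hy]; exact S.dg' y

lemma cGc : ContinuousOn (fun y => (S.G y : ℂ)) (Ici 0) :=
  Complex.continuous_ofReal.comp_continuousOn S.cG
lemma cbc : ContinuousOn (fun y => (S.b y : ℂ)) (Ici 0) :=
  Complex.continuous_ofReal.comp_continuousOn S.cb
lemma cωc : ContinuousOn (fun y => (S.ω y : ℂ)) (Ici 0) :=
  Complex.continuous_ofReal.comp_continuousOn S.cω
lemma cω1c : ContinuousOn (fun y => (S.ω1 y : ℂ)) (Ici 0) :=
  Complex.continuous_ofReal.comp_continuousOn S.cω1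
lemma cχc : ContinuousOn (fun y => (S.χ y : ℂ)) (Ici 0) :=
  Complex.continuous_ofReal.comp_continuousOn S.cχ
lemma cχ1c : ContinuousOn (fun y => (S.χ1 y : ℂ)) (Ici 0) :=
  Complex.continuous_ofReal.comp_continuousOn S.cχ1

/-- Diffusion main term lower bound. -/
lemma main_low {y θ : ℝ} (hy : 0 < y) (hθ : 0 ≤ θ) :
    S.ε / S.Γ ^ 2 * (θ * S.d2 y) ≤
      S.μ * S.ε * (θ * (‖deriv S.u y‖ ^ 2 + S.nt ^ 2 * ‖S.u y‖ ^ 2))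
      + S.μ * S.ε * (θ * (‖deriv S.v y‖ ^ 2 + S.nt ^ 2 * ‖S.v y‖ ^ 2))
      + S.κ * S.ε * (S.G y * θ * (‖deriv S.h y‖ ^ 2 + S.nt ^ 2 * ‖S.h y‖ ^ 2))
      + S.κ * S.ε * (S.G y * θ * (‖deriv S.g y‖ ^ 2 + S.nt ^ 2 * ‖S.g y‖ ^ 2)) := by
  have hΓ := S.hΓ
  have h0 : 0 < S.Γ := by linarith
  have hε := S.hε0
  have hm : 1 / S.Γ ^ 2 ≤ S.μ := by
    rw [div_le_iff₀ (by positivity)]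
    nlinarith [S.hμ', S.hμ0, mul_le_mul_of_nonneg_left S.hμ' h0.le]
  have hk : 1 / S.Γ ^ 2 ≤ S.κ * S.G y := by
    have g1 := S.G_low y hy.le
    rw [div_le_iff₀ (by positivity)]
    nlinarith [mul_le_mul S.hκ' g1 zero_le_one (by linarith [S.hκ'])]
  have e1 : S.ε / S.Γ ^ 2 * (θ * S.d2 y) = 
     1 / S.Γ ^ 2 * (S.ε * (θ * (‖deriv S.u y‖ ^ 2 + S.nt ^ 2 * ‖S.u y‖ ^ 2)))
      + 1 / S.Γ ^ 2 * (S.ε * (θ * (‖deriv S.v y‖ ^ 2 + S.nt ^ 2 * ‖S.v y‖ ^ 2)))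
      + 1 / S.Γ ^ 2 * (S.ε * (θ * (‖deriv S.h y‖ ^ 2 + S.nt ^ 2 * ‖S.h y‖ ^ 2)))
      + 1 / S.Γ ^ 2 * (S.ε * (θ * (‖deriv S.g y‖ ^ 2 + S.nt ^ 2 * ‖S.g y‖ ^ 2))) := by
    unfold d2 D2 W2; ring
  rw [e1]
  have a1 := mul_le_mul_of_nonneg_right hm (a := S.ε * (θ * (‖deriv S.u y‖ ^ 2 + S.nt ^ 2 * ‖S.u y‖ ^ 2))) (by positivity)
  have a2 := mul_le_mul_of_nonneg_right hm (a := S.ε * (θ * (‖deriv S.v y‖ ^ 2 + S.nt ^ 2 * ‖S.v y‖ ^ 2))) (by positivity)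
  have a3 := mul_le_mul_of_nonneg_right hk (a := S.ε * (θ * (‖deriv S.h y‖ ^ 2 + S.nt ^ 2 * ‖S.h y‖ ^ 2))) (by positivity)
  have a4 := mul_le_mul_of_nonneg_right hk (a := S.ε * (θ * (‖deriv S.g y‖ ^ 2 + S.nt ^ 2 * ‖S.g y‖ ^ 2))) (by positivity)
  linarith

lemma idq : IntegrableOn (fun y => S.d y * S.q y) (Ioi 0) :=
  (cs_int S.id2 S.iq2 (fun y _ => S.d2_nn y) (fun y _ => S.q2_nn y)).1

lemma iRW : IntegrableOn (fun y => √(S.R2 y) * √(S.W2 y)) (Ioi 0) :=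
  (cs_int S.iR S.iW2 (fun y _ => S.R_nn y) (fun y _ => S.W2_nn y)).1

def w : ℝ := √(∫ y in Ioi (0:ℝ), S.W2 y)
def a : ℝ := √(∫ y in Ioi (0:ℝ), S.d2 y)
def r : ℝ := √(∫ y in Ioi (0:ℝ), S.R2 y)
lemma w_nn : 0 ≤ S.w := Real.sqrt_nonneg _
lemma a_nn : 0 ≤ S.a := Real.sqrt_nonneg _
lemma r_nn : 0 ≤ S.r := Real.sqrt_nonneg _
lemma w_sq : S.w ^ 2 = ∫ y in Ioi (0:ℝ), S.W2 y :=
  Real.sq_sqrt (setIntegral_nonneg measurableSet_Ioi fun y _ => S.W2_nn y)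
lemma a_sq : S.a ^ 2 = ∫ y in Ioi (0:ℝ), S.d2 y :=
  Real.sq_sqrt (setIntegral_nonneg measurableSet_Ioi fun y _ => S.d2_nn y)
lemma int_dq : ∫ y in Ioi (0:ℝ), S.d y * S.q y ≤ 3 * (S.a * S.w) := by
  refine (cs_int S.id2 S.iq2 (fun y _ => S.d2_nn y) (fun y _ => S.q2_nn y)).2.trans ?_
  have : √(∫ y in Ioi (0:ℝ), S.q2 y) ≤ 3 * S.w := by
    refine Real.sqrt_le_iff.2 ⟨by have := S.w_nn; positivity, ?_⟩
    rw [mul_pow, S.w_sq]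
    have := S.intq2
    have h2 : 0 ≤ ∫ y in Ioi (0:ℝ), S.W2 y := setIntegral_nonneg measurableSet_Ioi fun y _ => S.W2_nn y
    linarith
  calc _ ≤ S.a * (3 * S.w) := by unfold a; gcongr
    _ = _ := by ring
lemma int_q2 : ∫ y in Ioi (0:ℝ), S.q2 y ≤ 5 * S.w ^ 2 := by rw [S.w_sq]; exact S.intq2
lemma int_RW : ∫ y in Ioi (0:ℝ), √(S.R2 y) * √(S.W2 y) ≤ S.r * S.w :=
  (cs_int S.iR S.iW2 (fun y _ => S.R_nn y) (fun y _ => S.W2_nn y)).2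

lemma pointA (hF : S.FB) {y : ℝ} (hy : 0 < y) :
      (S.F1 y * conj (S.u y) + S.F2 y * conj (S.v y) + S.F3 y * conj (S.G y * S.h y)
        + S.F4 y * conj (S.G y * S.g y)).re
      - (Complex.I * S.nt * ((S.b y * S.u y - S.G y * S.h y) * conj (S.u y)
          + (S.b y * S.v y - S.G y * S.g y) * conj (S.v y)
          - S.u y * conj (S.G y * S.h y) - S.v y * conj (S.G y * S.g y))).re
      - S.μ * S.ε * (deriv S.u y * conj (deriv S.u y) + S.nt ^ 2 * (S.u y * conj (S.u y))).re
      - S.μ * S.ε * (deriv S.v y * conj (-(Complex.I * S.nt) * S.u y)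
          + S.nt ^ 2 * (S.v y * conj (S.v y))).re
      - S.κ * S.ε * (deriv S.h y * conj (S.G1 y * S.h y + S.G y * deriv S.h y)
          + S.nt ^ 2 * (S.h y * conj (S.G y * S.h y))).re
      - S.κ * S.ε * (deriv S.g y * conj (S.G1 y * S.g y + S.G y * deriv S.g y)
          + S.nt ^ 2 * (S.g y * conj (S.G y * S.g y))).re
      + 0 ≤ 4 * S.Γ * (√(S.R2 y) * √(S.W2 y)) + 8 * S.Γ ^ 2 * (√S.ε * S.M) * (S.d y * S.q y)
        + 4 * S.Γ ^ 2 * (S.M * (1 + S.M)) * S.q2 y - S.ε / S.Γ ^ 2 * S.d2 y := by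
  have hΓ := S.hΓ
  have hM := S.hM
  have h0 : 0 < S.Γ := by linarith
  have hε := S.hε0
  have hκ := S.hκ0
  obtain ⟨w1, w2, w3, w4⟩ := S.W_le (y := y)
  obtain ⟨d1, d2, d3, d4⟩ := S.d_le (y := y)
  obtain ⟨n1, n2, n3, n4⟩ := S.Nd_le (y := y)
  have gl := S.G_le y hy.le
  have gp : 0 < S.G y := by nlinarith [S.G_low y hy.le]
  have hd := S.d_nn y
  have hq := S.q_nn y
  have hWq : √(S.W2 y) ≤ S.q y := S.Wq
  have hW := Real.sqrt_nonneg (S.W2 y)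
  have hR := Real.sqrt_nonneg (S.R2 y)
  -- F part
  have f1 := S.F_le hF hy (T1 := S.u y) (T2 := S.v y) (T3 := S.G y * S.h y) (T4 := S.G y * S.g y)
  have nG : ∀ z : ℂ, ‖(S.G y : ℂ) * z‖ = S.G y * ‖z‖ := fun z => by
    rw [norm_mul, Complex.norm_real, Real.norm_of_nonneg gp.le]
  have f2 : ‖S.u y‖ + ‖S.v y‖ + ‖S.G y * S.h y‖ + ‖S.G y * S.g y‖ ≤ 4 * S.Γ * √(S.W2 y) := by
    rw [nG, nG]
    have g1 : S.G y * ‖S.h y‖ ≤ S.Γ * √(S.W2 y) := by gcongr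
    have g2 : S.G y * ‖S.g y‖ ≤ S.Γ * √(S.W2 y) := by gcongr
    nlinarith [mul_le_mul_of_nonneg_right hΓ hW]
  have f3 : S.Φ y * (4 * S.Γ * √(S.W2 y)) ≤ 4 * S.Γ * (√(S.R2 y) * √(S.W2 y)) +
      4 * S.Γ ^ 2 * (√S.ε * S.M) * (S.d y * S.q y) + 4 * S.Γ ^ 2 * (S.M * (1 + S.M)) * S.q2 y := by
    have t1 := S.τ_le y hy
    have t0 := S.τ_nn y hy
    rw [← S.q_sq]
    calc S.Φ y * (4 * S.Γ * √(S.W2 y)) = 4 * S.Γ * (√(S.R2 y) * √(S.W2 y)) +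
          4 * S.Γ ^ 2 * S.τ y * (√S.ε * S.M * S.d y + S.M * (1 + S.M) * S.q y) * √(S.W2 y) := by
          unfold Φ; ring
      _ ≤ 4 * S.Γ * (√(S.R2 y) * √(S.W2 y)) +
          4 * S.Γ ^ 2 * 1 * (√S.ε * S.M * S.d y + S.M * (1 + S.M) * S.q y) * S.q y := by gcongr
      _ = _ := by ring
  have f4 := mul_le_mul_of_nonneg_left f2 (S.Φ_nn hy)
  -- coupling
  have c1 : (Complex.I * S.nt * ((S.b y * S.u y - S.G y * S.h y) * conj (S.u y)
          + (S.b y * S.v y - S.G y * S.g y) * conj (S.v y)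
          - S.u y * conj (S.G y * S.h y) - S.v y * conj (S.G y * S.g y))).re = 0 := by
    simp; right; ring
  -- diffusion
  have D1 := diff_low (θ := 1) (e := 0) (k := 0) (B := 0) d1 n1 (by simp) (by simp)
  have D2 := diff_low (θ := 1) (e := 0) (k := 0) (B := 0) d2 n2 (by simp) (by simp)
  have hB : ∀ z : ℂ, ‖z‖ ≤ √(S.W2 y) → ‖(S.G1 y : ℂ) * z‖ ≤ |S.G1 y| * S.q y := fun z hz => by
    rw [norm_mul, Complex.norm_real, Real.norm_eq_abs]; gcongr; exact hz.trans hWq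
  have D3 := diff_low (θ := S.G y) (k := 0) d3 n3 (hB _ w3) (by simp; positivity)
  have D4 := diff_low (θ := S.G y) (k := 0) d4 n4 (hB _ w4) (by simp; positivity)
  simp only [Complex.ofReal_one, one_mul, add_zero, mul_zero, zero_mul, sub_zero] at D1 D2 D3 D4
  rw [S.dv hy] at D2 ⊢
  rw [add_comm ((S.G y : ℂ) * _)] at D3 D4
  have m1 := S.main_low hy zero_le_one
  rw [S.dv hy] at m1
  have hμε : 0 ≤ S.μ * S.ε := by have := S.hμ0; positivity
  have hκε : 0 ≤ S.κ * S.ε := by positivity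
  have E1 := mul_le_mul_of_nonneg_left D1 hμε
  have E2 := mul_le_mul_of_nonneg_left D2 hμε
  have E3 := mul_le_mul_of_nonneg_left D3 hκε
  have E4 := mul_le_mul_of_nonneg_left D4 hκε
  have E5 : S.κ * S.ε * (|S.G1 y| * S.q y * S.d y) ≤ S.Γ ^ 2 * (√S.ε * S.M) * (S.d y * S.q y) := by
    have s1 : S.ε = √S.ε * √S.ε := (Real.mul_self_sqrt hε.le).symm
    calc S.κ * S.ε * (|S.G1 y| * S.q y * S.d y) = S.κ * (|S.G1 y| * √S.ε) * √S.ε * (S.d y * S.q y) := by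
          rw [s1]; simp only [Real.sqrt_mul_self (Real.sqrt_nonneg _)]; ring
      _ ≤ S.Γ * (S.Γ * S.M) * √S.ε * (S.d y * S.q y) := by
          gcongr ?_ * ?_ * √S.ε * (S.d y * S.q y)
          · exact S.hκ
          · exact S.G1_le' y hy
      _ = _ := by ring
  have hdd : √(S.d2 y) = S.d y := rfl
  rw [hdd] at E3 E4
  rw [c1]
  simp only [one_mul, mul_one] at m1
  linarith

lemma estA (hF : S.FB) : S.ε * S.a ^ 2 ≤ 24 * S.Γ ^ 4 *
    (S.r * S.w + √S.ε * S.M * (S.a * S.w) + S.M * (1 + S.M) * S.w ^ 2) := by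
  have hΓ := S.hΓ
  have hM := S.hM
  have h0 : 0 < S.Γ := by linarith
  have cu := S.cu.continuous
  have cv := S.cv.continuous
  have ch := S.ch.continuous
  have cg := S.cg.continuous
  have I1 := S.iRW.const_mul (4 * S.Γ)
  have I2 := S.idq.const_mul (8 * S.Γ ^ 2 * (√S.ε * S.M))
  have I3 := S.iq2.const_mul (4 * S.Γ ^ 2 * (S.M * (1 + S.M)))
  have I4 := S.id2.const_mul (S.ε / S.Γ ^ 2)
  have nG : ∀ y, 0 ≤ y → ∀ z : ℂ, ‖(S.G y : ℂ) * z‖ ≤ S.Γ * ‖z‖ := fun y hy z => by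
    have gl := S.G_le y hy
    have gp : 0 < S.G y := by nlinarith [S.G_low y hy]
    rw [norm_mul, Complex.norm_real, Real.norm_of_nonneg gp.le]; gcongr
  have key := S.test (T1 := S.u) (T2 := S.v) (T3 := fun y => S.G y * S.h y)
    (T4 := fun y => S.G y * S.g y) (T1' := deriv S.u)
    (T3' := fun y => S.G1 y * S.h y + S.G y * deriv S.h y)
    (T4' := fun y => S.G1 y * S.g y + S.G y * deriv S.g y)
    (c := fun _ => 0) (c' := fun _ => 0) (B := S.Γ)
    cu.continuousOn cv.continuousOn (S.cGc.mul ch.continuousOn) (S.cGc.mul cg.continuousOn)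
    (fun y _ => S.du y) (fun y hy => S.dvT hy)
    (fun y hy => (S.dG y hy).ofReal_comp.mul (S.dh y)) (fun y hy => (S.dG y hy).ofReal_comp.mul (S.dg' y))
    S.u0 S.v0 (by simp [S.g0])
    (fun y hy => by
      have := norm_nonneg (S.u y); have := norm_nonneg (S.v y); have := norm_nonneg (S.h y)
      have := norm_nonneg (S.g y); nlinarith)
    (fun y hy => by
      have := norm_nonneg (S.u y); have := norm_nonneg (S.v y); have := norm_nonneg (S.h y)
      have := norm_nonneg (S.g y); nlinarith)
    (fun y hy => (nG y hy _).trans (by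
      have := norm_nonneg (S.u y); have := norm_nonneg (S.v y); have := norm_nonneg (S.h y)
      have := norm_nonneg (S.g y); gcongr; linarith))
    (fun y hy => (nG y hy _).trans (by
      have := norm_nonneg (S.u y); have := norm_nonneg (S.v y); have := norm_nonneg (S.h y)
      have := norm_nonneg (S.g y); gcongr; linarith))
    continuousOn_const (fun y _ => hasDerivAt_const _ _) rfl tendsto_const_nhds
    (((I1.add I2).add I3).sub I4) (fun y hy => S.pointA hF hy)
  have key2 := int4 S.iRW S.idq S.iq2 S.id2 (4 * S.Γ) (8 * S.Γ ^ 2 * (√S.ε * S.M))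
    (4 * S.Γ ^ 2 * (S.M * (1 + S.M))) (S.ε / S.Γ ^ 2)
  have key := key.trans_eq key2
  rw [← S.a_sq] at key
  have J1 := mul_le_mul_of_nonneg_left S.int_RW (a := 4 * S.Γ) (by positivity)
  have J2 := mul_le_mul_of_nonneg_left S.int_dq (a := 8 * S.Γ ^ 2 * (√S.ε * S.M)) (by positivity)
  have J3 := mul_le_mul_of_nonneg_left S.int_q2 (a := 4 * S.Γ ^ 2 * (S.M * (1 + S.M))) (by positivity)
  have a1 := S.a_nn; have w1 := S.w_nn; have r1 := S.r_nn
  have L1 : S.ε / S.Γ ^ 2 * S.a ^ 2 ≤ 24 * S.Γ ^ 2 * (S.r * S.w + √S.ε * S.M * (S.a * S.w) + S.M * (1 + S.M) * S.w ^ 2) := by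
    have x1 : 4 * S.Γ * (S.r * S.w) ≤ 24 * S.Γ ^ 2 * (S.r * S.w) := by
      gcongr ?_ * (S.r * S.w)
      nlinarith
    have x2 : 0 ≤ S.Γ ^ 2 * (S.M * (1 + S.M) * S.w ^ 2) := by positivity
    nlinarith
  have L2 := mul_le_mul_of_nonneg_left L1 (a := S.Γ ^ 2) (by positivity)
  calc S.ε * S.a ^ 2 = S.Γ ^ 2 * (S.ε / S.Γ ^ 2 * S.a ^ 2) := by field_simp
    _ ≤ _ := L2
    _ = _ := by ring
end Sys

namespace Sys
variable (S : Sys)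

def Y2 (y : ℝ) : ℝ := (S.ω y + √S.ε) * S.W2 y
  + S.K / ((y + √S.ε) * (y + S.K)) * (‖S.φ y‖ ^ 2 + ‖S.ψ y‖ ^ 2)
def X (y : ℝ) : ℝ := √((S.ω y + √S.ε) * S.R2 y) * √(S.Y2 y)
def J (y : ℝ) : ℝ := S.X y + (1 + S.M) * S.ε * (S.d y * S.q y) + √S.ε * (S.M * (1 + S.M)) * S.q2 y
def X0 (y : ℝ) : ℝ := S.ω y * √(S.W2 y) + S.χ y * (‖S.φ y‖ + ‖S.ψ y‖)

lemma Y2_nn {y : ℝ} (hy : 0 < y) : 0 ≤ S.Y2 y := by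
  have := S.ω_nn y hy.le; have := S.W2_nn y; have := S.hK
  unfold Y2; positivity

lemma X_nn (y : ℝ) : 0 ≤ S.X y := by unfold X; positivity

lemma J_nn {y : ℝ} : 0 ≤ S.J y := by
  have := S.X_nn y; have := S.hM; have := S.d_nn y; have := S.q_nn y; have := S.q2_nn y
  have := S.hε0
  unfold J; positivity

lemma pointR {y : ℝ} (hy : 0 < y) : √(S.R2 y) * S.X0 y ≤ 3 * S.Γ * S.X y := by
  have hΓ := S.hΓ
  have hs : 0 < √S.ε := Real.sqrt_pos.2 S.hε0
  have hω := S.ω_nn y hy.le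
  have hY := S.Y2_nn hy
  have hK : 0 < S.K := by linarith [S.hK]
  have hA : 0 < S.ω y + √S.ε := by positivity
  have hχ := S.χ_nn y hy.le
  have e1 : S.X y = √(S.R2 y) * (√(S.ω y + √S.ε) * √(S.Y2 y)) := by
    unfold X; rw [Real.sqrt_mul hA.le]; ring
  have e2 : √(S.ω y + √S.ε) * √(S.Y2 y) = √((S.ω y + √S.ε) * S.Y2 y) := by rw [Real.sqrt_mul hA.le]
  set P := √((S.ω y + √S.ε) * S.Y2 y) with hP
  have hP2 : P ^ 2 = (S.ω y + √S.ε) * S.Y2 y := Real.sq_sqrt (by positivity)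
  have hP0 : 0 ≤ P := Real.sqrt_nonneg _
  have m1 : S.χ y ^ 2 ≤ S.Γ * ((S.ω y + √S.ε) * (S.K / ((y + √S.ε) * (y + S.K)))) := by
    have c1 := S.χ_le' y hy.le
    have c2 := S.ω_low y hy
    calc S.χ y ^ 2 ≤ (S.K / (S.K + y)) ^ 2 := by gcongr
      _ = ((S.K / (S.K + y)) * (y + √S.ε)) * (S.K / ((y + √S.ε) * (y + S.K))) := by
          field_simp; ring
      _ ≤ (S.Γ * (S.ω y + √S.ε)) * (S.K / ((y + √S.ε) * (y + S.K))) := by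
          gcongr ?_ * _
          have : S.K / (S.K + y) ≤ 1 := by rw [div_le_one (by positivity)]; linarith
          nlinarith
      _ = _ := by ring
  have key : ∀ z : ℂ, ‖z‖ ^ 2 ≤ ‖S.φ y‖ ^ 2 + ‖S.ψ y‖ ^ 2 → S.χ y * ‖z‖ ≤ S.Γ * P := by
    intro z hz
    refine abs_le_of_sq_le_sq' ?_ (by positivity) |>.2
    rw [mul_pow, mul_pow, hP2]
    have hm : 0 ≤ S.K / ((y + √S.ε) * (y + S.K)) := by positivity
    have hW := S.W2_nn y
    calc S.χ y ^ 2 * ‖z‖ ^ 2 ≤ (S.Γ * ((S.ω y + √S.ε) * (S.K / ((y + √S.ε) * (y + S.K))))) * (‖S.φ y‖ ^ 2 + ‖S.ψ y‖ ^ 2) := by gcongr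
      _ = S.Γ * ((S.ω y + √S.ε) * ((S.K / ((y + √S.ε) * (y + S.K))) * (‖S.φ y‖ ^ 2 + ‖S.ψ y‖ ^ 2))) := by ring
      _ ≤ S.Γ * ((S.ω y + √S.ε) * S.Y2 y) := by
          gcongr; unfold Y2; exact le_add_of_nonneg_left (by positivity)
      _ ≤ S.Γ ^ 2 * ((S.ω y + √S.ε) * S.Y2 y) := by gcongr; nlinarith
  have k1 := key (S.φ y) (by nlinarith [norm_nonneg (S.ψ y)])
  have k2 := key (S.ψ y) (by nlinarith [norm_nonneg (S.φ y)])
  have k3 : S.ω y * √(S.W2 y) ≤ P := by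
    refine Real.le_sqrt_of_sq_le ?_
    rw [mul_pow, Real.sq_sqrt (S.W2_nn y)]
    have hW := S.W2_nn y
    calc S.ω y ^ 2 * S.W2 y ≤ (S.ω y + √S.ε) ^ 2 * S.W2 y := by gcongr; linarith
      _ = (S.ω y + √S.ε) * ((S.ω y + √S.ε) * S.W2 y) := by ring
      _ ≤ _ := by gcongr; unfold Y2; exact le_add_of_nonneg_right (by positivity)
  rw [e1, e2]
  calc √(S.R2 y) * S.X0 y ≤ √(S.R2 y) * (3 * S.Γ * P) := by
        gcongr; unfold X0; nlinarith
    _ = _ := by ring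

lemma pointF {y : ℝ} (hy : 0 < y) : S.Φ y * S.X0 y ≤ 3 * S.Γ ^ 2 * S.J y := by
  have hΓ := S.hΓ
  have hM := S.hM
  have hd := S.d_nn y
  have hq := S.q_nn y
  have hε := S.hε0
  have t0 := S.τ_nn y hy
  have t1 := S.τ_le' y hy
  have hω := S.ω_nn y hy.le
  have hX := S.X_nn y
  have b1 : S.τ y * S.X0 y ≤ 3 * S.Γ * √S.ε * S.q y := by
    have a1 : S.τ y * (S.ω y * √(S.W2 y)) ≤ S.Γ * √S.ε * S.q y := by
      calc S.τ y * (S.ω y * √(S.W2 y)) ≤ S.τ y * ((S.Γ * y) * S.q y) := by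
            gcongr
            · exact S.ω_le y hy.le
            · exact S.Wq
        _ = S.Γ * (S.τ y * y) * S.q y := by ring
        _ ≤ _ := by gcongr
    have a2 : ∀ z : ℂ, ‖z‖ ≤ y * S.q y → S.τ y * (S.χ y * ‖z‖) ≤ S.Γ * √S.ε * S.q y := by
      intro z hz
      have := S.χ_nn y hy.le
      calc S.τ y * (S.χ y * ‖z‖) ≤ S.τ y * (1 * (y * S.q y)) := by
            gcongr; exact S.χ_le y hy.le
        _ = 1 * (S.τ y * y) * S.q y := by ring
        _ ≤ _ := by gcongr
    have := a2 _ (S.φq hy)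
    have := a2 _ (S.ψq hy)
    unfold X0; nlinarith
  have s1 : √S.ε * √S.ε = S.ε := Real.mul_self_sqrt hε.le
  calc S.Φ y * S.X0 y = √(S.R2 y) * S.X0 y + S.Γ * (√S.ε * S.M * S.d y + S.M * (1 + S.M) * S.q y) * (S.τ y * S.X0 y) := by
        unfold Φ; ring
    _ ≤ 3 * S.Γ * S.X y + S.Γ * (√S.ε * S.M * S.d y + S.M * (1 + S.M) * S.q y) * (3 * S.Γ * √S.ε * S.q y) := by
        gcongr ?_ + _ * ?_
        exact S.pointR hy
    _ = 3 * S.Γ * S.X y + 3 * S.Γ ^ 2 * ((√S.ε * √S.ε) * (S.M * (S.d y * S.q y)) + √S.ε * (S.M * (1 + S.M)) * S.q y ^ 2) := by ring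
    _ ≤ 3 * S.Γ ^ 2 * S.X y + 3 * S.Γ ^ 2 * ((√S.ε * √S.ε) * ((1 + S.M) * (S.d y * S.q y)) + √S.ε * (S.M * (1 + S.M)) * S.q y ^ 2) := by
        gcongr ?_ * _ + 3 * S.Γ ^ 2 * (_ * (?_ * _) + _)
        · nlinarith
        · linarith
    _ = _ := by rw [s1, S.q_sq]; unfold J; ring


lemma _root_.norm_rmul (x : ℝ) (z : ℂ) : ‖(x : ℂ) * z‖ = |x| * ‖z‖ := by
  rw [norm_mul, Complex.norm_real, Real.norm_eq_abs]

lemma err_all {y : ℝ} (hy : 0 < y) :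
    (|S.nt| * (S.ω1 y * ‖S.φ y‖) ≤ S.Γ * S.q y ∧ |S.nt| * (S.ω1 y * ‖S.ψ y‖) ≤ S.Γ * S.q y) ∧
    (|S.ω2 y| * ‖S.φ y‖ ≤ S.Γ * (1 + S.M) * S.q y ∧ |S.ω2 y| * ‖S.ψ y‖ ≤ S.Γ * (1 + S.M) * S.q y) ∧
    (|S.b1 y| * (S.ω1 y * ‖S.φ y‖) ≤ S.Γ ^ 2 * S.M * S.q y ∧
      |S.b1 y| * (S.ω1 y * ‖S.ψ y‖) ≤ S.Γ ^ 2 * S.M * S.q y) ∧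
    (|S.χ1 y| * ‖S.ψ y‖ ≤ 2 * S.q y ∧ |S.χ1 y| ≤ 2 * |S.nt|) ∧
    (|S.nt| * (S.χ y * ‖S.ψ y‖) ≤ S.q y) ∧ (S.ω1 y ≤ S.Γ) ∧
    (∀ z : ℂ, ‖z‖ ≤ S.q y → |S.G1 y| * (S.ω y * ‖z‖) ≤ S.Γ ^ 2 * S.M * S.q y) ∧
    (‖S.u y‖ ≤ S.q y ∧ ‖S.v y‖ ≤ S.q y ∧ ‖S.h y‖ ≤ S.q y ∧ ‖S.g y‖ ≤ S.q y) := by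
  have hΓ := S.hΓ
  have hM := S.hM
  have hq := S.q_nn y
  obtain ⟨w1, w2, w3, w4⟩ := S.W_le (y := y)
  have hWq : √(S.W2 y) ≤ S.q y := S.Wq
  have w1 := w1.trans hWq
  have w2 := w2.trans hWq
  have w3 := w3.trans hWq
  have w4 := w4.trans hWq
  have nv := S.nv y
  have ng := S.ng y
  have hN := S.N_pos
  have hφ : ‖S.φ y‖ ≤ y * S.q y := S.φq hy
  have hψ : ‖S.ψ y‖ ≤ y * S.q y := S.ψq hy
  have o0 := S.ω1_nn y hy.le
  have c0 := S.χ_nn y hy.le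
  have c1 := S.χ_le y hy.le
  have hω := S.ω_nn y hy.le
  have o1 : S.ω1 y ≤ S.Γ := (S.ω1_le y hy.le).trans (by nlinarith)
  have hc : |S.χ1 y| ≤ 2 * |S.nt| := by
    rw [abs_of_nonpos (S.χ1_np y hy.le)]
    refine (S.χ1_le y hy.le).trans ?_
    nlinarith
  have A1 : ∀ z x : ℂ, ‖x‖ = |S.nt| * ‖z‖ → ‖x‖ ≤ S.q y → |S.nt| * (S.ω1 y * ‖z‖) ≤ S.Γ * S.q y := by
    intro z x h1 h2
    calc |S.nt| * (S.ω1 y * ‖z‖) = S.ω1 y * ‖x‖ := by rw [h1]; ring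
      _ ≤ _ := by gcongr
  have A2 : ∀ z x : ℂ, ‖x‖ = |S.nt| * ‖z‖ → ‖x‖ ≤ S.q y → ‖z‖ ≤ y * S.q y →
      |S.ω2 y| * ‖z‖ ≤ S.Γ * (1 + S.M) * S.q y := by
    intro z x h1 h2 h3
    have h4 : ‖z‖ / y ≤ S.q y := by rwa [div_le_iff₀' hy]
    calc |S.ω2 y| * ‖z‖ ≤ S.Γ * (|S.nt| + S.M / y) * ‖z‖ := by gcongr; exact S.ω2_le y hy
      _ = S.Γ * (‖x‖ + S.M * (‖z‖ / y)) := by rw [h1]; ring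
      _ ≤ S.Γ * (S.q y + S.M * S.q y) := by gcongr
      _ = _ := by ring
  have A3 : ∀ z : ℂ, ‖z‖ ≤ y * S.q y → |S.b1 y| * (S.ω1 y * ‖z‖) ≤ S.Γ ^ 2 * S.M * S.q y := by
    intro z h3
    calc |S.b1 y| * (S.ω1 y * ‖z‖) ≤ |S.b1 y| * (S.Γ * (y * S.q y)) := by gcongr
      _ = (|S.b1 y| * y) * (S.Γ * S.q y) := by ring
      _ ≤ (S.Γ * S.M) * (S.Γ * S.q y) := mul_le_mul_of_nonneg_right (S.b1_le y hy) (by positivity)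
      _ = _ := by ring
  refine ⟨⟨A1 _ _ nv w2, A1 _ _ ng w4⟩, ⟨A2 _ _ nv w2 hφ, A2 _ _ ng w4 hψ⟩, ⟨A3 _ hφ, A3 _ hψ⟩,
    ⟨?_, hc⟩, ?_, o1, ?_, w1, w2, w3, w4⟩
  · calc |S.χ1 y| * ‖S.ψ y‖ ≤ 2 * |S.nt| * ‖S.ψ y‖ := by gcongr
      _ = 2 * ‖S.g y‖ := by rw [ng]; ring
      _ ≤ _ := by gcongr
  · calc |S.nt| * (S.χ y * ‖S.ψ y‖) = S.χ y * ‖S.g y‖ := by rw [ng]; ring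
      _ ≤ 1 * S.q y := by gcongr
      _ = _ := by ring
  · intro z hz
    calc |S.G1 y| * (S.ω y * ‖z‖) ≤ |S.G1 y| * ((S.Γ * y) * S.q y) := by
          gcongr; exact S.ω_le y hy.le
      _ = (|S.G1 y| * y) * (S.Γ * S.q y) := by ring
      _ ≤ (S.Γ * S.M) * (S.Γ * S.q y) := mul_le_mul_of_nonneg_right (S.G1_le y hy) (by positivity)
      _ = _ := by ring

/-! weighted energy test functions -/
def P1 (y : ℝ) : ℂ := S.ω y * S.u y + S.ω1 y * S.φ y
def P2 (y : ℝ) : ℂ := S.ω y * S.v y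
def P3 (y : ℝ) : ℂ := S.G y * S.ω y * S.h y - S.χ y * S.ψ y + S.b y * S.ω1 y * S.φ y
def P4 (y : ℝ) : ℂ := S.G y * S.ω y * S.g y - S.χ1 y * S.g y / S.nt ^ 2
def E1 (y : ℝ) : ℂ := 2 * (S.ω1 y * S.u y) + S.ω2 y * S.φ y
def E3 (y : ℝ) : ℂ := S.G1 y * (S.ω y * S.h y) - S.χ1 y * S.ψ y + S.b1 y * (S.ω1 y * S.φ y)
  + S.b y * (S.ω2 y * S.φ y) + S.b y * (S.ω1 y * S.u y)
def E4 (y : ℝ) : ℂ := S.G1 y * (S.ω y * S.g y) + S.χ y * S.g y - S.χ2 y * S.g y / S.nt ^ 2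
  - S.χ1 y * deriv S.g y / S.nt ^ 2

lemma dP1 {y : ℝ} (hy : 0 < y) : HasDerivAt S.P1 (S.ω y * deriv S.u y + S.E1 y) y := by
  have := ((S.dω y hy).ofReal_comp.mul (S.du y)).add ((S.dω1 y hy).ofReal_comp.mul (S.dφ y hy))
  refine HasDerivAt.congr_deriv this ?_
  unfold E1; ring
lemma dP2 {y : ℝ} (hy : 0 < y) : HasDerivAt S.P2 (-(Complex.I * S.nt) * S.P1 y) y := by
  have := ((S.dω y hy).ofReal_comp.mul (S.dvT hy))
  refine HasDerivAt.congr_deriv this ?_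
  unfold P1; rw [S.vφ]; ring
lemma dP3 {y : ℝ} (hy : 0 < y) :
    HasDerivAt S.P3 ((S.G y * S.ω y : ℝ) * deriv S.h y + S.E3 y) y := by
  have := ((((S.dG y hy).ofReal_comp.mul (S.dω y hy).ofReal_comp).mul (S.dh y)).sub
    ((S.dχ y hy).ofReal_comp.mul (S.dψ y hy))).add
    (((S.db y hy).ofReal_comp.mul (S.dω1 y hy).ofReal_comp).mul (S.dφ y hy))
  refine HasDerivAt.congr_deriv this ?_
  have e : (S.G y : ℂ) * S.ω1 y = S.χ y := by exact_mod_cast S.Gω1 y hy.le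
  simp only [Pi.mul_apply]
  unfold E3; push_cast
  linear_combination (S.h y) * e
lemma dP4 {y : ℝ} (hy : 0 < y) :
    HasDerivAt S.P4 ((S.G y * S.ω y : ℝ) * deriv S.g y + S.E4 y) y := by
  have := ((((S.dG y hy).ofReal_comp.mul (S.dω y hy).ofReal_comp).mul (S.dg' y)).sub
    (((S.dχ1 y hy).ofReal_comp.mul (S.dg' y)).div_const ((S.nt : ℂ) ^ 2)))
  refine HasDerivAt.congr_deriv this ?_
  have e : (S.G y : ℂ) * S.ω1 y = S.χ y := by exact_mod_cast S.Gω1 y hy.le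
  simp only [Pi.mul_apply]
  unfold E4; push_cast
  linear_combination (S.g y) * e

lemma E1_le {y : ℝ} (hy : 0 < y) : ‖S.E1 y‖ ≤ 10 * S.Γ ^ 2 * (1 + S.M) * S.q y := by
  obtain ⟨⟨a1, a2⟩, ⟨b1, b2⟩, ⟨c1, c2⟩, ⟨d1, d2⟩, e1, f1, g1, w1, w2, w3, w4⟩ := S.err_all hy
  have hΓ := S.hΓ; have hM := S.hM; have hq := S.q_nn y
  have o0 := S.ω1_nn y hy.le
  unfold E1
  have n1 : ‖2 * ((S.ω1 y : ℂ) * S.u y)‖ ≤ 2 * (S.Γ * S.q y) := by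
    rw [norm_mul, norm_rmul, abs_of_nonneg o0]; simp only [Complex.norm_ofNat]; gcongr
  have n2 : ‖(S.ω2 y : ℂ) * S.φ y‖ ≤ S.Γ * (1 + S.M) * S.q y := by rw [norm_rmul]; exact b1
  refine (norm_add_le_of_le n1 n2).trans ?_
  have x1 : S.Γ * S.q y ≤ S.Γ ^ 2 * (1 + S.M) * S.q y := by
    gcongr ?_ * _
    nlinarith
  have x2 : S.Γ * (1 + S.M) * S.q y ≤ S.Γ ^ 2 * (1 + S.M) * S.q y := by
    gcongr ?_ * _ * _; nlinarith
  nlinarith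

lemma E3_le {y : ℝ} (hy : 0 < y) : ‖S.E3 y‖ ≤ 10 * S.Γ ^ 2 * (1 + S.M) * S.q y := by
  obtain ⟨⟨a1, a2⟩, ⟨b1, b2⟩, ⟨c1, c2⟩, ⟨d1, d2⟩, e1, f1, g1, w1, w2, w3, w4⟩ := S.err_all hy
  have hΓ := S.hΓ; have hM := S.hM; have hq := S.q_nn y
  have o0 := S.ω1_nn y hy.le
  have oω := S.ω_nn y hy.le
  have hb := S.b_le y hy.le
  unfold E3
  have n1 : ‖(S.G1 y : ℂ) * (S.ω y * S.h y)‖ ≤ S.Γ ^ 2 * S.M * S.q y := by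
    rw [norm_rmul, norm_rmul, abs_of_nonneg oω]; exact g1 _ w3
  have n2 : ‖(S.χ1 y : ℂ) * S.ψ y‖ ≤ 2 * S.q y := by rw [norm_rmul]; exact d1
  have n3 : ‖(S.b1 y : ℂ) * (S.ω1 y * S.φ y)‖ ≤ S.Γ ^ 2 * S.M * S.q y := by
    rw [norm_rmul, norm_rmul, abs_of_nonneg o0]; exact c1
  have n4 : ‖(S.b y : ℂ) * (S.ω2 y * S.φ y)‖ ≤ S.Γ * (S.Γ * (1 + S.M) * S.q y) := by
    rw [norm_rmul, norm_rmul]; gcongr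
  have n5 : ‖(S.b y : ℂ) * (S.ω1 y * S.u y)‖ ≤ S.Γ * (S.Γ * S.q y) := by
    rw [norm_rmul, norm_rmul, abs_of_nonneg o0]; gcongr
  refine (norm_add_le_of_le (norm_add_le_of_le (norm_add_le_of_le (norm_sub_le_of_le n1 n2) n3) n4) n5).trans ?_
  have x1 : 1 * S.q y ≤ S.Γ ^ 2 * S.q y := by gcongr ?_ * _; nlinarith
  have x2 : 0 ≤ S.Γ ^ 2 * S.M * S.q y := by positivity
  nlinarith

lemma E4_le {y : ℝ} (hy : 0 < y) : ‖S.E4 y‖ ≤ 10 * S.Γ ^ 2 * (1 + S.M) * S.q y := by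
  obtain ⟨⟨a1, a2⟩, ⟨b1, b2⟩, ⟨c1, c2⟩, ⟨d1, d2⟩, e1, f1, g1, w1, w2, w3, w4⟩ := S.err_all hy
  have hΓ := S.hΓ; have hM := S.hM; have hq := S.q_nn y
  have oω := S.ω_nn y hy.le
  have hN := S.N_pos
  have hn2 : S.nt ^ 2 = |S.nt| ^ 2 := (sq_abs _).symm
  have nn : ‖(S.nt : ℂ) ^ 2‖ = |S.nt| ^ 2 := by simp
  unfold E4
  have n1 : ‖(S.G1 y : ℂ) * (S.ω y * S.g y)‖ ≤ S.Γ ^ 2 * S.M * S.q y := by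
    rw [norm_rmul, norm_rmul, abs_of_nonneg oω]; exact g1 _ w4
  have n2 : ‖(S.χ y : ℂ) * S.g y‖ ≤ 1 * S.q y := by
    rw [norm_rmul, abs_of_nonneg (S.χ_nn y hy.le)]
    gcongr; exact S.χ_le y hy.le
  have n3 : ‖(S.χ2 y : ℂ) * S.g y / S.nt ^ 2‖ ≤ 6 * S.q y := by
    rw [norm_div, norm_rmul, nn, div_le_iff₀ (by positivity)]
    calc |S.χ2 y| * ‖S.g y‖ ≤ (6 * S.nt ^ 2) * S.q y := by gcongr; exact S.χ2_le y hy
      _ = _ := by rw [hn2]; ring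
  have n4 : ‖(S.χ1 y : ℂ) * deriv S.g y / S.nt ^ 2‖ ≤ 2 * S.q y := by
    rw [norm_div, norm_rmul, nn, div_le_iff₀ (by positivity), S.dg hy]
    have : ‖-(Complex.I * S.nt) * S.h y‖ = |S.nt| * ‖S.h y‖ := by simp
    rw [this]
    calc |S.χ1 y| * (|S.nt| * ‖S.h y‖) ≤ (2 * |S.nt|) * (|S.nt| * S.q y) := by gcongr
      _ = _ := by ring
  refine (norm_sub_le_of_le (norm_sub_le_of_le (norm_add_le_of_le n1 n2) n3) n4).trans ?_
  have x1 : 1 * S.q y ≤ S.Γ ^ 2 * S.q y := by gcongr ?_ * _; nlinarith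
  have x2 : 0 ≤ S.Γ ^ 2 * S.M * S.q y := by positivity
  nlinarith

end Sys

namespace Sys
variable (S : Sys)

lemma sumP {y : ℝ} (hy : 0 < y) :
    ‖S.P1 y‖ + ‖S.P2 y‖ + ‖S.P3 y‖ + ‖S.P4 y‖ ≤ 4 * S.Γ ^ 2 * S.X0 y := by
  have hΓ := S.hΓ
  have h0 : 0 < S.Γ := by linarith
  have hN := S.N_pos
  obtain ⟨w1, w2, w3, w4⟩ := S.W_le (y := y)
  have oω := S.ω_nn y hy.le
  have o0 := S.ω1_nn y hy.le
  have o1 := S.ω1_le y hy.le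
  have c0 := S.χ_nn y hy.le
  have gp : 0 < S.G y := by nlinarith [S.G_low y hy.le]
  have gl := S.G_le y hy.le
  have hb := S.b_le y hy.le
  have hc := S.χ1_le y hy.le
  have aω := abs_of_nonneg oω
  have aω1 := abs_of_nonneg o0
  have aχ := abs_of_nonneg c0
  have aG := abs_of_pos gp
  have nn : ‖(S.nt : ℂ) ^ 2‖ = |S.nt| ^ 2 := by simp
  have hW := Real.sqrt_nonneg (S.W2 y)
  have hφ := norm_nonneg (S.φ y)
  have hψ := norm_nonneg (S.ψ y)
  have m1 : ‖S.P1 y‖ ≤ S.ω y * √(S.W2 y) + (S.Γ * S.χ y) * ‖S.φ y‖ := by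
    unfold P1
    refine norm_add_le_of_le ?_ ?_
    · rw [norm_rmul, aω]; gcongr
    · rw [norm_rmul, aω1]; gcongr
  have m2 : ‖S.P2 y‖ ≤ S.ω y * √(S.W2 y) := by
    unfold P2; rw [norm_rmul, aω]; gcongr
  have m3 : ‖S.P3 y‖ ≤ S.Γ * (S.ω y * √(S.W2 y)) + S.χ y * ‖S.ψ y‖ + S.Γ * ((S.Γ * S.χ y) * ‖S.φ y‖) := by
    unfold P3
    refine norm_add_le_of_le (norm_sub_le_of_le ?_ ?_) ?_
    · rw [mul_assoc, norm_rmul, norm_rmul, aG, aω]; gcongr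
    · rw [norm_rmul, aχ]
    · rw [mul_assoc, norm_rmul, norm_rmul, aω1]; gcongr
  have m4 : ‖S.P4 y‖ ≤ S.Γ * (S.ω y * √(S.W2 y)) + 2 * (S.χ y * ‖S.ψ y‖) := by
    unfold P4
    refine norm_sub_le_of_le ?_ ?_
    · rw [mul_assoc, norm_rmul, norm_rmul, aG, aω]; gcongr
    · rw [norm_div, norm_rmul, nn, div_le_iff₀ (by positivity), abs_of_nonpos (S.χ1_np y hy.le), S.ng]
      calc -S.χ1 y * (|S.nt| * ‖S.ψ y‖) ≤ (2 * |S.nt| * S.χ y) * (|S.nt| * ‖S.ψ y‖) := by gcongr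
        _ = _ := by ring
  have x1 : 0 ≤ S.ω y * √(S.W2 y) := by positivity
  have x2 : 0 ≤ S.χ y * ‖S.φ y‖ := by positivity
  have x3 : 0 ≤ S.χ y * ‖S.ψ y‖ := by positivity
  have y1 : S.Γ ≤ S.Γ ^ 2 := by nlinarith
  have y2 : 1 ≤ S.Γ ^ 2 := by nlinarith
  unfold X0
  calc _ ≤ (2 + 2 * S.Γ) * (S.ω y * √(S.W2 y)) + (S.Γ + S.Γ ^ 2) * (S.χ y * ‖S.φ y‖)
        + 3 * (S.χ y * ‖S.ψ y‖) := by linarith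
    _ ≤ (4 * S.Γ ^ 2) * (S.ω y * √(S.W2 y)) + (4 * S.Γ ^ 2) * (S.χ y * ‖S.φ y‖)
        + (4 * S.Γ ^ 2) * (S.χ y * ‖S.ψ y‖) := by gcongr <;> linarith
    _ = _ := by ring

def cP (y : ℝ) : ℝ := (Complex.I * S.nt * (S.χ y * (S.φ y * conj (S.ψ y)))).re
def cP' (y : ℝ) : ℝ := (Complex.I * S.nt * (S.χ1 y * (S.φ y * conj (S.ψ y))
  + S.χ y * (S.u y * conj (S.ψ y) + S.φ y * conj (S.h y)))).re

lemma dcP {y : ℝ} (hy : 0 < y) : HasDerivAt S.cP (S.cP' y) y := by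
  have := hasDerivAt_re (((S.dχ y hy).ofReal_comp.mul
    ((S.dφ y hy).mul (hasDerivAt_conj (S.dψ y hy)))).const_mul (Complex.I * S.nt))
  exact this

lemma coupP {y : ℝ} (hy : 0 < y) :
    (Complex.I * S.nt * ((S.b y * S.u y - S.G y * S.h y) * conj (S.P1 y)
          + (S.b y * S.v y - S.G y * S.g y) * conj (S.P2 y)
          - S.u y * conj (S.P3 y) - S.v y * conj (S.P4 y))).re = S.cP' y := by
  have e : (S.G y : ℂ) * S.ω1 y = S.χ y := by exact_mod_cast S.Gω1 y hy.le
  have hn : (S.nt : ℂ) ≠ 0 := by exact_mod_cast S.hnt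
  have e2 : S.v y * conj (S.g y) = S.nt ^ 2 * (S.φ y * conj (S.ψ y)) := by
    rw [S.vφ, S.gψ]
    simp only [map_mul, map_neg, Complex.conj_I, Complex.conj_ofReal]
    linear_combination (-(S.nt : ℂ) ^ 2 * (S.φ y * conj (S.ψ y))) * Complex.I_sq
  have key : Complex.I * S.nt * ((S.b y * S.u y - S.G y * S.h y) * conj (S.P1 y)
          + (S.b y * S.v y - S.G y * S.g y) * conj (S.P2 y)
          - S.u y * conj (S.P3 y) - S.v y * conj (S.P4 y)) =
      Complex.I * S.nt * (S.χ1 y * (S.φ y * conj (S.ψ y))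
          + S.χ y * (S.u y * conj (S.ψ y) + S.φ y * conj (S.h y)))
      + Complex.I * ((S.nt * S.b y * S.ω y * (‖S.u y‖ ^ 2 + ‖S.v y‖ ^ 2) : ℝ) : ℂ)
      - (S.nt * S.G y * S.ω y : ℝ) * (Complex.I * (S.h y * conj (S.u y) + S.u y * conj (S.h y)
         + (S.g y * conj (S.v y) + S.v y * conj (S.g y))))
      - (S.nt * S.χ y : ℝ) * (Complex.I * (S.h y * conj (S.φ y) + S.φ y * conj (S.h y))) := by
    unfold P1 P2 P3 P4
    push_cast
    rw [← Complex.mul_conj' (S.u y), ← Complex.mul_conj' (S.v y)]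
    simp only [map_add, map_sub, map_mul, map_div₀, map_pow, Complex.conj_ofReal]
    have e3 : S.v y * (S.χ1 y * conj (S.g y) / (S.nt : ℂ) ^ 2) = S.χ1 y * (S.φ y * conj (S.ψ y)) := by
      rw [mul_div_assoc', div_eq_iff (by positivity)]
      linear_combination (S.χ1 y : ℂ) * e2
    linear_combination (-Complex.I * S.nt * S.h y * conj (S.φ y)) * e + Complex.I * S.nt * e3
  have sym : ∀ a b : ℂ, (Complex.I * (a * conj b + b * conj a)).re = 0 := by
    intro a b; simp; ring
  have sym4 : (Complex.I * (S.h y * conj (S.u y) + S.u y * conj (S.h y)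
         + (S.g y * conj (S.v y) + S.v y * conj (S.g y)))).re = 0 := by
    rw [mul_add, Complex.add_re, sym, sym, add_zero]
  rw [key, Complex.sub_re, Complex.sub_re, Complex.add_re, Complex.re_ofReal_mul,
    Complex.re_ofReal_mul, sym, sym4]
  simp only [Complex.I_mul_re, Complex.ofReal_im]
  unfold cP'; ring

lemma kP {y : ℝ} (hy : 0 < y) :
    |S.nt| * ‖(S.ω1 y : ℂ) * S.φ y‖ ≤ 10 * S.Γ ^ 2 * (1 + S.M) * S.q y ∧
    ‖(S.ω1 y : ℂ) * S.v y‖ ≤ 10 * S.Γ ^ 2 * (1 + S.M) * S.q y ∧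
    |S.nt| * ‖-(S.χ y * S.ψ y) + (S.b y : ℂ) * (S.ω1 y * S.φ y)‖ ≤ 10 * S.Γ ^ 2 * (1 + S.M) * S.q y ∧
    |S.nt| * ‖-((S.χ1 y : ℂ) * S.g y / S.nt ^ 2)‖ ≤ 10 * S.Γ ^ 2 * (1 + S.M) * S.q y := by
  obtain ⟨⟨a1, a2⟩, ⟨b1, b2⟩, ⟨c1, c2⟩, ⟨d1, d2⟩, e1, f1, g1, w1, w2, w3, w4⟩ := S.err_all hy
  have hΓ := S.hΓ
  have hM := S.hM
  have h0 : 0 < S.Γ := by linarith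
  have hq := S.q_nn y
  have o0 := S.ω1_nn y hy.le
  have hb := S.b_le y hy.le
  have hN := S.N_pos
  have nn : ‖(S.nt : ℂ) ^ 2‖ = |S.nt| ^ 2 := by simp
  obtain ⟨B, hB⟩ : ∃ B, B = 10 * S.Γ ^ 2 * (1 + S.M) * S.q y := ⟨_, rfl⟩
  rw [← hB]
  have B0 : S.Γ ^ 2 * S.q y * 10 ≤ B := by rw [hB]; nlinarith [mul_nonneg (mul_nonneg (sq_nonneg S.Γ) hM) hq]
  have x1 : 1 * S.q y ≤ S.Γ ^ 2 * S.q y := by gcongr ?_ * _; nlinarith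
  have x2 : S.Γ * S.q y ≤ S.Γ ^ 2 * S.q y := by gcongr ?_ * _; nlinarith
  -- diffusion
  have k1 : |S.nt| * ‖(S.ω1 y : ℂ) * S.φ y‖ ≤ B := by
    rw [norm_rmul, abs_of_nonneg o0]; linarith
  have k2 : ‖(S.ω1 y : ℂ) * S.v y‖ ≤ B := by
    rw [norm_rmul, abs_of_nonneg o0]
    have : S.ω1 y * ‖S.v y‖ ≤ S.Γ * S.q y := by gcongr
    linarith
  have k3 : |S.nt| * ‖-(S.χ y * S.ψ y) + (S.b y : ℂ) * (S.ω1 y * S.φ y)‖ ≤ B := by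
    have i1 : ‖-((S.χ y : ℂ) * S.ψ y) + (S.b y : ℂ) * (S.ω1 y * S.φ y)‖ ≤ S.χ y * ‖S.ψ y‖ + S.Γ * (S.ω1 y * ‖S.φ y‖) := by
      refine norm_add_le_of_le ?_ ?_
      · rw [norm_neg, norm_rmul, abs_of_nonneg (S.χ_nn y hy.le)]
      · rw [norm_rmul, norm_rmul, abs_of_nonneg o0]; gcongr
    have i2 := mul_le_mul_of_nonneg_left i1 hN.le
    have i3 := mul_le_mul_of_nonneg_left a1 h0.le
    have i4 : |S.nt| * (S.χ y * ‖S.ψ y‖ + S.Γ * (S.ω1 y * ‖S.φ y‖)) =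
      |S.nt| * (S.χ y * ‖S.ψ y‖) + S.Γ * (|S.nt| * (S.ω1 y * ‖S.φ y‖)) := by ring
    have i5 : S.Γ * (S.Γ * S.q y) = S.Γ ^ 2 * S.q y := by ring
    linarith
  have k4 : |S.nt| * ‖-((S.χ1 y : ℂ) * S.g y / S.nt ^ 2)‖ ≤ B := by
    rw [norm_neg, norm_div, norm_rmul, nn, S.ng]
    have : |S.nt| * (|S.χ1 y| * (|S.nt| * ‖S.ψ y‖) / |S.nt| ^ 2) = |S.χ1 y| * ‖S.ψ y‖ := by field_simp
    rw [this]; linarith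
  exact ⟨k1, k2, k3, k4⟩

set_option maxHeartbeats 1000000 in
lemma pointP (hF : S.FB) {y : ℝ} (hy : 0 < y) :
      (S.F1 y * conj (S.P1 y) + S.F2 y * conj (S.P2 y) + S.F3 y * conj (S.P3 y)
        + S.F4 y * conj (S.P4 y)).re
      - (Complex.I * S.nt * ((S.b y * S.u y - S.G y * S.h y) * conj (S.P1 y)
          + (S.b y * S.v y - S.G y * S.g y) * conj (S.P2 y)
          - S.u y * conj (S.P3 y) - S.v y * conj (S.P4 y))).re
      - S.μ * S.ε * (deriv S.u y * conj (S.ω y * deriv S.u y + S.E1 y)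
          + S.nt ^ 2 * (S.u y * conj (S.P1 y))).re
      - S.μ * S.ε * (deriv S.v y * conj (-(Complex.I * S.nt) * S.P1 y)
          + S.nt ^ 2 * (S.v y * conj (S.P2 y))).re
      - S.κ * S.ε * (deriv S.h y * conj ((S.G y * S.ω y : ℝ) * deriv S.h y + S.E3 y)
          + S.nt ^ 2 * (S.h y * conj (S.P3 y))).re
      - S.κ * S.ε * (deriv S.g y * conj ((S.G y * S.ω y : ℝ) * deriv S.g y + S.E4 y)
          + S.nt ^ 2 * (S.g y * conj (S.P4 y))).re
      + S.cP' y ≤ 100 * S.Γ ^ 4 * S.J y + 0 * S.J y + 0 * S.J y - S.ε / S.Γ ^ 2 * (S.ω y * S.d2 y) := by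
  obtain ⟨⟨a1, a2⟩, ⟨b1, b2⟩, ⟨c1, c2⟩, ⟨d1, d2⟩, e1, f1, g1, w1, w2, w3, w4⟩ := S.err_all hy
  have hΓ := S.hΓ
  have hM := S.hM
  have h0 : 0 < S.Γ := by linarith
  have hε := S.hε0
  have hκ := S.hκ0
  obtain ⟨p1, p2, p3, p4⟩ := S.d_le (y := y)
  obtain ⟨n1, n2, n3, n4⟩ := S.Nd_le (y := y)
  have hd := S.d_nn y
  have hq := S.q_nn y
  have oω := S.ω_nn y hy.le
  have o0 := S.ω1_nn y hy.le
  have hb := S.b_le y hy.le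
  have hN := S.N_pos
  have nn : ‖(S.nt : ℂ) ^ 2‖ = |S.nt| ^ 2 := by simp
  obtain ⟨B, hB⟩ : ∃ B, B = 10 * S.Γ ^ 2 * (1 + S.M) * S.q y := ⟨_, rfl⟩
  -- coupling and F
  rw [S.coupP hy]
  have f1' := S.F_le hF hy (T1 := S.P1 y) (T2 := S.P2 y) (T3 := S.P3 y) (T4 := S.P4 y)
  have f2 := mul_le_mul_of_nonneg_left (S.sumP hy) (S.Φ_nn hy)
  have f3 := mul_le_mul_of_nonneg_left (S.pointF hy) (a := 4 * S.Γ ^ 2) (by positivity)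
  obtain ⟨k1, k2, k3, k4⟩ := S.kP hy
  have q1 := S.E1_le hy
  have q3 := S.E3_le hy
  have q4 := S.E4_le hy
  rw [← hB] at k1 k2 k3 k4 q1 q3 q4
  have B0 : 0 ≤ B := (norm_nonneg _).trans k2
  have D1 := diff_low (θ := S.ω y) p1 n1 q1 k1
  have D2 := diff_low (θ := S.ω y) (k := 0) p2 n2 k2 (by simp; positivity)
  have D3 := diff_low (θ := S.G y * S.ω y) p3 n3 q3 k3
  have D4 := diff_low (θ := S.G y * S.ω y) p4 n4 q4 k4
  have r1 : (S.ω y : ℂ) * S.u y + S.ω1 y * S.φ y = S.P1 y := rfl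
  have r2 : (S.ω y : ℂ) * S.v y + 0 = S.P2 y := by unfold P2; ring
  have r2' : (S.ω y : ℂ) * deriv S.v y + S.ω1 y * S.v y = -(Complex.I * S.nt) * S.P1 y := by
    unfold P1; rw [S.dv hy, S.vφ]; ring
  have r3 : ((S.G y * S.ω y : ℝ) : ℂ) * S.h y + (-(S.χ y * S.ψ y) + (S.b y : ℂ) * (S.ω1 y * S.φ y)) = S.P3 y := by
    unfold P3; push_cast; ring
  have r4 : ((S.G y * S.ω y : ℝ) : ℂ) * S.g y + -((S.χ1 y : ℂ) * S.g y / S.nt ^ 2) = S.P4 y := by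
    unfold P4; push_cast; ring
  rw [r1] at D1
  rw [r2, r2'] at D2
  rw [r3] at D3
  rw [r4] at D4
  have m1 := S.main_low hy oω
  have hμε : 0 ≤ S.μ * S.ε := by have := S.hμ0; positivity
  have hκε : 0 ≤ S.κ * S.ε := by positivity
  have G1 := mul_le_mul_of_nonneg_left D1 hμε
  have G2 := mul_le_mul_of_nonneg_left D2 hμε
  have G3 := mul_le_mul_of_nonneg_left D3 hκε
  have G4 := mul_le_mul_of_nonneg_left D4 hκε
  have hdd : √(S.d2 y) = S.d y := rfl
  rw [hdd] at G1 G2 G3 G4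
  have BJ : S.ε * (B * S.d y) ≤ 10 * S.Γ ^ 2 * S.J y := by
    have hX := S.X_nn y
    have hq2 := S.q2_nn y
    have : 0 ≤ √S.ε * (S.M * (1 + S.M)) * S.q2 y := by positivity
    calc S.ε * (B * S.d y) = 10 * S.Γ ^ 2 * ((1 + S.M) * S.ε * (S.d y * S.q y)) := by rw [hB]; ring
      _ ≤ _ := by gcongr; unfold J; linarith
  have hB0 : 0 ≤ S.ε * (B * S.d y) := by positivity
  have M1 : S.μ * (S.ε * (B * S.d y)) ≤ S.Γ * (10 * S.Γ ^ 2 * S.J y) :=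
    mul_le_mul S.hμ BJ hB0 h0.le
  have M2 : S.κ * (S.ε * (B * S.d y)) ≤ S.Γ * (10 * S.Γ ^ 2 * S.J y) :=
    mul_le_mul S.hκ BJ hB0 h0.le
  have J0 := S.J_nn (y := y)
  have fin : S.Γ * (10 * S.Γ ^ 2 * S.J y) ≤ 10 * S.Γ ^ 4 * S.J y := by
    calc S.Γ * (10 * S.Γ ^ 2 * S.J y) = 10 * S.Γ ^ 3 * S.J y := by ring
      _ ≤ 10 * S.Γ ^ 4 * S.J y := by gcongr; norm_num
  have fin2 : 4 * S.Γ ^ 2 * (3 * S.Γ ^ 2 * S.J y) = 12 * S.Γ ^ 4 * S.J y := by ring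
  have fin3 : 0 ≤ S.Γ ^ 4 * S.J y := by positivity
  linarith
end Sys

namespace Sys
variable (S : Sys)

def sg : ℝ := if 0 < S.nt then 1 else -1
lemma sg_nt : S.sg * S.nt = |S.nt| := by
  unfold sg; split_ifs with h
  · rw [abs_of_pos h, one_mul]
  · rw [abs_of_nonpos (not_lt.1 h)]; ring
lemma sg_abs : |S.sg| = 1 := by
  unfold sg; split_ifs <;> simp
def ι : ℂ := -(Complex.I * S.sg)
lemma ι_norm : ‖S.ι‖ = 1 := by unfold ι; simp [S.sg_abs]
lemma ι_conj : conj S.ι = Complex.I * S.sg := by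
  unfold ι; simp only [map_neg, map_mul, Complex.conj_I, Complex.conj_ofReal]; ring
lemma ι_mul_norm (z : ℂ) : ‖S.ι * z‖ = ‖z‖ := by rw [norm_mul, S.ι_norm, one_mul]

def S1 (y : ℝ) : ℂ := S.ι * (S.ω y * S.h y + S.ω1 y * S.ψ y)
def S2 (y : ℝ) : ℂ := S.ι * (S.ω y * S.g y)
def S3 (y : ℝ) : ℂ := S.ι * ((S.Γ ^ 3 * S.ω y : ℝ) * S.u y + S.b y * S.ω1 y * S.ψ y)
def S4 (y : ℝ) : ℂ := S.ι * ((S.Γ ^ 3 * S.ω y : ℝ) * S.v y)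
def S1' (y : ℝ) : ℂ := S.ι * (S.ω y * deriv S.h y + 2 * (S.ω1 y * S.h y) + S.ω2 y * S.ψ y)
def S3' (y : ℝ) : ℂ := S.ι * ((S.Γ ^ 3 * S.ω y : ℝ) * deriv S.u y + (S.Γ ^ 3 * S.ω1 y : ℝ) * S.u y
  + S.b1 y * (S.ω1 y * S.ψ y) + S.b y * (S.ω2 y * S.ψ y) + S.b y * (S.ω1 y * S.h y))
def S4' (y : ℝ) : ℂ := S.ι * ((S.Γ ^ 3 * S.ω y : ℝ) * deriv S.v y + (S.Γ ^ 3 * S.ω1 y : ℝ) * S.v y)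

lemma dS1 {y : ℝ} (hy : 0 < y) : HasDerivAt S.S1 (S.S1' y) y := by
  have := (((S.dω y hy).ofReal_comp.mul (S.dh y)).add ((S.dω1 y hy).ofReal_comp.mul (S.dψ y hy))).const_mul S.ι
  refine HasDerivAt.congr_deriv this ?_
  unfold S1'; ring
lemma dS2 {y : ℝ} (hy : 0 < y) : HasDerivAt S.S2 (-(Complex.I * S.nt) * S.S1 y) y := by
  have := ((S.dω y hy).ofReal_comp.mul (S.dgT hy)).const_mul S.ι
  refine HasDerivAt.congr_deriv this ?_
  unfold S1; rw [S.gψ]; ring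
lemma dS3 {y : ℝ} (hy : 0 < y) : HasDerivAt S.S3 (S.S3' y) y := by
  have := (((((S.dω y hy).const_mul (S.Γ ^ 3)).ofReal_comp).mul (S.du y)).add
    (((S.db y hy).ofReal_comp.mul (S.dω1 y hy).ofReal_comp).mul (S.dψ y hy))).const_mul S.ι
  refine HasDerivAt.congr_deriv this ?_
  simp only [Pi.mul_apply]
  unfold S3'; push_cast; ring
lemma dS4 {y : ℝ} (hy : 0 < y) : HasDerivAt S.S4 (S.S4' y) y := by
  have := (((((S.dω y hy).const_mul (S.Γ ^ 3)).ofReal_comp).mul (S.dv' y))).const_mul S.ι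
  refine HasDerivAt.congr_deriv this ?_
  unfold S4'; push_cast; ring

lemma sumS {y : ℝ} (hy : 0 < y) :
    ‖S.S1 y‖ + ‖S.S2 y‖ + ‖S.S3 y‖ + ‖S.S4 y‖ ≤ 4 * S.Γ ^ 3 * S.X0 y := by
  have hΓ := S.hΓ
  have h0 : 0 < S.Γ := by linarith
  obtain ⟨w1, w2, w3, w4⟩ := S.W_le (y := y)
  have oω := S.ω_nn y hy.le
  have o0 := S.ω1_nn y hy.le
  have o1 := S.ω1_le y hy.le
  have c0 := S.χ_nn y hy.le
  have hb := S.b_le y hy.le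
  have aω := abs_of_nonneg oω
  have aω1 := abs_of_nonneg o0
  have hW := Real.sqrt_nonneg (S.W2 y)
  have hφ := norm_nonneg (S.φ y)
  have hψ := norm_nonneg (S.ψ y)
  have aL : |S.Γ ^ 3 * S.ω y| = S.Γ ^ 3 * S.ω y := abs_of_nonneg (by positivity)
  have m1 : ‖S.S1 y‖ ≤ S.ω y * √(S.W2 y) + (S.Γ * S.χ y) * ‖S.ψ y‖ := by
    unfold S1
    rw [ι_mul_norm]
    refine norm_add_le_of_le ?_ ?_
    · rw [norm_rmul, aω]; gcongr
    · rw [norm_rmul, aω1]; gcongr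
  have m2 : ‖S.S2 y‖ ≤ S.ω y * √(S.W2 y) := by
    unfold S2; rw [ι_mul_norm, norm_rmul, aω]; gcongr
  have m3 : ‖S.S3 y‖ ≤ S.Γ ^ 3 * S.ω y * √(S.W2 y) + S.Γ * ((S.Γ * S.χ y) * ‖S.ψ y‖) := by
    unfold S3
    rw [ι_mul_norm]
    refine norm_add_le_of_le ?_ ?_
    · rw [norm_rmul, aL]; gcongr
    · rw [mul_assoc, norm_rmul, norm_rmul, aω1]; gcongr
  have m4 : ‖S.S4 y‖ ≤ S.Γ ^ 3 * S.ω y * √(S.W2 y) := by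
    unfold S4; rw [ι_mul_norm, norm_rmul, aL]; gcongr
  have x1 : 0 ≤ S.ω y * √(S.W2 y) := by positivity
  have x2 : 0 ≤ S.χ y * ‖S.φ y‖ := by positivity
  have x3 : 0 ≤ S.χ y * ‖S.ψ y‖ := by positivity
  have y2 : 1 ≤ S.Γ ^ 3 := one_le_pow₀ hΓ
  have y1 : S.Γ ≤ S.Γ ^ 3 := le_self_pow₀ hΓ (by norm_num)
  have y3 : S.Γ ^ 2 ≤ S.Γ ^ 3 := pow_le_pow_right₀ hΓ (by norm_num)
  unfold X0
  calc _ ≤ (2 + 2 * S.Γ ^ 3) * (S.ω y * √(S.W2 y)) + (0:ℝ) * (S.χ y * ‖S.φ y‖)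
        + (S.Γ + S.Γ ^ 2) * (S.χ y * ‖S.ψ y‖) := by linarith
    _ ≤ (4 * S.Γ ^ 3) * (S.ω y * √(S.W2 y)) + (4 * S.Γ ^ 3) * (S.χ y * ‖S.φ y‖)
        + (4 * S.Γ ^ 3) * (S.χ y * ‖S.ψ y‖) := by gcongr <;> linarith
    _ = _ := by ring

def cS (y : ℝ) : ℝ := (((|S.nt| / 2 : ℝ) : ℂ) * (S.χ y * (S.ψ y * conj (S.ψ y)))).re
def cS' (y : ℝ) : ℝ := (((|S.nt| / 2 : ℝ) : ℂ) * (S.χ1 y * (S.ψ y * conj (S.ψ y))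
  + S.χ y * (S.h y * conj (S.ψ y) + S.ψ y * conj (S.h y)))).re

lemma dcS {y : ℝ} (hy : 0 < y) : HasDerivAt S.cS (S.cS' y) y := by
  have := hasDerivAt_re (((S.dχ y hy).ofReal_comp.mul
    ((S.dψ y hy).mul (hasDerivAt_conj (S.dψ y hy)))).const_mul ((|S.nt| / 2 : ℝ) : ℂ))
  exact this

lemma coupS {y : ℝ} (hy : 0 < y) :
    -(Complex.I * S.nt * ((S.b y * S.u y - S.G y * S.h y) * conj (S.S1 y)
          + (S.b y * S.v y - S.G y * S.g y) * conj (S.S2 y)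
          - S.u y * conj (S.S3 y) - S.v y * conj (S.S4 y))).re + S.cS' y ≤
     - (|S.nt| / (2 * S.Γ) * (S.ω y * S.W2 y)) := by
  have e : (S.G y : ℂ) * S.ω1 y = S.χ y := by exact_mod_cast S.Gω1 y hy.le
  have hn : (S.sg : ℂ) * S.nt = (|S.nt| : ℝ) := by exact_mod_cast S.sg_nt
  have key : -(Complex.I * S.nt * ((S.b y * S.u y - S.G y * S.h y) * conj (S.S1 y)
          + (S.b y * S.v y - S.G y * S.g y) * conj (S.S2 y)
          - S.u y * conj (S.S3 y) - S.v y * conj (S.S4 y))) +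
      (((|S.nt| / 2 : ℝ) : ℂ) * (S.χ1 y * (S.ψ y * conj (S.ψ y))
  + S.χ y * (S.h y * conj (S.ψ y) + S.ψ y * conj (S.h y)))) =
      ((|S.nt| * S.b y * S.ω y : ℝ) : ℂ) * (S.u y * conj (S.h y) + S.v y * conj (S.g y))
      - ((|S.nt| * S.ω y * (S.G y * (‖S.h y‖ ^ 2 + ‖S.g y‖ ^ 2) + S.Γ ^ 3 * (‖S.u y‖ ^ 2 + ‖S.v y‖ ^ 2))
         - |S.nt| / 2 * S.χ1 y * ‖S.ψ y‖ ^ 2 : ℝ) : ℂ)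
      + ((|S.nt| * S.χ y / 2 : ℝ) : ℂ) * (S.ψ y * conj (S.h y) - S.h y * conj (S.ψ y)) := by
    unfold S1 S2 S3 S4
    push_cast
    rw [← Complex.mul_conj' (S.u y), ← Complex.mul_conj' (S.v y), ← Complex.mul_conj' (S.h y), ← Complex.mul_conj' (S.g y), ← Complex.mul_conj' (S.ψ y)]
    simp only [map_add, map_sub, map_mul, map_pow, Complex.conj_ofReal, S.ι_conj]
    rw [← hn, ← e]
    ring_nf
    simp only [Complex.I_sq]
    ring
  have anti : (S.ψ y * conj (S.h y) - S.h y * conj (S.ψ y)).re = 0 := by simp; ring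
  have key2 := congrArg Complex.re key
  rw [Complex.add_re, Complex.neg_re, Complex.add_re, Complex.sub_re, Complex.re_ofReal_mul _ (_ - _), anti,
    Complex.re_ofReal_mul _ (S.u y * conj (S.h y) + _), Complex.ofReal_re] at key2
  unfold cS'
  rw [key2]
  have hN := S.N_pos
  have hΓ := S.hΓ
  have h0 : 0 < S.Γ := by linarith
  have oω := S.ω_nn y hy.le
  have hb := S.b_le y hy.le
  have gl : 1 / S.Γ ≤ S.G y := by rw [div_le_iff₀ h0]; linarith [S.G_low y hy.le]
  have am : ∀ z x : ℂ, S.b y * (z * conj x).re ≤ 1 / (2 * S.Γ) * ‖x‖ ^ 2 + S.Γ ^ 3 / 2 * ‖z‖ ^ 2 := by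
    intro z x
    have h1 := re_le_norm_mul (le_refl ‖z‖) (le_refl ‖x‖)
    have h2 : S.b y * (z * conj x).re ≤ S.Γ * (‖z‖ * ‖x‖) := by
      refine (le_abs_self _).trans ?_
      rw [abs_mul]; gcongr
    have h3 : 0 ≤ 1 / (2 * S.Γ) * (‖x‖ - S.Γ ^ 2 * ‖z‖) ^ 2 := by positivity
    have h4 : 1 / (2 * S.Γ) * (‖x‖ - S.Γ ^ 2 * ‖z‖) ^ 2 = 1 / (2 * S.Γ) * ‖x‖ ^ 2 + S.Γ ^ 3 / 2 * ‖z‖ ^ 2 - S.Γ * (‖z‖ * ‖x‖) := by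
      field_simp; ring
    linarith
  have a1 := am (S.u y) (S.h y)
  have a2 := am (S.v y) (S.g y)
  have hx : |S.nt| / 2 * S.χ1 y * ‖S.ψ y‖ ^ 2 ≤ 0 := by
    have : 0 ≤ |S.nt| / 2 * (-S.χ1 y) * ‖S.ψ y‖ ^ 2 := by
      have := S.χ1_np y hy.le
      have : 0 ≤ -S.χ1 y := by linarith
      positivity
    linarith
  have y3 : 1 / S.Γ ≤ S.Γ ^ 3 := by
    rw [div_le_iff₀ h0, ← pow_succ]; exact one_le_pow₀ hΓ
  have half : 1 / (2 * S.Γ) = 1 / 2 * (1 / S.Γ) := by field_simp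
  have b1 : S.b y * (S.u y * conj (S.h y) + S.v y * conj (S.g y)).re
      - (S.G y * (‖S.h y‖ ^ 2 + ‖S.g y‖ ^ 2) + S.Γ ^ 3 * (‖S.u y‖ ^ 2 + ‖S.v y‖ ^ 2)) ≤ - (1 / (2 * S.Γ) * S.W2 y) := by
    rw [Complex.add_re]
    have c1 := mul_le_mul_of_nonneg_right gl (a := ‖S.h y‖ ^ 2 + ‖S.g y‖ ^ 2) (by positivity)
    have c2 := mul_le_mul_of_nonneg_right y3 (a := ‖S.u y‖ ^ 2 + ‖S.v y‖ ^ 2) (by positivity)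
    rw [half] at a1 a2 ⊢
    unfold W2
    linarith
  have b2 := mul_le_mul_of_nonneg_left b1 (a := |S.nt| * S.ω y) (by positivity)
  have e2 : |S.nt| / (2 * S.Γ) * (S.ω y * S.W2 y) = |S.nt| * S.ω y * (1 / (2 * S.Γ) * S.W2 y) := by field_simp
  rw [e2]
  linarith

set_option maxHeartbeats 1000000 in
lemma kS {y : ℝ} (hy : 0 < y) : ∃ B, 
    B = S.Γ ^ 3 * S.ω y * S.d y + 10 * S.Γ ^ 4 * (1 + S.M) * S.q y ∧ 0 ≤ B ∧
    ‖S.S1' y‖ ≤ B ∧ |S.nt| * ‖S.S1 y‖ ≤ B ∧ ‖-(Complex.I * S.nt) * S.S1 y‖ ≤ B ∧ 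
    |S.nt| * ‖S.S2 y‖ ≤ B ∧ ‖S.S3' y‖ ≤ B ∧ |S.nt| * ‖S.S3 y‖ ≤ B ∧ ‖S.S4' y‖ ≤ B ∧ 
    |S.nt| * ‖S.S4 y‖ ≤ B := by
  obtain ⟨⟨a1, a2⟩, ⟨b1, b2⟩, ⟨c1, c2⟩, ⟨d1, d2⟩, e1, f1, g1, w1, w2, w3, w4⟩ := S.err_all hy
  obtain ⟨p1, p2, p3, p4⟩ := S.d_le (y := y)
  obtain ⟨n1, n2, n3, n4⟩ := S.Nd_le (y := y)
  have hdd : √(S.d2 y) = S.d y := rfl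
  rw [hdd] at p1 p2 p3 p4 n1 n2 n3 n4
  have hΓ := S.hΓ
  have hM := S.hM
  have h0 : 0 < S.Γ := by linarith
  have hq := S.q_nn y
  have hd := S.d_nn y
  have oω := S.ω_nn y hy.le
  have o0 := S.ω1_nn y hy.le
  have hb := S.b_le y hy.le
  have hN := S.N_pos
  have aω := abs_of_nonneg oω
  have aω1 := abs_of_nonneg o0
  have aL : |S.Γ ^ 3 * S.ω y| = S.Γ ^ 3 * S.ω y := abs_of_nonneg (by positivity)
  have aL1 : |S.Γ ^ 3 * S.ω1 y| = S.Γ ^ 3 * S.ω1 y := abs_of_nonneg (by positivity)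
  obtain ⟨Q, hQ⟩ : ∃ Q, Q = S.Γ ^ 4 * (1 + S.M) * S.q y := ⟨_, rfl⟩
  have y1 : S.Γ ≤ S.Γ ^ 4 := le_self_pow₀ hΓ (by norm_num)
  have y2 : 1 ≤ S.Γ ^ 3 := one_le_pow₀ hΓ
  have y3 : S.Γ ^ 2 ≤ S.Γ ^ 4 := pow_le_pow_right₀ hΓ (by norm_num)
  have z1 : S.Γ * S.q y ≤ Q := by
    rw [hQ]; gcongr ?_ * _
    calc S.Γ ≤ S.Γ ^ 4 * 1 := by linarith
      _ ≤ _ := by gcongr; linarith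
  have z2 : S.Γ * (1 + S.M) * S.q y ≤ Q := by
    rw [hQ]; gcongr ?_ * _ * _
  have z3 : S.Γ ^ 2 * S.M * S.q y ≤ Q := by
    rw [hQ]; gcongr ?_ * ?_ * _; linarith
  have z4 : S.Γ * (S.Γ * (1 + S.M) * S.q y) ≤ Q := by
    rw [hQ]
    calc _ = S.Γ ^ 2 * (1 + S.M) * S.q y := by ring
      _ ≤ _ := by gcongr ?_ * _ * _
  have z5 : S.Γ * (S.Γ * S.q y) ≤ Q := by
    refine le_trans ?_ z4
    gcongr _ * (?_ * _)
    exact le_mul_of_one_le_right h0.le (by linarith)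
  have z6 : S.Γ ^ 3 * S.Γ * S.q y ≤ Q := by
    rw [hQ]
    calc _ = S.Γ ^ 4 * 1 * S.q y := by ring
      _ ≤ _ := by gcongr; linarith
  have Q0 : 0 ≤ Q := by rw [hQ]; positivity
  have D0 : 0 ≤ S.ω y * S.d y := by positivity
  have D1 : S.ω y * S.d y ≤ S.Γ ^ 3 * S.ω y * S.d y := by
    have := mul_le_mul_of_nonneg_right y2 D0; linarith
  have r1 : ‖(S.ω1 y : ℂ) * S.h y‖ ≤ S.Γ * S.q y := by rw [norm_rmul, aω1]; gcongr
  have t1 : |S.nt| * ‖S.S1 y‖ ≤ S.Γ ^ 3 * S.ω y * S.d y + 10 * Q := by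
    unfold S1
    rw [ι_mul_norm]
    have : ‖(S.ω y : ℂ) * S.h y + S.ω1 y * S.ψ y‖ ≤ S.ω y * ‖S.h y‖ + S.ω1 y * ‖S.ψ y‖ := by
      refine norm_add_le_of_le ?_ ?_
      · rw [norm_rmul, aω]
      · rw [norm_rmul, aω1]
    have h1 := mul_le_mul_of_nonneg_left this hN.le
    have h2 := mul_le_mul_of_nonneg_left n3 oω
    have h3 : |S.nt| * (S.ω y * ‖S.h y‖ + S.ω1 y * ‖S.ψ y‖) = S.ω y * (|S.nt| * ‖S.h y‖) + |S.nt| * (S.ω1 y * ‖S.ψ y‖) := by ring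
    linarith
  refine ⟨_, rfl, by positivity, ?_⟩
  have hh : S.Γ ^ 3 * S.ω y * S.d y + 10 * S.Γ ^ 4 * (1 + S.M) * S.q y = S.Γ ^ 3 * S.ω y * S.d y + 10 * Q := by
    rw [hQ]; ring
  rw [hh]
  refine ⟨?_, t1, ?_, ?_, ?_, ?_, ?_, ?_⟩
  · unfold S1'
    rw [ι_mul_norm]
    have i1 : ‖(S.ω y : ℂ) * deriv S.h y‖ ≤ S.ω y * S.d y := by rw [norm_rmul, aω]; gcongr
    have i2 : ‖2 * ((S.ω1 y : ℂ) * S.h y)‖ ≤ 2 * (S.Γ * S.q y) := by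
      rw [norm_mul]; simp only [Complex.norm_ofNat]; gcongr
    have i3 : ‖(S.ω2 y : ℂ) * S.ψ y‖ ≤ S.Γ * (1 + S.M) * S.q y := by rw [norm_rmul]; exact b2
    refine (norm_add_le_of_le (norm_add_le_of_le i1 i2) i3).trans ?_
    linarith
  · have : ‖-(Complex.I * S.nt) * S.S1 y‖ = |S.nt| * ‖S.S1 y‖ := by simp
    rw [this]; exact t1
  · unfold S2
    rw [ι_mul_norm, norm_rmul, aω]
    have h2 := mul_le_mul_of_nonneg_left n4 oω
    linarith
  · unfold S3'
    rw [ι_mul_norm]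
    have i1 : ‖((S.Γ ^ 3 * S.ω y : ℝ) : ℂ) * deriv S.u y‖ ≤ S.Γ ^ 3 * S.ω y * S.d y := by rw [norm_rmul, aL]; gcongr
    have i2 : ‖((S.Γ ^ 3 * S.ω1 y : ℝ) : ℂ) * S.u y‖ ≤ S.Γ ^ 3 * S.Γ * S.q y := by rw [norm_rmul, aL1]; gcongr
    have i3 : ‖(S.b1 y : ℂ) * (S.ω1 y * S.ψ y)‖ ≤ S.Γ ^ 2 * S.M * S.q y := by
      rw [norm_rmul, norm_rmul, aω1]; exact c2
    have i4 : ‖(S.b y : ℂ) * (S.ω2 y * S.ψ y)‖ ≤ S.Γ * (S.Γ * (1 + S.M) * S.q y) := by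
      rw [norm_rmul, norm_rmul]; gcongr
    have i5 : ‖(S.b y : ℂ) * (S.ω1 y * S.h y)‖ ≤ S.Γ * (S.Γ * S.q y) := by
      rw [norm_rmul]; gcongr
    refine (norm_add_le_of_le (norm_add_le_of_le (norm_add_le_of_le (norm_add_le_of_le i1 i2) i3) i4) i5).trans ?_
    linarith
  · unfold S3
    rw [ι_mul_norm]
    have : ‖((S.Γ ^ 3 * S.ω y : ℝ) : ℂ) * S.u y + S.b y * S.ω1 y * S.ψ y‖ ≤ S.Γ ^ 3 * S.ω y * ‖S.u y‖ + S.Γ * (S.ω1 y * ‖S.ψ y‖) := by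
      refine norm_add_le_of_le ?_ ?_
      · rw [norm_rmul, aL]
      · rw [mul_assoc, norm_rmul, norm_rmul, aω1]; gcongr
    have h1 := mul_le_mul_of_nonneg_left this hN.le
    have h2 := mul_le_mul_of_nonneg_left n1 (a := S.Γ ^ 3 * S.ω y) (by positivity)
    have h3 := mul_le_mul_of_nonneg_left a2 h0.le
    have h4 : |S.nt| * (S.Γ ^ 3 * S.ω y * ‖S.u y‖ + S.Γ * (S.ω1 y * ‖S.ψ y‖)) = S.Γ ^ 3 * S.ω y * (|S.nt| * ‖S.u y‖) + S.Γ * (|S.nt| * (S.ω1 y * ‖S.ψ y‖)) := by ring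
    linarith
  · unfold S4'
    rw [ι_mul_norm]
    have i1 : ‖((S.Γ ^ 3 * S.ω y : ℝ) : ℂ) * deriv S.v y‖ ≤ S.Γ ^ 3 * S.ω y * S.d y := by rw [norm_rmul, aL]; gcongr
    have i2 : ‖((S.Γ ^ 3 * S.ω1 y : ℝ) : ℂ) * S.v y‖ ≤ S.Γ ^ 3 * S.Γ * S.q y := by rw [norm_rmul, aL1]; gcongr
    refine (norm_add_le_of_le i1 i2).trans ?_
    linarith
  · unfold S4
    rw [ι_mul_norm, norm_rmul, aL]
    have h2 := mul_le_mul_of_nonneg_left n2 (a := S.Γ ^ 3 * S.ω y) (by positivity)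
    linarith

lemma pointS (hF : S.FB) {y : ℝ} (hy : 0 < y) :
      (S.F1 y * conj (S.S1 y) + S.F2 y * conj (S.S2 y) + S.F3 y * conj (S.S3 y)
        + S.F4 y * conj (S.S4 y)).re
      - (Complex.I * S.nt * ((S.b y * S.u y - S.G y * S.h y) * conj (S.S1 y)
          + (S.b y * S.v y - S.G y * S.g y) * conj (S.S2 y)
          - S.u y * conj (S.S3 y) - S.v y * conj (S.S4 y))).re
      - S.μ * S.ε * (deriv S.u y * conj (S.S1' y)
          + S.nt ^ 2 * (S.u y * conj (S.S1 y))).re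
      - S.μ * S.ε * (deriv S.v y * conj (-(Complex.I * S.nt) * S.S1 y)
          + S.nt ^ 2 * (S.v y * conj (S.S2 y))).re
      - S.κ * S.ε * (deriv S.h y * conj (S.S3' y)
          + S.nt ^ 2 * (S.h y * conj (S.S3 y))).re
      - S.κ * S.ε * (deriv S.g y * conj (S.S4' y)
          + S.nt ^ 2 * (S.g y * conj (S.S4 y))).re
      + S.cS' y ≤ 100 * S.Γ ^ 5 * S.J y + 8 * S.Γ ^ 4 * S.ε * (S.ω y * S.d2 y) + 0 * S.J y
        - |S.nt| / (2 * S.Γ) * (S.ω y * S.W2 y) := by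
  obtain ⟨B, hB, B0, k1, k2, k3, k4, k5, k6, k7, k8⟩ := S.kS hy
  have hΓ := S.hΓ
  have hM := S.hM
  have h0 : 0 < S.Γ := by linarith
  have hε := S.hε0
  have hκ := S.hκ0
  obtain ⟨p1, p2, p3, p4⟩ := S.d_le (y := y)
  obtain ⟨n1, n2, n3, n4⟩ := S.Nd_le (y := y)
  have hdd : √(S.d2 y) = S.d y := rfl
  rw [hdd] at p1 p2 p3 p4 n1 n2 n3 n4
  have hd := S.d_nn y
  have hq := S.q_nn y
  have hC := S.coupS hy
  have f1' := S.F_le hF hy (T1 := S.S1 y) (T2 := S.S2 y) (T3 := S.S3 y) (T4 := S.S4 y)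
  have f2 := mul_le_mul_of_nonneg_left (S.sumS hy) (S.Φ_nn hy)
  have f3 := mul_le_mul_of_nonneg_left (S.pointF hy) (a := 4 * S.Γ ^ 3) (by positivity)
  have hμε : 0 ≤ S.μ * S.ε := by have := S.hμ0; positivity
  have hκε : 0 ≤ S.κ * S.ε := by positivity
  have G1 := mul_le_mul_of_nonneg_left (diff_low' p1 n1 k1 k2) hμε
  have G2 := mul_le_mul_of_nonneg_left (diff_low' p2 n2 k3 k4) hμε
  have G3 := mul_le_mul_of_nonneg_left (diff_low' p3 n3 k5 k6) hκε
  have G4 := mul_le_mul_of_nonneg_left (diff_low' p4 n4 k7 k8) hκε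
  have BJ : S.ε * (B * S.d y) ≤ S.Γ ^ 3 * S.ε * (S.ω y * S.d2 y) + 10 * S.Γ ^ 4 * S.J y := by
    have hX := S.X_nn y
    have hq2 := S.q2_nn y
    have : 0 ≤ √S.ε * (S.M * (1 + S.M)) * S.q2 y := by positivity
    calc S.ε * (B * S.d y) = S.Γ ^ 3 * S.ε * (S.ω y * S.d y ^ 2) + 10 * S.Γ ^ 4 * ((1 + S.M) * S.ε * (S.d y * S.q y)) := by rw [hB]; ring
      _ ≤ _ := by rw [S.d_sq]; gcongr; unfold J; linarith
  have hB0 : 0 ≤ S.ε * (B * S.d y) := by positivity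
  have M1 := mul_le_mul S.hμ BJ hB0 h0.le
  have M2 := mul_le_mul S.hκ BJ hB0 h0.le
  have J0 := S.J_nn (y := y)
  have fin : S.Γ * (S.Γ ^ 3 * S.ε * (S.ω y * S.d2 y) + 10 * S.Γ ^ 4 * S.J y) =
    S.Γ ^ 4 * S.ε * (S.ω y * S.d2 y) + 10 * (S.Γ ^ 5 * S.J y) := by ring
  have fin2 : 4 * S.Γ ^ 3 * (3 * S.Γ ^ 2 * S.J y) = 12 * (S.Γ ^ 5 * S.J y) := by ring
  have fin3 : 0 ≤ S.Γ ^ 5 * S.J y := by positivity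
  rw [fin] at M1 M2
  linarith
end Sys

namespace Sys
variable (S : Sys)

lemma iω {f : ℝ → ℝ} (hf : IntegrableOn f (Ioi 0)) : IntegrableOn (fun y => S.ω y * f y) (Ioi 0) := by
  obtain ⟨B, hB⟩ := S.ω_bdd
  have hm : AEStronglyMeasurable S.ω (volume.restrict (Ioi 0)) :=
    (S.cω.mono Ioi_subset_Ici_self).aestronglyMeasurable measurableSet_Ioi
  refine Integrable.bdd_mul (c := B) hf hm ?_
  filter_upwards [ae_restrict_mem measurableSet_Ioi] with y hy
  rw [Real.norm_of_nonneg (S.ω_nn y (le_of_lt hy))]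
  exact hB y (le_of_lt hy)

lemma iωs {f : ℝ → ℝ} (hf : IntegrableOn f (Ioi 0)) :
    IntegrableOn (fun y => (S.ω y + √S.ε) * f y) (Ioi 0) := by
  have := (S.iω hf).add (hf.const_mul (√S.ε))
  refine this.congr (Eventually.of_forall fun y => ?_)
  simp only [Pi.add_apply]; ring

def b2 : ℝ := ∫ y in Ioi (0:ℝ), S.ω y * S.W2 y
def rω : ℝ := √(∫ y in Ioi (0:ℝ), (S.ω y + √S.ε) * S.R2 y)
def L : ℝ := Real.log (S.K / √S.ε) + 1

lemma b2_nn : 0 ≤ S.b2 := setIntegral_nonneg measurableSet_Ioi fun y hy =>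
  mul_nonneg (S.ω_nn y (le_of_lt hy)) (S.W2_nn y)

lemma L_ge : 1 ≤ S.L := by
  have h1 : 0 < √S.ε := Real.sqrt_pos.2 S.hε0
  have h2 : √S.ε ≤ 1 := Real.sqrt_le_one.2 S.hε1
  have h3 : 1 ≤ S.K / √S.ε := by rw [one_le_div h1]; linarith [S.hK]
  have := Real.log_nonneg h3
  unfold L; linarith

lemma intY : IntegrableOn S.Y2 (Ioi 0) ∧
    ∫ y in Ioi (0:ℝ), S.Y2 y ≤ 17 * S.Γ * S.L ^ 2 * (S.b2 + √S.ε * S.w ^ 2) := by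
  have h1 : 0 < √S.ε := Real.sqrt_pos.2 S.hε0
  have h2 : √S.ε ≤ 1 := Real.sqrt_le_one.2 S.hε1
  have eu : ∀ y ∈ Ioi (0:ℝ), (S.ω y + √S.ε) * ‖S.u y‖ ^ 2 = (S.ω y + √S.ε) * ‖deriv S.φ y‖ ^ 2 :=
    fun y hy => by rw [(S.dφ y hy).deriv]
  have eh : ∀ y ∈ Ioi (0:ℝ), (S.ω y + √S.ε) * ‖S.h y‖ ^ 2 = (S.ω y + √S.ε) * ‖deriv S.ψ y‖ ^ 2 :=
    fun y hy => by rw [(S.dψ y hy).deriv]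
  obtain ⟨Iφ, hφ⟩ := log_hardy S.cφ S.φ0 S.iφ S.tφ h1 h2 S.hK S.hΓ S.ω_low
    ((S.iωs S.iu).congr_fun eu measurableSet_Ioi)
  obtain ⟨Iψ, hψ⟩ := log_hardy S.cψ S.ψ0 S.iψ S.tψ h1 h2 S.hK S.hΓ S.ω_low
    ((S.iωs S.ih).congr_fun eh measurableSet_Ioi)
  rw [← setIntegral_congr_fun measurableSet_Ioi eu] at hφ
  rw [← setIntegral_congr_fun measurableSet_Ioi eh] at hψ
  have IW := S.iωs S.iW2
  have hY : ∀ y, S.Y2 y = (S.ω y + √S.ε) * S.W2 y +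
      (S.K / ((y + √S.ε) * (y + S.K)) * ‖S.φ y‖ ^ 2 + S.K / ((y + √S.ε) * (y + S.K)) * ‖S.ψ y‖ ^ 2) := by
    intro y; unfold Y2; ring
  have IY : IntegrableOn S.Y2 (Ioi 0) := by
    rw [funext hY]; exact IW.add (Iφ.add Iψ)
  refine ⟨IY, ?_⟩
  have e1 : ∫ y in Ioi (0:ℝ), S.Y2 y = (∫ y in Ioi (0:ℝ), (S.ω y + √S.ε) * S.W2 y)
     + ((∫ y in Ioi (0:ℝ), S.K / ((y + √S.ε) * (y + S.K)) * ‖S.φ y‖ ^ 2)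
       + ∫ y in Ioi (0:ℝ), S.K / ((y + √S.ε) * (y + S.K)) * ‖S.ψ y‖ ^ 2) := by
    have I2 : Integrable (fun y => S.K / ((y + √S.ε) * (y + S.K)) * ‖S.φ y‖ ^ 2
        + S.K / ((y + √S.ε) * (y + S.K)) * ‖S.ψ y‖ ^ 2) (volume.restrict (Ioi 0)) := Iφ.add Iψ
    rw [← integral_add Iφ Iψ, ← integral_add IW I2]
    exact integral_congr_ae (Eventually.of_forall hY)
  have e2 : ∫ y in Ioi (0:ℝ), (S.ω y + √S.ε) * S.W2 y = S.b2 + √S.ε * S.w ^ 2 := by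
    rw [S.w_sq, ← integral_const_mul, b2, ← integral_add (S.iω S.iW2) (S.iW2.const_mul _)]
    congr 1; ext y; ring
  have e3 : (∫ y in Ioi (0:ℝ), (S.ω y + √S.ε) * ‖S.u y‖ ^ 2) + (∫ y in Ioi (0:ℝ), (S.ω y + √S.ε) * ‖S.h y‖ ^ 2)
      ≤ S.b2 + √S.ε * S.w ^ 2 := by
    rw [← e2, ← integral_add (S.iωs S.iu) (S.iωs S.ih)]
    refine setIntegral_mono_on ((S.iωs S.iu).add (S.iωs S.ih)) IW measurableSet_Ioi fun y hy => ?_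
    have := S.ω_nn y (le_of_lt hy)
    rw [← mul_add]
    gcongr
    unfold W2; nlinarith [norm_nonneg (S.v y), norm_nonneg (S.g y)]
  have hL := S.L_ge
  have hΓ := S.hΓ
  have hb := S.b2_nn
  have hL' : Real.log (S.K / √S.ε) + 1 = S.L := rfl
  rw [hL'] at hφ hψ
  rw [e1, e2]
  have f1 := mul_le_mul_of_nonneg_left e3 (a := 16 * S.Γ * S.L ^ 2) (by positivity)
  have f2 : 1 * (S.b2 + √S.ε * S.w ^ 2) ≤ S.Γ * S.L ^ 2 * (S.b2 + √S.ε * S.w ^ 2) := by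
    gcongr
    have : 1 ≤ S.L ^ 2 := one_le_pow₀ hL
    nlinarith
  linarith

lemma intX : IntegrableOn S.X (Ioi 0) ∧
    ∫ y in Ioi (0:ℝ), S.X y ≤ S.rω * √(17 * S.Γ * S.L ^ 2 * (S.b2 + √S.ε * S.w ^ 2)) := by
  obtain ⟨h1, h2⟩ := S.intY
  obtain ⟨h3, h4⟩ := cs_int (S.iωs S.iR) h1 (fun y hy => by
    have := S.ω_nn y hy.le; have := S.R_nn y; positivity) (fun y hy => S.Y2_nn hy)
  refine ⟨h3, h4.trans ?_⟩
  unfold rω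
  gcongr

lemma intJ : IntegrableOn S.J (Ioi 0) ∧
    ∫ y in Ioi (0:ℝ), S.J y ≤ S.rω * √(17 * S.Γ * S.L ^ 2 * (S.b2 + √S.ε * S.w ^ 2))
      + 3 * (1 + S.M) * S.ε * (S.a * S.w) + 5 * √S.ε * (S.M * (1 + S.M)) * S.w ^ 2 := by
  obtain ⟨h1, h2⟩ := S.intX
  have I2 := S.idq.const_mul ((1 + S.M) * S.ε)
  have I3 := S.iq2.const_mul (√S.ε * (S.M * (1 + S.M)))
  have hM := S.hM
  have hε := S.hε0
  refine ⟨(h1.add I2).add I3, ?_⟩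
  have e : ∫ y in Ioi (0:ℝ), S.J y = (∫ y in Ioi (0:ℝ), S.X y) + (1 + S.M) * S.ε * (∫ y in Ioi (0:ℝ), S.d y * S.q y)
      + √S.ε * (S.M * (1 + S.M)) * ∫ y in Ioi (0:ℝ), S.q2 y := by
    have I12 : Integrable (fun y => S.X y + (1 + S.M) * S.ε * (S.d y * S.q y)) (volume.restrict (Ioi 0)) :=
      h1.add I2
    rw [← integral_const_mul, ← integral_const_mul, ← integral_add h1 I2, ← integral_add I12 I3]
    rfl
  rw [e]
  have J2 := mul_le_mul_of_nonneg_left S.int_dq (a := (1 + S.M) * S.ε) (by positivity)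
  have J3 := mul_le_mul_of_nonneg_left S.int_q2 (a := √S.ε * (S.M * (1 + S.M))) (by positivity)
  linarith

lemma X0_le : ∃ B : ℝ, 0 ≤ B ∧ ∀ y, 0 < y → S.X0 y ≤ B * (‖S.u y‖ + ‖S.v y‖ + ‖S.h y‖ + ‖S.g y‖) := by
  obtain ⟨B, hB⟩ := S.ω_bdd
  have hB0 : 0 ≤ B := (S.ω_nn 0 le_rfl).trans (hB 0 le_rfl)
  have hN := S.N_pos
  refine ⟨B + |S.nt|⁻¹, by positivity, fun y hy => ?_⟩
  have h1 := norm_nonneg (S.u y)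
  have h2 := norm_nonneg (S.v y)
  have h3 := norm_nonneg (S.h y)
  have h4 := norm_nonneg (S.g y)
  have hW : √(S.W2 y) ≤ ‖S.u y‖ + ‖S.v y‖ + ‖S.h y‖ + ‖S.g y‖ := by
    refine Real.sqrt_le_iff.2 ⟨by positivity, ?_⟩
    unfold W2
    have : 0 ≤ ‖S.u y‖ * ‖S.v y‖ + ‖S.u y‖ * ‖S.h y‖ + ‖S.u y‖ * ‖S.g y‖ + ‖S.v y‖ * ‖S.h y‖
      + ‖S.v y‖ * ‖S.g y‖ + ‖S.h y‖ * ‖S.g y‖ := by positivity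
    nlinarith
  have hφ : ‖S.φ y‖ = |S.nt|⁻¹ * ‖S.v y‖ := by rw [S.nv, inv_mul_cancel_left₀ hN.ne']
  have hψ : ‖S.ψ y‖ = |S.nt|⁻¹ * ‖S.g y‖ := by rw [S.ng, inv_mul_cancel_left₀ hN.ne']
  have hω := hB y hy.le
  have hω0 := S.ω_nn y hy.le
  have hc := S.χ_le y hy.le
  have hc0 := S.χ_nn y hy.le
  unfold X0
  rw [hφ, hψ, add_mul]
  have k1 : S.χ y * (|S.nt|⁻¹ * ‖S.v y‖ + |S.nt|⁻¹ * ‖S.g y‖) ≤ 1 * (|S.nt|⁻¹ * ‖S.v y‖ + |S.nt|⁻¹ * ‖S.g y‖) := by gcongr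
  have k2 : |S.nt|⁻¹ * ‖S.v y‖ + |S.nt|⁻¹ * ‖S.g y‖ ≤ |S.nt|⁻¹ * (‖S.u y‖ + ‖S.v y‖ + ‖S.h y‖ + ‖S.g y‖) := by
    rw [← mul_add]; gcongr; linarith
  have k3 : S.ω y * √(S.W2 y) ≤ B * (‖S.u y‖ + ‖S.v y‖ + ‖S.h y‖ + ‖S.g y‖) := by gcongr
  linarith

lemma bound_of_sum {T : ℝ → ℂ} {C B : ℝ} (T0 : T 0 = 0) (hC : 0 ≤ C) (hB0 : 0 ≤ B)
    (h : ∀ y, 0 < y → ‖T y‖ ≤ C * S.X0 y)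
    (hB : ∀ y, 0 < y → S.X0 y ≤ B * (‖S.u y‖ + ‖S.v y‖ + ‖S.h y‖ + ‖S.g y‖)) :
    ∀ y, 0 ≤ y → ‖T y‖ ≤ (C * B) * (‖S.u y‖ + ‖S.v y‖ + ‖S.h y‖ + ‖S.g y‖) := by
  intro y hy
  rcases hy.eq_or_lt with rfl | hy
  · rw [T0, norm_zero]; positivity
  · calc ‖T y‖ ≤ C * S.X0 y := h y hy
      _ ≤ C * (B * (‖S.u y‖ + ‖S.v y‖ + ‖S.h y‖ + ‖S.g y‖)) := by gcongr; exact hB y hy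
      _ = _ := by ring

lemma tχ {f g : ℝ → ℂ} {k : ℂ} (hf : Tendsto f atTop (nhds 0)) (hg : Tendsto g atTop (nhds 0)) :
    Tendsto (fun y => (k * (S.χ y * (f y * conj (g y)))).re) atTop (nhds 0) := by
  have h1 := ((hf.norm.mul hg.norm)).const_mul ‖k‖
  simp only [norm_zero, mul_zero] at h1
  refine squeeze_zero_norm' ?_ h1
  filter_upwards [eventually_ge_atTop 0] with y hy
  have c0 := S.χ_nn y hy
  have c1 := S.χ_le y hy
  rw [Real.norm_eq_abs]
  refine (Complex.abs_re_le_norm _).trans ?_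
  rw [norm_mul, norm_rmul, abs_of_nonneg c0, norm_mul, RCLike.norm_conj]
  refine mul_le_mul_of_nonneg_left ?_ (norm_nonneg _)
  calc S.χ y * (‖f y‖ * ‖g y‖) ≤ 1 * (‖f y‖ * ‖g y‖) := by gcongr
    _ = _ := one_mul _

lemma cχt {f g : ℝ → ℂ} {k : ℂ} (hf : Continuous f) (hg : Continuous g) :
    ContinuousOn (fun y => (k * (S.χ y * (f y * conj (g y)))).re) (Ici 0) :=
  Complex.continuous_re.comp_continuousOn (continuousOn_const.mul (S.cχc.mul
    (hf.mul (Complex.continuous_conj.comp hg)).continuousOn))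

lemma estP (hF : S.FB) : S.ε * (∫ y in Ioi (0:ℝ), S.ω y * S.d2 y) ≤ 100 * S.Γ ^ 6 * ∫ y in Ioi (0:ℝ), S.J y := by
  have hΓ := S.hΓ
  have h0 : 0 < S.Γ := by linarith
  have cu := S.cu.continuous.continuousOn (s := Ici 0)
  have cv := S.cv.continuous.continuousOn (s := Ici 0)
  have ch := S.ch.continuous.continuousOn (s := Ici 0)
  have cg := S.cg.continuous.continuousOn (s := Ici 0)
  have cφ := S.cφ.continuous.continuousOn (s := Ici 0)
  have cψ := S.cψ.continuous.continuousOn (s := Ici 0)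
  obtain ⟨B, hB0, hB⟩ := S.X0_le
  have hC : 0 ≤ 4 * S.Γ ^ 2 := by positivity
  have z1 : S.P1 0 = 0 := by unfold P1; rw [S.ω_zero, S.φ0]; simp
  have z2 : S.P2 0 = 0 := by unfold P2; rw [S.ω_zero]; simp
  have z3 : S.P3 0 = 0 := by unfold P3; rw [S.ω_zero, S.φ0, S.ψ0]; simp
  have z4 : S.P4 0 = 0 := by unfold P4; rw [S.g0]; simp
  have n1 := fun y => norm_nonneg (S.P1 y)
  have n2 := fun y => norm_nonneg (S.P2 y)
  have n3 := fun y => norm_nonneg (S.P3 y)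
  have n4 := fun y => norm_nonneg (S.P4 y)
  have IJ := S.intJ.1
  have key := S.test (T1 := S.P1) (T2 := S.P2) (T3 := S.P3) (T4 := S.P4)
    (c := S.cP) (c' := S.cP')
    ((S.cωc.mul cu).add (S.cω1c.mul cφ)) (S.cωc.mul cv)
    ((((S.cGc.mul S.cωc).mul ch).sub (S.cχc.mul cψ)).add ((S.cbc.mul S.cω1c).mul cφ))
    (((S.cGc.mul S.cωc).mul cg).sub ((S.cχ1c.mul cg).div_const _))
    (fun y hy => S.dP1 hy) (fun y hy => S.dP2 hy) (fun y hy => S.dP3 hy) (fun y hy => S.dP4 hy)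
    z1 z2 z4
    (S.bound_of_sum z1 hC hB0 (fun y hy => by linarith [S.sumP hy, n1 y, n2 y, n3 y, n4 y]) hB)
    (S.bound_of_sum z2 hC hB0 (fun y hy => by linarith [S.sumP hy, n1 y, n2 y, n3 y, n4 y]) hB)
    (S.bound_of_sum z3 hC hB0 (fun y hy => by linarith [S.sumP hy, n1 y, n2 y, n3 y, n4 y]) hB)
    (S.bound_of_sum z4 hC hB0 (fun y hy => by linarith [S.sumP hy, n1 y, n2 y, n3 y, n4 y]) hB)
    (S.cχt S.cφ.continuous S.cψ.continuous) (fun y hy => S.dcP hy)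
    (by unfold cP; rw [S.φ0]; simp) (S.tχ S.tφ S.tψ)
    ((((IJ.const_mul (100 * S.Γ ^ 4)).add (IJ.const_mul 0)).add (IJ.const_mul 0)).sub
      ((S.iω S.id2).const_mul (S.ε / S.Γ ^ 2)))
    (fun y hy => S.pointP hF hy)
  have key := key.trans_eq (int4 IJ IJ IJ (S.iω S.id2) _ _ _ _)
  have L2 := mul_nonneg (pow_nonneg h0.le 2) key
  have e : S.Γ ^ 2 * (S.ε / S.Γ ^ 2 * (∫ y in Ioi (0:ℝ), S.ω y * S.d2 y)) = S.ε * (∫ y in Ioi (0:ℝ), S.ω y * S.d2 y) := by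
    field_simp
  linarith

lemma estS (hF : S.FB) : |S.nt| * S.b2 ≤ 2000 * S.Γ ^ 11 * ∫ y in Ioi (0:ℝ), S.J y := by
  have hΓ := S.hΓ
  have h0 : 0 < S.Γ := by linarith
  have cu := S.cu.continuous.continuousOn (s := Ici 0)
  have cv := S.cv.continuous.continuousOn (s := Ici 0)
  have ch := S.ch.continuous.continuousOn (s := Ici 0)
  have cg := S.cg.continuous.continuousOn (s := Ici 0)
  have cψ := S.cψ.continuous.continuousOn (s := Ici 0)
  have cL : ContinuousOn (fun y => ((S.Γ ^ 3 * S.ω y : ℝ) : ℂ)) (Ici 0) :=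
    Complex.continuous_ofReal.comp_continuousOn (continuousOn_const.mul S.cω)
  obtain ⟨B, hB0, hB⟩ := S.X0_le
  have hC : 0 ≤ 4 * S.Γ ^ 3 := by positivity
  have z1 : S.S1 0 = 0 := by unfold S1; rw [S.ω_zero, S.ψ0]; simp
  have z2 : S.S2 0 = 0 := by unfold S2; rw [S.ω_zero]; simp
  have z3 : S.S3 0 = 0 := by unfold S3; rw [S.ω_zero, S.ψ0]; simp
  have z4 : S.S4 0 = 0 := by unfold S4; rw [S.ω_zero]; simp
  have n1 := fun y => norm_nonneg (S.S1 y)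
  have n2 := fun y => norm_nonneg (S.S2 y)
  have n3 := fun y => norm_nonneg (S.S3 y)
  have n4 := fun y => norm_nonneg (S.S4 y)
  have IJ := S.intJ.1
  have Id := S.iω S.id2
  have IW := S.iω S.iW2
  have key := S.test (T1 := S.S1) (T2 := S.S2) (T3 := S.S3) (T4 := S.S4)
    (c := S.cS) (c' := S.cS')
    (continuousOn_const.mul ((S.cωc.mul ch).add (S.cω1c.mul cψ))) (continuousOn_const.mul (S.cωc.mul cg))
    (continuousOn_const.mul ((cL.mul cu).add ((S.cbc.mul S.cω1c).mul cψ)))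
    (continuousOn_const.mul (cL.mul cv))
    (fun y hy => S.dS1 hy) (fun y hy => S.dS2 hy) (fun y hy => S.dS3 hy) (fun y hy => S.dS4 hy)
    z1 z2 z4
    (S.bound_of_sum z1 hC hB0 (fun y hy => by linarith [S.sumS hy, n1 y, n2 y, n3 y, n4 y]) hB)
    (S.bound_of_sum z2 hC hB0 (fun y hy => by linarith [S.sumS hy, n1 y, n2 y, n3 y, n4 y]) hB)
    (S.bound_of_sum z3 hC hB0 (fun y hy => by linarith [S.sumS hy, n1 y, n2 y, n3 y, n4 y]) hB)
    (S.bound_of_sum z4 hC hB0 (fun y hy => by linarith [S.sumS hy, n1 y, n2 y, n3 y, n4 y]) hB)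
    (S.cχt S.cψ.continuous S.cψ.continuous) (fun y hy => S.dcS hy)
    (by unfold cS; rw [S.ψ0]; simp) (S.tχ S.tψ S.tψ)
    ((((IJ.const_mul (100 * S.Γ ^ 5)).add (Id.const_mul (8 * S.Γ ^ 4 * S.ε))).add (IJ.const_mul 0)).sub
      (IW.const_mul (|S.nt| / (2 * S.Γ))))
    (fun y hy => S.pointS hF hy)
  have key := key.trans_eq (int4 IJ Id IJ IW _ _ _ _)
  have hJ : 0 ≤ ∫ y in Ioi (0:ℝ), S.J y := setIntegral_nonneg measurableSet_Ioi fun y _ => S.J_nn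
  have hb : (∫ y in Ioi (0:ℝ), S.ω y * S.W2 y) = S.b2 := rfl
  rw [hb] at key
  have h1 := mul_le_mul_of_nonneg_left (S.estP hF) (a := 8 * S.Γ ^ 4) (by positivity)
  have h2 : |S.nt| / (2 * S.Γ) * S.b2 ≤ (100 * S.Γ ^ 5 + 800 * S.Γ ^ 10) * ∫ y in Ioi (0:ℝ), S.J y := by linarith
  have h3 := mul_le_mul_of_nonneg_left h2 (a := 2 * S.Γ) (by positivity)
  have e : 2 * S.Γ * (|S.nt| / (2 * S.Γ) * S.b2) = |S.nt| * S.b2 := by field_simp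
  rw [e] at h3
  refine h3.trans ?_
  rw [← mul_assoc (2 * S.Γ)]
  refine mul_le_mul_of_nonneg_right ?_ hJ
  have : S.Γ ^ 6 ≤ S.Γ ^ 11 := pow_le_pow_right₀ hΓ (by norm_num)
  have : 0 ≤ S.Γ ^ 11 := by positivity
  calc 2 * S.Γ * (100 * S.Γ ^ 5 + 800 * S.Γ ^ 10) = 200 * S.Γ ^ 6 + 1600 * S.Γ ^ 11 := by ring
    _ ≤ _ := by linarith

end Sys

namespace Sys
variable (S : Sys)

lemma interp1 {f : ℝ → ℂ} (hf : ContDiff ℝ 2 f)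
    (hi : IntegrableOn (fun y => ‖f y‖ ^ 2) (Ioi 0))
    (hi' : IntegrableOn (fun y => ‖deriv f y‖ ^ 2) (Ioi 0))
    (hT : Tendsto (fun y => ‖f y‖) atTop (nhds 0))
    (hw : ∀ y, ‖f y‖ ^ 2 ≤ S.W2 y) (ha : ∀ y, ‖deriv f y‖ ^ 2 ≤ S.d2 y)
    {t : ℝ} (ht : 0 < t) (htK : t ≤ S.K) :
    ∫ y in Ioi (0:ℝ), ‖f y‖ ^ 2 ≤ 2 * t * (S.w * S.a) + 2 * S.Γ / t * S.b2 := by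
  have hΓ := S.hΓ
  refine (interp (hf.of_le (by norm_num)) hi hi' (tendsto_zero_iff_norm_tendsto_zero.2 hT) ht htK
    S.ω_low (S.iω hi)).trans ?_
  have h1 : √(∫ y in Ioi (0:ℝ), ‖f y‖ ^ 2) ≤ S.w :=
    Real.sqrt_le_sqrt (setIntegral_mono_on hi S.iW2 measurableSet_Ioi fun y _ => hw y)
  have h2 : √(∫ y in Ioi (0:ℝ), ‖deriv f y‖ ^ 2) ≤ S.a :=
    Real.sqrt_le_sqrt (setIntegral_mono_on hi' S.id2 measurableSet_Ioi fun y _ => ha y)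
  have h3 : ∫ y in Ioi (0:ℝ), S.ω y * ‖f y‖ ^ 2 ≤ S.b2 :=
    setIntegral_mono_on (S.iω hi) (S.iω S.iW2) measurableSet_Ioi fun y hy =>
      mul_le_mul_of_nonneg_left (hw y) (S.ω_nn y (le_of_lt hy))
  have := S.w_nn
  have h0 : 0 < S.Γ := by linarith
  gcongr

lemma estI {t : ℝ} (ht : 0 < t) (htK : t ≤ S.K) :
    S.w ^ 2 ≤ 8 * S.Γ * (t * (S.a * S.w) + S.b2 / t) := by
  have hΓ := S.hΓ
  have e : S.w ^ 2 = (∫ y in Ioi (0:ℝ), ‖S.u y‖ ^ 2) + (∫ y in Ioi (0:ℝ), ‖S.v y‖ ^ 2)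
     + (∫ y in Ioi (0:ℝ), ‖S.h y‖ ^ 2) + ∫ y in Ioi (0:ℝ), ‖S.g y‖ ^ 2 := by
    have I1 : Integrable (fun y => ‖S.u y‖ ^ 2 + ‖S.v y‖ ^ 2) (volume.restrict (Ioi 0)) := S.iu.add S.iv
    have I2 : Integrable (fun y => ‖S.u y‖ ^ 2 + ‖S.v y‖ ^ 2 + ‖S.h y‖ ^ 2) (volume.restrict (Ioi 0)) := I1.add S.ih
    rw [S.w_sq, ← integral_add S.iu S.iv, ← integral_add I1 S.ih, ← integral_add I2 S.ig]
    rfl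
  have n1 := fun y => sq_nonneg ‖S.u y‖
  have n2 := fun y => sq_nonneg ‖S.v y‖
  have n3 := fun y => sq_nonneg ‖S.h y‖
  have n4 := fun y => sq_nonneg ‖S.g y‖
  have m1 := fun y => sq_nonneg ‖deriv S.u y‖
  have m2 := fun y => sq_nonneg ‖deriv S.v y‖
  have m3 := fun y => sq_nonneg ‖deriv S.h y‖
  have m4 := fun y => sq_nonneg ‖deriv S.g y‖
  have m5 : ∀ y, 0 ≤ S.nt ^ 2 * S.W2 y := fun y => mul_nonneg (sq_nonneg _) (S.W2_nn y)
  have j1 := S.interp1 S.cu S.iu S.iu' S.tu (fun y => by unfold W2; linarith [n1 y, n2 y, n3 y, n4 y])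
    (fun y => by unfold d2 D2; linarith [m1 y, m2 y, m3 y, m4 y, m5 y]) ht htK
  have j2 := S.interp1 S.cv S.iv S.iv' S.tv (fun y => by unfold W2; linarith [n1 y, n2 y, n3 y, n4 y])
    (fun y => by unfold d2 D2; linarith [m1 y, m2 y, m3 y, m4 y, m5 y]) ht htK
  have j3 := S.interp1 S.ch S.ih S.ih' S.th (fun y => by unfold W2; linarith [n1 y, n2 y, n3 y, n4 y])
    (fun y => by unfold d2 D2; linarith [m1 y, m2 y, m3 y, m4 y, m5 y]) ht htK
  have j4 := S.interp1 S.cg S.ig S.ig' S.tg (fun y => by unfold W2; linarith [n1 y, n2 y, n3 y, n4 y])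
    (fun y => by unfold d2 D2; linarith [m1 y, m2 y, m3 y, m4 y, m5 y]) ht htK
  have k : S.w ^ 2 ≤ 8 * t * (S.w * S.a) + 8 * S.Γ / t * S.b2 := by
    have : 8 * S.Γ / t * S.b2 = 4 * (2 * S.Γ / t * S.b2) := by ring
    rw [this, e]; linarith
  have k2 : 8 * t * (S.w * S.a) ≤ S.Γ * (8 * t * (S.w * S.a)) :=
    le_mul_of_one_le_left (by have := S.w_nn; have := S.a_nn; positivity) hΓ
  calc S.w ^ 2 ≤ _ := k
    _ ≤ S.Γ * (8 * t * (S.w * S.a)) + 8 * S.Γ / t * S.b2 := by linarith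
    _ = _ := by ring
end Sys


lemma quad_bound {X P E F : ℝ} (hP : 0 ≤ P) (hE : 0 ≤ E) (hF : 0 ≤ F)
    (h : X ^ 2 ≤ 2 * E * P * X + 2 * F * P ^ 2) : X ≤ (2 * E + 2 * F + 1) * P := by
  by_contra hc
  push Not at hc
  have h0 : 0 < X := lt_of_le_of_lt (by positivity) hc
  have h1 : P ≤ X := by
    have : 1 * P ≤ (2 * E + 2 * F + 1) * P := by gcongr; linarith
    linarith
  have h2 : X * ((2 * E + 2 * F + 1) * P) < X * X := by gcongr
  have h3 : 2 * F * P * P ≤ 2 * F * P * X := by gcongr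
  have h4 : 0 ≤ X * P := by positivity
  nlinarith

lemma alg_smallness {θ : ℝ} (hθ : 0 < θ) : ∃ δ : ℝ, 0 < δ ∧ ∀ ϱ M : ℝ, 0 < ϱ → 0 ≤ M →
    ϱ * (M + M ^ 4) ≤ δ → ∃ z : ℝ, 1 ≤ z ∧ z ^ 3 ≤ 2 + ϱ ∧ ϱ ≤ z ^ 6 ∧
    ∀ x, 0 < x → 1 ≤ x ^ 3 * ϱ → z ^ 2 * (M * (1 + M)) ≤ θ * x ^ 2 ∧
      M * (1 + M) ^ 3 ≤ θ * (z ^ 2 * x ^ 4) := by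
  refine ⟨min 1 (min (θ / 8) (θ ^ 2 / 4)), by positivity, fun ϱ M hϱ hM hδ => ?_⟩
  have d1 := hδ.trans (min_le_left _ _)
  have d2 := hδ.trans ((min_le_right _ _).trans (min_le_left _ _))
  have d3 := hδ.trans ((min_le_right _ _).trans (min_le_right _ _))
  have q : 0 ≤ M + M ^ 4 := by positivity
  have M2 : M ^ 2 ≤ M + M ^ 4 := by
    rcases le_total M 1 with h | h
    · have : M ^ 2 ≤ M := by nlinarith
      have : 0 ≤ M ^ 4 := by positivity
      linarith
    · have : M ^ 2 ≤ M ^ 4 := pow_le_pow_right₀ h (by norm_num)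
      linarith
  have M3 : M ^ 3 ≤ M + M ^ 4 := by
    rcases le_total M 1 with h | h
    · have : M ^ 3 ≤ M := by have : M ^ 2 ≤ 1 := pow_le_one₀ hM h
                             nlinarith
      have : 0 ≤ M ^ 4 := by positivity
      linarith
    · have : M ^ 3 ≤ M ^ 4 := pow_le_pow_right₀ h (by norm_num)
      linarith
  have m3 : M * (1 + M) ^ 3 ≤ 8 * (M + M ^ 4) := by nlinarith
  have m2 : (M * (1 + M)) ^ 2 ≤ 4 * (M + M ^ 4) := by nlinarith
  -- M + M^4 ≤ δ' x^3
  have tr : ∀ x c, 0 < x → 1 ≤ x ^ 3 * ϱ → ϱ * (M + M ^ 4) ≤ c → M + M ^ 4 ≤ c * x ^ 3 := by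
    intro x c hx h1 h2
    have : 1 * (M + M ^ 4) ≤ x ^ 3 * ϱ * (M + M ^ 4) := by gcongr
    have : x ^ 3 * (ϱ * (M + M ^ 4)) ≤ x ^ 3 * c := by gcongr
    linarith
  rcases le_total ϱ 1 with h | h
  · refine ⟨1, le_rfl, by linarith, by linarith, fun x hx hx1 => ?_⟩
    have x1 : 1 ≤ x := by
      by_contra hc
      push Not at hc
      have : x ^ 3 < 1 := pow_lt_one₀ hx.le hc (by norm_num)
      nlinarith
    have x34 : x ^ 3 ≤ x ^ 4 := pow_le_pow_right₀ x1 (by norm_num)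
    constructor
    · rw [one_pow, one_mul]
      refine (pow_le_pow_iff_left₀ (by positivity) (by positivity) two_ne_zero).1 ?_
      have := tr x _ hx hx1 d3
      calc (M * (1 + M)) ^ 2 ≤ 4 * (M + M ^ 4) := m2
        _ ≤ 4 * (θ ^ 2 / 4 * x ^ 3) := by gcongr
        _ = θ ^ 2 * x ^ 3 := by ring
        _ ≤ θ ^ 2 * x ^ 4 := by gcongr
        _ = _ := by ring
    · have := tr x _ hx hx1 d2
      calc M * (1 + M) ^ 3 ≤ 8 * (M + M ^ 4) := m3
        _ ≤ 8 * (θ / 8 * x ^ 3) := by gcongr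
        _ = θ * x ^ 3 := by ring
        _ ≤ θ * x ^ 4 := by gcongr
        _ = _ := by ring
  · set z := ϱ ^ ((1:ℝ) / 6) with hz
    have z1 : 1 ≤ z := Real.one_le_rpow h (by norm_num)
    have z6 : z ^ 6 = ϱ := by rw [hz, ← Real.rpow_natCast, ← Real.rpow_mul hϱ.le]; norm_num
    have z0 : 0 < z := by linarith
    refine ⟨z, z1, ?_, z6.ge, fun x hx hx1 => ?_⟩
    · have : z ^ 3 ≤ z ^ 6 := pow_le_pow_right₀ z1 (by norm_num)
      linarith
    have zx : 1 ≤ z ^ 2 * x := by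
      by_contra hc
      push Not at hc
      have : (z ^ 2 * x) ^ 3 < 1 := pow_lt_one₀ (by positivity) hc (by norm_num)
      have e : (z ^ 2 * x) ^ 3 = x ^ 3 * z ^ 6 := by ring
      rw [e, z6] at this; linarith
    constructor
    · have M1 : M ≤ 1 := by
        have : 0 ≤ ϱ * M ^ 4 := by positivity
        have : 1 * M ≤ ϱ * M := by gcongr
        linarith
      have m1 : M * (1 + M) ≤ 2 * (M + M ^ 4) := by
        have : 0 ≤ M ^ 4 := by positivity
        nlinarith
      have k1 : (M + M ^ 4) ≤ θ / 8 / z ^ 6 := by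
        rw [le_div_iff₀ (by positivity), z6]; linarith
      have k2 : z⁻¹ ^ 4 ≤ x ^ 2 := by
        rw [inv_pow, inv_le_iff_one_le_mul₀ (by positivity)]
        calc 1 ≤ (z ^ 2 * x) ^ 2 := one_le_pow₀ zx
          _ = _ := by ring
      calc z ^ 2 * (M * (1 + M)) ≤ z ^ 2 * (2 * (θ / 8 / z ^ 6)) 
            := mul_le_mul_of_nonneg_left (by linarith) (by positivity)
        _ = θ / 4 * z⁻¹ ^ 4 := by field_simp; norm_num
        _ ≤ θ / 4 * x ^ 2 := by gcongr
        _ ≤ θ * x ^ 2 := by gcongr; linarith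
    · have := tr x _ hx hx1 d2
      calc M * (1 + M) ^ 3 ≤ 8 * (M + M ^ 4) := m3
        _ ≤ 8 * (θ / 8 * x ^ 3) := by gcongr
        _ = θ * (1 * x ^ 3) := by ring
        _ ≤ θ * (z ^ 2 * x * x ^ 3) := by gcongr
        _ = _ := by ring

lemma alg_core {C M m z i w α β P : ℝ} (hC : 1 ≤ C) (hM : 0 ≤ M) (hm : m = M * (1 + M))
    (hz : 1 ≤ z) (hi : 0 < i) (hiz : i ≤ z ^ 2) (hw : 0 ≤ w) (hα : 0 ≤ α) (hβ : 0 ≤ β) (hP : 0 ≤ P)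
    (s1 : 300 * C ^ 6 * (z ^ 2 * m * i ^ 2) ≤ 1)
    (s2 : 300 * C ^ 6 * (m * (1 + M) ^ 2 * i ^ 4) ≤ z ^ 2)
    (hA : α ^ 2 ≤ C * (P * w + M * (α * w) + m * w ^ 2))
    (hB : β ^ 2 ≤ C * i ^ 3 * (P * (β + w) + (1 + M) * (α * w) + m * w ^ 2))
    (hI : w ^ 2 ≤ C * (z * i * (α * w) + β ^ 2 / (z * i))) :
    α ^ 2 ≤ 3 * C ^ 2 * (P * w + m * w ^ 2) ∧
    β ^ 2 ≤ 2 * (C * i ^ 3 * (P * w + (1 + M) * (α * w) + m * w ^ 2)) + C ^ 2 * i ^ 6 * P ^ 2 ∧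
    w ^ 2 ≤ 2 * (29 * C ^ 6 * (1 + M) ^ 2 * z ^ 2) * (i ^ 2 * P) * w
      + 2 * (C ^ 3 * z) * (i ^ 2 * P) ^ 2 := by
  have z0 : 0 < z := by linarith
  have C0 : 0 < C := by linarith
  have m0 : 0 ≤ m := by rw [hm]; positivity
  have C12 : C ≤ C ^ 2 := by nlinarith
  have C46 : C ^ 4 ≤ C ^ 6 := pow_le_pow_right₀ hC (by norm_num)
  have C26 : C ^ 2 ≤ C ^ 6 := pow_le_pow_right₀ hC (by norm_num)
  have h1 : α ^ 2 ≤ 3 * C ^ 2 * (P * w + m * w ^ 2) := by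
    have k1 : 2 * (C * (M * (α * w))) ≤ α ^ 2 + C ^ 2 * (M ^ 2 * w ^ 2) := by
      have := sq_nonneg (α - C * M * w); nlinarith
    have k2 : C ^ 2 * (M ^ 2 * w ^ 2) ≤ C ^ 2 * (m * w ^ 2) := by
      gcongr; rw [hm]; nlinarith
    have k3 : C * (P * w) ≤ C ^ 2 * (P * w) := by gcongr
    have k4 : C * (m * w ^ 2) ≤ C ^ 2 * (m * w ^ 2) := by gcongr
    have k5 : 0 ≤ C ^ 2 * (P * w) := by positivity
    linarith
  have h2 : β ^ 2 ≤ 2 * (C * i ^ 3 * (P * w + (1 + M) * (α * w) + m * w ^ 2)) + C ^ 2 * i ^ 6 * P ^ 2 := by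
    have k1 : 2 * (C * i ^ 3 * (P * β)) ≤ β ^ 2 + C ^ 2 * i ^ 6 * P ^ 2 := by
      have := sq_nonneg (β - C * i ^ 3 * P); nlinarith
    linarith
  refine ⟨h1, h2, ?_⟩
  have h3 : C * (z * i * (α * w)) ≤ w ^ 2 / 4 + C ^ 2 * z ^ 2 * i ^ 2 * α ^ 2 := by
    have := sq_nonneg (w / 2 - C * z * i * α); nlinarith
  have h3' : C ^ 2 * z ^ 2 * i ^ 2 * α ^ 2 ≤ C ^ 2 * z ^ 2 * i ^ 2 * (3 * C ^ 2 * (P * w + m * w ^ 2)) := by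
    gcongr
  have h4 : C * (β ^ 2 / (z * i)) ≤ C * ((2 * (C * i ^ 3 * (P * w + (1 + M) * (α * w) + m * w ^ 2)) +
      C ^ 2 * i ^ 6 * P ^ 2) / (z * i)) := by gcongr
  have e4 : C * ((2 * (C * i ^ 3 * (P * w + (1 + M) * (α * w) + m * w ^ 2)) +
      C ^ 2 * i ^ 6 * P ^ 2) / (z * i)) = 2 * C ^ 2 * (i ^ 2 / z) * (P * w + (1 + M) * (α * w) + m * w ^ 2)
      + C ^ 3 * (i ^ 5 / z) * P ^ 2 := by field_simp
  rw [e4] at h4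
  have h5 : 2 * C ^ 2 * (i ^ 2 / z) * ((1 + M) * (α * w)) ≤ w ^ 2 / 8 +
      8 * C ^ 4 * (i ^ 2 / z) ^ 2 * (1 + M) ^ 2 * α ^ 2 := by
    have := sq_nonneg (w - 8 * C ^ 2 * (i ^ 2 / z) * (1 + M) * α); linarith
  have h5' : 8 * C ^ 4 * (i ^ 2 / z) ^ 2 * (1 + M) ^ 2 * α ^ 2 ≤
      8 * C ^ 4 * (i ^ 2 / z) ^ 2 * (1 + M) ^ 2 * (3 * C ^ 2 * (P * w + m * w ^ 2)) := by gcongr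
  -- collect coefficients
  set e := i ^ 2 / z with he
  have e0 : 0 ≤ e := by positivity
  have ez : e ≤ z ^ 2 * i ^ 2 := by
    rw [he, div_le_iff₀ z0]
    have : 1 ≤ z ^ 2 * z := by rw [← pow_succ]; exact one_le_pow₀ hz
    have := mul_le_mul_of_nonneg_right this (sq_nonneg i)
    linarith
  have ee : e ^ 2 ≤ z ^ 2 * i ^ 2 := by
    rw [he, div_pow, div_le_iff₀ (by positivity)]
    have : i ^ 2 ≤ (z ^ 2) ^ 2 := by gcongr
    calc (i ^ 2) ^ 2 = i ^ 2 * i ^ 2 := by ring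
      _ ≤ i ^ 2 * (z ^ 2) ^ 2 := by gcongr
      _ = _ := by ring
  have ei : i ^ 5 / z ≤ z * i ^ 4 := by
    rw [div_le_iff₀ z0]
    calc i ^ 5 = i ^ 4 * i := by ring
      _ ≤ i ^ 4 * z ^ 2 := by gcongr
      _ = _ := by ring
  have Q : 3 * C ^ 4 * (z ^ 2 * i ^ 2) + 2 * C ^ 2 * e + 24 * C ^ 6 * e ^ 2 * (1 + M) ^ 2 ≤
      29 * C ^ 6 * (1 + M) ^ 2 * (z ^ 2 * i ^ 2) := by
    have o : 1 ≤ (1 + M) ^ 2 := one_le_pow₀ (by linarith)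
    have a1 : 3 * C ^ 4 * (z ^ 2 * i ^ 2) ≤ 3 * C ^ 6 * (z ^ 2 * i ^ 2) := by gcongr
    have a2 : 2 * C ^ 2 * e ≤ 2 * C ^ 6 * (z ^ 2 * i ^ 2) := by gcongr
    have a3 : 24 * C ^ 6 * e ^ 2 * (1 + M) ^ 2 ≤ 24 * C ^ 6 * (z ^ 2 * i ^ 2) * (1 + M) ^ 2 := by gcongr
    have a4 : 5 * C ^ 6 * (z ^ 2 * i ^ 2) * 1 ≤ 5 * C ^ 6 * (z ^ 2 * i ^ 2) * (1 + M) ^ 2 := by gcongr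
    linarith
  have Qm : 8 * ((3 * C ^ 4 * (z ^ 2 * i ^ 2) + 2 * C ^ 2 * e + 24 * C ^ 6 * e ^ 2 * (1 + M) ^ 2) * m) ≤ 1 := by
    have a1 : 3 * C ^ 4 * (z ^ 2 * i ^ 2) * m ≤ 3 * C ^ 6 * (z ^ 2 * i ^ 2) * m := by gcongr
    have a2 : 2 * C ^ 2 * e * m ≤ 2 * C ^ 6 * (z ^ 2 * i ^ 2) * m := by gcongr
    have a3 : 300 * (C ^ 6 * e ^ 2 * (1 + M) ^ 2 * m) ≤ 1 := by
      have : e ^ 2 = i ^ 4 / z ^ 2 := by rw [he, div_pow]; ring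
      rw [this]
      have : 300 * (C ^ 6 * (i ^ 4 / z ^ 2) * (1 + M) ^ 2 * m) = 300 * C ^ 6 * (m * (1 + M) ^ 2 * i ^ 4) / z ^ 2 := by
        ring
      rw [this, div_le_one (by positivity)]; exact s2
    have a4 : 300 * (C ^ 6 * (z ^ 2 * i ^ 2) * m) ≤ 1 := by linarith
    have a5 : 0 ≤ C ^ 6 * (z ^ 2 * i ^ 2) * m := by positivity
    linarith
  set T := 3 * C ^ 4 * (z ^ 2 * i ^ 2) + 2 * C ^ 2 * e + 24 * C ^ 6 * e ^ 2 * (1 + M) ^ 2 with hT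
  have tot : 5 / 8 * w ^ 2 ≤ T * (P * w) + T * m * w ^ 2 + C ^ 3 * (i ^ 5 / z) * P ^ 2 := by
    have x1 : w ^ 2 ≤ C * (z * i * (α * w)) + C * (β ^ 2 / (z * i)) := by linarith
    have : T * (P * w) + T * m * w ^ 2 = C ^ 2 * z ^ 2 * i ^ 2 * (3 * C ^ 2 * (P * w + m * w ^ 2)) +
       8 * C ^ 4 * e ^ 2 * (1 + M) ^ 2 * (3 * C ^ 2 * (P * w + m * w ^ 2)) +
       2 * C ^ 2 * e * (P * w) + 2 * C ^ 2 * e * (m * w ^ 2) := by rw [hT]; ring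
    rw [this]; linarith
  have t1 : T * m * w ^ 2 ≤ 1 / 8 * w ^ 2 := by gcongr; linarith
  have t2 : T * (P * w) ≤ 29 * C ^ 6 * (1 + M) ^ 2 * (z ^ 2 * i ^ 2) * (P * w) := by gcongr
  have t3 : C ^ 3 * (i ^ 5 / z) * P ^ 2 ≤ C ^ 3 * (z * i ^ 4) * P ^ 2 := by gcongr
  linarith


lemma alg_final {C : ℝ} (hC : 1 ≤ C) : ∃ δ : ℝ, 0 < δ ∧ ∀ ϱ M : ℝ, 0 < ϱ → 0 ≤ M →
    ϱ * (M + M ^ 4) ≤ δ → ∃ C6 : ℝ, 0 < C6 ∧ ∀ x w α β P : ℝ, 0 < x → 1 ≤ x ^ 3 * ϱ →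
    0 ≤ w → 0 ≤ α → 0 ≤ β → 0 ≤ P →
    α ^ 2 ≤ C * (P * w + M * (α * w) + M * (1 + M) * w ^ 2) →
    x ^ 3 * β ^ 2 ≤ C * (P * (β + w) + (1 + M) * (α * w) + M * (1 + M) * w ^ 2) →
    (∀ s, 0 < s → s ≤ 2 + ϱ → w ^ 2 ≤ C * (s * (α * w) + β ^ 2 / s)) →
    x * α ≤ C6 * P ∧ x ^ 2 * w ≤ C6 * P ∧ x ^ 5 * β ^ 2 ≤ (C6 * P) ^ 2 := by
  have C0 : 0 < C := by linarith
  obtain ⟨δ, hδ, H⟩ := alg_smallness (θ := 1 / (300 * C ^ 6)) (by positivity)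
  refine ⟨δ, hδ, fun ϱ M hϱ hM hs => ?_⟩
  obtain ⟨z, z1, z3, z6, Hx⟩ := H ϱ M hϱ hM hs
  have z0 : 0 < z := by linarith
  set m := M * (1 + M) with hm
  have m0 : 0 ≤ m := by positivity
  obtain ⟨E, hE⟩ : ∃ t, t = 29 * C ^ 6 * (1 + M) ^ 2 * z ^ 2 := ⟨_, rfl⟩
  obtain ⟨F, hF⟩ : ∃ t, t = C ^ 3 * z := ⟨_, rfl⟩
  have E0 : 0 ≤ E := by rw [hE]; positivity
  have F0 : 0 ≤ F := by rw [hF]; positivity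
  obtain ⟨c1, hc1⟩ : ∃ t, t = 2 * E + 2 * F + 1 := ⟨_, rfl⟩
  have c10 : 0 ≤ c1 := by rw [hc1]; positivity
  obtain ⟨c2, hc2⟩ : ∃ t, t = 3 * C ^ 2 * (c1 + m * c1 ^ 2 * z ^ 4) + 1 := ⟨_, rfl⟩
  have c20 : 1 ≤ c2 := by
    have : 0 ≤ 3 * C ^ 2 * (c1 + m * c1 ^ 2 * z ^ 4) := by positivity
    linarith
  have c20' : 0 ≤ c2 := by linarith
  obtain ⟨c3, hc3⟩ : ∃ t, t = 2 * (C * (c1 + (1 + M) * (c2 * c1 * z ^ 2) + m * c1 ^ 2 * z ^ 4)) + C ^ 2 * z ^ 2 := ⟨_, rfl⟩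
  have c30 : 0 ≤ c3 := by rw [hc3]; positivity
  refine ⟨c1 + c2 + c3, by positivity, fun x w α β P hx hx1 hw hα hβ hP hA hB hI => ?_⟩
  obtain ⟨q1, q2⟩ := Hx x hx hx1
  have zx : 1 ≤ z ^ 2 * x := by
    by_contra hc
    push Not at hc
    have h1 : (z ^ 2 * x) ^ 3 < 1 := pow_lt_one₀ (by positivity) hc (by norm_num)
    have e : (z ^ 2 * x) ^ 3 = x ^ 3 * z ^ 6 := by ring
    have : x ^ 3 * ϱ ≤ x ^ 3 * z ^ 6 := by gcongr
    rw [e] at h1; linarith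
  set i := x⁻¹ with hi
  have i0 : 0 < i := by positivity
  have xi : x * i = 1 := mul_inv_cancel₀ hx.ne'
  have iz : i ≤ z ^ 2 := by
    rw [hi, inv_le_iff_one_le_mul₀ hx]; exact zx
  have D : 0 < 300 * C ^ 6 := by positivity
  have s1 : 300 * C ^ 6 * (z ^ 2 * m * i ^ 2) ≤ 1 := by
    have := mul_le_mul_of_nonneg_left q1 (a := 300 * C ^ 6 * i ^ 2) (by positivity)
    have e1 : 300 * C ^ 6 * i ^ 2 * (1 / (300 * C ^ 6) * x ^ 2) = 1 := by
      rw [hi]; field_simp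
    rw [e1] at this; linarith
  have s2 : 300 * C ^ 6 * (m * (1 + M) ^ 2 * i ^ 4) ≤ z ^ 2 := by
    have := mul_le_mul_of_nonneg_left q2 (a := 300 * C ^ 6 * i ^ 4) (by positivity)
    have e1 : 300 * C ^ 6 * i ^ 4 * (1 / (300 * C ^ 6) * (z ^ 2 * x ^ 4)) = z ^ 2 := by
      rw [hi]; field_simp
    have e2 : m * (1 + M) ^ 2 = M * (1 + M) ^ 3 := by rw [hm]; ring
    rw [e1] at this; rw [e2]; linarith
  have hB' : β ^ 2 ≤ C * i ^ 3 * (P * (β + w) + (1 + M) * (α * w) + m * w ^ 2) := by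
    have := mul_le_mul_of_nonneg_left hB (a := i ^ 3) (by positivity)
    have e1 : i ^ 3 * (x ^ 3 * β ^ 2) = β ^ 2 := by rw [hi]; field_simp
    rw [e1] at this; linarith
  have hI' := hI (z * i) (by positivity) (by
    calc z * i ≤ z * z ^ 2 := by gcongr
      _ = z ^ 3 := by ring
      _ ≤ _ := z3)
  obtain ⟨r1, r2, r3⟩ := alg_core hC hM hm z1 i0 iz hw hα hβ hP s1 s2 hA hB' hI'
  have w1 : w ≤ c1 * (i ^ 2 * P) := by
    rw [hc1]; exact quad_bound (by positivity) E0 F0 (by rw [hE, hF]; exact r3)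
  have i2 : i ^ 2 ≤ z ^ 4 := by
    calc i ^ 2 ≤ (z ^ 2) ^ 2 := by gcongr
      _ = z ^ 4 := by ring
  have a1 : α ≤ c2 * (i * P) := by
    refine (pow_le_pow_iff_left₀ hα (by positivity) two_ne_zero).1 ?_
    calc α ^ 2 ≤ 3 * C ^ 2 * (P * w + m * w ^ 2) := r1
      _ ≤ 3 * C ^ 2 * (P * (c1 * (i ^ 2 * P)) + m * (c1 * (i ^ 2 * P)) ^ 2) := by gcongr
      _ = 3 * C ^ 2 * (c1 + m * c1 ^ 2 * i ^ 2) * (i * P) ^ 2 := by ring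
      _ ≤ 3 * C ^ 2 * (c1 + m * c1 ^ 2 * z ^ 4) * (i * P) ^ 2 := by gcongr
      _ ≤ c2 * (i * P) ^ 2 := by gcongr; linarith
      _ ≤ c2 ^ 2 * (i * P) ^ 2 :=
        mul_le_mul_of_nonneg_right (le_self_pow₀ c20 two_ne_zero) (by positivity)
      _ = _ := by ring
  have b1 : β ^ 2 ≤ c3 * (i ^ 5 * P ^ 2) := by
    calc β ^ 2 ≤ _ := r2
      _ ≤ 2 * (C * i ^ 3 * (P * (c1 * (i ^ 2 * P)) + (1 + M) * ((c2 * (i * P)) * (c1 * (i ^ 2 * P)))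
          + m * (c1 * (i ^ 2 * P)) ^ 2)) + C ^ 2 * i ^ 6 * P ^ 2 := by gcongr
      _ = (2 * (C * (c1 + (1 + M) * (c2 * c1 * i) + m * c1 ^ 2 * i ^ 2)) + C ^ 2 * i) * (i ^ 5 * P ^ 2) := by
          ring
      _ ≤ (2 * (C * (c1 + (1 + M) * (c2 * c1 * z ^ 2) + m * c1 ^ 2 * z ^ 4)) + C ^ 2 * z ^ 2) * (i ^ 5 * P ^ 2) := by
          gcongr
      _ = _ := by rw [hc3]
  refine ⟨?_, ?_, ?_⟩
  · calc x * α ≤ x * (c2 * (i * P)) := by gcongr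
      _ = c2 * P := by rw [hi]; field_simp
      _ ≤ _ := by gcongr; linarith
  · calc x ^ 2 * w ≤ x ^ 2 * (c1 * (i ^ 2 * P)) := by gcongr
      _ = c1 * P := by rw [hi]; field_simp
      _ ≤ _ := by gcongr; linarith
  · have k : c3 ≤ (c1 + c2 + c3) ^ 2 :=
      (show c3 ≤ c1 + c2 + c3 by linarith).trans (le_self_pow₀ (by linarith) two_ne_zero)
    calc x ^ 5 * β ^ 2 ≤ x ^ 5 * (c3 * (i ^ 5 * P ^ 2)) := by gcongr
      _ = c3 * P ^ 2 := by rw [hi]; field_simp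
      _ ≤ (c1 + c2 + c3) ^ 2 * P ^ 2 := by gcongr
      _ = _ := by ring


lemma chi_int {K y : ℝ} (hK : 2 ≤ K) (hy : 0 ≤ y) :
    ∫ s in (0:ℝ)..y, (K / (K + s)) ^ 2 = y * (K / (K + y)) := by
  have hd : ∀ s ∈ uIcc 0 y, HasDerivAt (fun s => s * (K / (K + s))) ((K / (K + s)) ^ 2) s := by
    intro s hs
    rw [uIcc_of_le hy] at hs
    have hs0 : 0 < K + s := by linarith [hs.1]
    have : HasDerivAt (fun s => s * (K / (K + s))) _ s := (hasDerivAt_id' s).mul ((hasDerivAt_const s K).div ((hasDerivAt_id' s).const_add K) hs0.ne')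
    refine this.congr_deriv ?_
    field_simp
    ring
  rw [intervalIntegral.integral_eq_sub_of_hasDerivAt hd]
  · simp
  · refine ContinuousOn.intervalIntegrable ?_
    rw [uIcc_of_le hy]
    refine ContinuousOn.pow (ContinuousOn.div continuousOn_const (continuousOn_const.add continuousOn_id) ?_) 2
    intro s hs
    have : K + s ≠ 0 := by linarith [hs.1]
    exact this

lemma dchi {K y : ℝ} (hK : 2 ≤ K) (hy : 0 ≤ y) :
    HasDerivAt (fun s => (K / (K + s)) ^ 2) (-(2 * K ^ 2 / (K + y) ^ 3)) y := by
  have hs0 : 0 < K + y := by linarith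
  have : HasDerivAt (fun s => (K / (K + s)) ^ 2) _ y := ((hasDerivAt_const y K).div ((hasDerivAt_id' y).const_add K) hs0.ne').pow 2
  refine this.congr_deriv ?_
  simp only [Pi.div_apply]
  norm_num
  field_simp

lemma dchi1 {K y : ℝ} (hK : 2 ≤ K) (hy : 0 ≤ y) :
    HasDerivAt (fun s => -(2 * K ^ 2 / (K + s) ^ 3)) (6 * K ^ 2 / (K + y) ^ 4) y := by
  have hs0 : 0 < K + y := by linarith
  have : HasDerivAt (fun s => -(2 * K ^ 2 / (K + s) ^ 3)) _ y := ((hasDerivAt_const y (2 * K ^ 2)).div (((hasDerivAt_id' y).const_add K).pow 3) (by simp only [Pi.pow_apply]; positivity)).neg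
  refine this.congr_deriv ?_
  simp only [Pi.pow_apply]
  field_simp
  norm_num
  ring

lemma weight {G G1 : ℝ → ℝ} {K l Gm : ℝ} (hK : 2 ≤ K) (hl : 0 < l) (cG : Continuous G)
    (dG : ∀ y, 0 < y → HasDerivAt G (G1 y) y) (Gl : ∀ y, 0 ≤ y → l ≤ G y) (Gu : ∀ y, 0 ≤ y → G y ≤ Gm) :
    ∃ ω ω1 ω2 : ℝ → ℝ, (∀ y, 0 < y → HasDerivAt ω (ω1 y) y) ∧ (∀ y, 0 < y → HasDerivAt ω1 (ω2 y) y) ∧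
      Continuous ω ∧ Continuous ω1 ∧ ω 0 = 0 ∧ (∀ y, 0 ≤ y → ω1 y = (K / (K + y)) ^ 2 / G y) ∧
      (∀ y, 0 < y → ω2 y = (-(2 * K ^ 2 / (K + y) ^ 3) * G y - (K / (K + y)) ^ 2 * G1 y) / G y ^ 2) ∧
      (∀ y, 0 ≤ y → ω y ≤ l⁻¹ * (y * (K / (K + y)))) ∧
      (∀ y, 0 ≤ y → y * (K / (K + y)) ≤ Gm * ω y) := by
  set c : ℝ → ℝ := fun y => (K / (K + max y 0)) ^ 2 / G (max y 0) with hc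
  have pos : ∀ y, 0 ≤ y → 0 < G y := fun y hy => hl.trans_le (Gl y hy)
  have cc : Continuous c := by
    have cm : Continuous fun y : ℝ => max y 0 := continuous_id.max continuous_const
    refine Continuous.div ((continuous_const.div (continuous_const.add cm) ?_).pow 2) (cG.comp cm) ?_
    · intro y; have h := le_max_right y 0; have : K + max y 0 ≠ 0 := by linarith
      exact this
    · intro y; exact (pos _ (le_max_right y 0)).ne'
  have cv : ∀ y, 0 ≤ y → c y = (K / (K + y)) ^ 2 / G y := fun y hy => by
    simp only [hc]; rw [max_eq_left hy]
  have dω : ∀ y, HasDerivAt (fun y => ∫ s in (0:ℝ)..y, c s) (c y) y := fun y =>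
    intervalIntegral.integral_hasDerivAt_right (cc.intervalIntegrable _ _)
      (cc.stronglyMeasurableAtFilter _ _) cc.continuousAt
  have ichi : ∀ y, 0 ≤ y → IntervalIntegrable (fun s => (K / (K + s)) ^ 2) volume 0 y := by
    intro y hy
    refine ContinuousOn.intervalIntegrable ?_
    rw [uIcc_of_le hy]
    refine ContinuousOn.pow (ContinuousOn.div continuousOn_const (continuousOn_const.add continuousOn_id) ?_) 2
    intro s hs
    have : K + s ≠ 0 := by linarith [hs.1]
    exact this
  refine ⟨fun y => ∫ s in (0:ℝ)..y, c s, c, fun y => (-(2 * K ^ 2 / (K + y) ^ 3) * G y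
    - (K / (K + y)) ^ 2 * G1 y) / G y ^ 2, fun y _ => dω y, ?_, ?_, cc, ?_, cv, fun y _ => rfl, ?_, ?_⟩
  · intro y hy
    have := (dchi hK hy.le).div (dG y hy) (pos y hy.le).ne'
    refine this.congr_of_eventuallyEq ?_
    filter_upwards [lt_mem_nhds hy] with s hs
    rw [cv s hs.le]; rfl
  · exact continuous_iff_continuousAt.2 fun y => (dω y).continuousAt
  · simp
  · intro y hy
    rw [← chi_int hK hy, ← intervalIntegral.integral_const_mul]
    refine intervalIntegral.integral_mono_on hy (cc.intervalIntegrable _ _) ((ichi y hy).const_mul _) fun s hs => ?_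
    rw [cv s hs.1, div_eq_mul_inv, mul_comm]
    gcongr
    exact Gl s hs.1
  · intro y hy
    rw [← chi_int hK hy, ← intervalIntegral.integral_const_mul]
    refine intervalIntegral.integral_mono_on hy (ichi y hy) ((cc.intervalIntegrable _ _).const_mul _) fun s hs => ?_
    rw [cv s hs.1, ← mul_div_assoc, le_div_iff₀ (pos s hs.1), mul_comm]
    gcongr
    exact Gu s hs.1


lemma row1 {nt s M m τ d q : ℝ} {A0 A1 B0 B1 C0 C1 D h g h' g' ψ : ℂ} (hs : 0 < s) (hM : 0 ≤ M)
    (hτ : 0 ≤ τ) (hm : 0 ≤ m) (hd : 0 ≤ d)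
    (a0 : ‖A0‖ ≤ M * τ) (a1 : ‖A1‖ ≤ M * τ) (b0 : ‖B0‖ ≤ M * τ) (b1 : ‖B1‖ ≤ M * τ)
    (c0 : ‖C0‖ ≤ m * τ) (c1 : ‖C1‖ ≤ m * τ) (dd : ‖D‖ ≤ m * τ ^ 2)
    (k1 : |nt| * ‖h‖ ≤ d) (k2 : |nt| * ‖g‖ ≤ d) (k3 : ‖h'‖ ≤ d) (k4 : ‖g'‖ ≤ d)
    (k5 : ‖h‖ ≤ q) (k6 : ‖g‖ ≤ q) (k7 : s⁻¹ * ‖ψ‖ * τ ≤ q) :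
    ‖Complex.I * (nt : ℂ) * ((s : ℂ) * (A0 * h + A1 * g)) + (s : ℂ) * (B0 * h' + B1 * g')
      + (C0 * h + C1 * g) + ((s⁻¹ : ℝ) : ℂ) * ψ * D‖ ≤ 4 * τ * (s * M * d + m * q) := by
  have n1 : ‖Complex.I * (nt : ℂ) * ((s : ℂ) * (A0 * h + A1 * g))‖ ≤ 2 * (s * (M * τ * d)) := by
    rw [norm_mul, norm_mul, norm_mul, Complex.norm_I, Complex.norm_real, Complex.norm_real,
      Real.norm_eq_abs, Real.norm_of_nonneg hs.le, one_mul]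
    calc |nt| * (s * ‖A0 * h + A1 * g‖) ≤ |nt| * (s * (‖A0‖ * ‖h‖ + ‖A1‖ * ‖g‖)) := by
          gcongr
          refine (norm_add_le _ _).trans ?_
          rw [norm_mul, norm_mul]
      _ = s * (‖A0‖ * (|nt| * ‖h‖) + ‖A1‖ * (|nt| * ‖g‖)) := by ring
      _ ≤ s * (M * τ * d + M * τ * d) := by gcongr
      _ = _ := by ring
  have n2 : ‖(s : ℂ) * (B0 * h' + B1 * g')‖ ≤ 2 * (s * (M * τ * d)) := by
    rw [norm_mul, Complex.norm_real, Real.norm_of_nonneg hs.le]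
    calc s * ‖B0 * h' + B1 * g'‖ ≤ s * (‖B0‖ * ‖h'‖ + ‖B1‖ * ‖g'‖) := by
          gcongr
          refine (norm_add_le _ _).trans ?_
          rw [norm_mul, norm_mul]
      _ ≤ s * (M * τ * d + M * τ * d) := by gcongr
      _ = _ := by ring
  have n3 : ‖C0 * h + C1 * g‖ ≤ 2 * (m * τ * q) := by
    refine (norm_add_le _ _).trans ?_
    rw [norm_mul, norm_mul]
    calc ‖C0‖ * ‖h‖ + ‖C1‖ * ‖g‖ ≤ m * τ * q + m * τ * q := by gcongr
      _ = _ := by ring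
  have n4 : ‖((s⁻¹ : ℝ) : ℂ) * ψ * D‖ ≤ m * τ * q := by
    rw [norm_mul, norm_mul, Complex.norm_real, Real.norm_of_nonneg (by positivity)]
    calc s⁻¹ * ‖ψ‖ * ‖D‖ ≤ s⁻¹ * ‖ψ‖ * (m * τ ^ 2) := by gcongr
      _ = m * τ * (s⁻¹ * ‖ψ‖ * τ) := by ring
      _ ≤ m * τ * q := by gcongr
  have q0 : 0 ≤ q := (norm_nonneg _).trans k5
  have : 0 ≤ m * τ * q := by positivity
  refine (norm_add_le _ _).trans ?_
  refine (add_le_add_left (norm_add_le _ _) _).trans ?_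
  refine (add_le_add_left (add_le_add_left (norm_add_le _ _) _) _).trans ?_
  linarith

lemma row2 {s M m τ d q k c : ℝ} {C0 C1 D h g f' ψ : ℂ} (hs : 0 < s) (hM : 0 ≤ M)
    (hτ : 0 ≤ τ) (hm : 0 ≤ m) (hd : 0 ≤ d) (hk : 0 ≤ k)
    (b0 : |c| ≤ k * (s * (M * τ)))
    (c0 : ‖C0‖ ≤ m * τ) (c1 : ‖C1‖ ≤ m * τ) (dd : ‖D‖ ≤ m * τ ^ 2)
    (k3 : ‖f'‖ ≤ d)
    (k5 : ‖h‖ ≤ q) (k6 : ‖g‖ ≤ q) (k7 : s⁻¹ * ‖ψ‖ * τ ≤ q) :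
    ‖-((c : ℂ) * f') + (C0 * h + C1 * g) + ((s⁻¹ : ℝ) : ℂ) * ψ * D‖ ≤ (k + 4) * τ * (s * M * d + m * q) := by
  have n2 : ‖-((c : ℂ) * f')‖ ≤ k * (s * (M * τ)) * d := by
    rw [norm_neg, norm_mul, Complex.norm_real, Real.norm_eq_abs]
    gcongr
  have n3 : ‖C0 * h + C1 * g‖ ≤ 2 * (m * τ * q) := by
    refine (norm_add_le _ _).trans ?_
    rw [norm_mul, norm_mul]
    calc ‖C0‖ * ‖h‖ + ‖C1‖ * ‖g‖ ≤ m * τ * q + m * τ * q := by gcongr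
      _ = _ := by ring
  have n4 : ‖((s⁻¹ : ℝ) : ℂ) * ψ * D‖ ≤ m * τ * q := by
    rw [norm_mul, norm_mul, Complex.norm_real, Real.norm_of_nonneg (by positivity)]
    calc s⁻¹ * ‖ψ‖ * ‖D‖ ≤ s⁻¹ * ‖ψ‖ * (m * τ ^ 2) := by gcongr
      _ = m * τ * (s⁻¹ * ‖ψ‖ * τ) := by ring
      _ ≤ m * τ * q := by gcongr
  have q0 : 0 ≤ q := (norm_nonneg _).trans k5
  have x1 : 0 ≤ m * τ * q := by positivity
  have x2 : 0 ≤ k * (m * τ * q) := by positivity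
  have x3 : 0 ≤ τ * (s * M * d) := by positivity
  refine (norm_add_le _ _).trans ?_
  refine (add_le_add_left (norm_add_le _ _) _).trans ?_
  linarith

def GG (μ κ γ γbar γ₀ : ℝ) : ℝ :=
  4 + μ + κ + μ⁻¹ + κ⁻¹ + 2 * γbar + γbar ^ 2 + 2 * γ₀⁻¹ + 2 * γbar * γ₀⁻¹ ^ 2
    + (1 + μ / κ) * (γbar + 1) + 2 * κ / γ

lemma GG_facts {μ κ γ γbar γ₀ : ℝ} (hμ : 0 < μ) (hκ : 0 < κ)
    (hγ : 0 < γ) (hγγ : γ ≤ γbar) (hγ₀ : 0 < γ₀) :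
    4 + 2 * κ / γ ≤ GG μ κ γ γbar γ₀ ∧ μ ≤ GG μ κ γ γbar γ₀ ∧ κ ≤ GG μ κ γ γbar γ₀ ∧
    μ⁻¹ ≤ GG μ κ γ γbar γ₀ ∧ κ⁻¹ ≤ GG μ κ γ γbar γ₀ ∧ 2 * γbar ≤ GG μ κ γ γbar γ₀ ∧
    γbar ^ 2 ≤ GG μ κ γ γbar γ₀ ∧ 2 * γ₀⁻¹ ≤ GG μ κ γ γbar γ₀ ∧
    2 * γbar * γ₀⁻¹ ^ 2 ≤ GG μ κ γ γbar γ₀ ∧ (1 + μ / κ) * γbar ≤ GG μ κ γ γbar γ₀ ∧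
    (1 + μ / κ) ≤ GG μ κ γ γbar γ₀ ∧ 4 ≤ GG μ κ γ γbar γ₀ := by
  have hb : 0 < γbar := by linarith
  have a1 : 0 < μ⁻¹ := by positivity
  have a2 : 0 < κ⁻¹ := by positivity
  have a3 : 0 < γbar ^ 2 := by positivity
  have a4 : 0 < γ₀⁻¹ := by positivity
  have a5 : 0 < 2 * γbar * γ₀⁻¹ ^ 2 := by positivity
  have a6 : 0 < (1 + μ / κ) * γbar := by positivity
  have a7 : 0 < (1 + μ / κ) := by positivity
  have a8 : 0 < 2 * κ / γ := by positivity
  have e : GG μ κ γ γbar γ₀ = 4 + μ + κ + μ⁻¹ + κ⁻¹ + 2 * γbar + γbar ^ 2 + 2 * γ₀⁻¹ + 2 * γbar * γ₀⁻¹ ^ 2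
    + (1 + μ / κ) * γbar + (1 + μ / κ) + 2 * κ / γ := by unfold GG; ring
  rw [e]
  refine ⟨?_, ?_, ?_, ?_, ?_, ?_, ?_, ?_, ?_, ?_, ?_, ?_⟩ <;> linarith


lemma prof_bd {x M : ℝ} {Y a b : ℝ} (hY : 0 ≤ Y) (hx : 0 ≤ x)
    (h : (1 + Y) ^ 3 * (a + b) ≤ M) (hxab : x ≤ a + b) : x ≤ M * (1 + Y)⁻¹ ∧ x * Y ≤ M ∧ x ≤ M := by
  have h1 : (1 + Y) ≤ (1 + Y) ^ 3 := le_self_pow₀ (by linarith) (by norm_num)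
  have h2 : (1 + Y) * x ≤ M := by
    calc (1 + Y) * x ≤ (1 + Y) ^ 3 * (a + b) := by gcongr
      _ ≤ M := h
  refine ⟨?_, ?_, ?_⟩
  · rw [← div_eq_mul_inv, le_div_iff₀ (by linarith)]; linarith
  · nlinarith
  · nlinarith

lemma inv_bd {Y x a b m : ℝ} (hY : 0 ≤ Y) (h : (1 + Y) * (a + b) ≤ m) (ha : x ≤ a + b) :
    x ≤ m * (1 + Y)⁻¹ := by
  rw [← div_eq_mul_inv, le_div_iff₀ (by linarith)]
  calc x * (1 + Y) ≤ (a + b) * (1 + Y) := by gcongr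
    _ ≤ m := by linarith

lemma inv_bd2 {Y x a b m : ℝ} (hY : 0 ≤ Y) (h : (1 + Y) ^ 2 * (a + b) ≤ m) (ha : x ≤ a + b) :
    x ≤ m * (1 + Y)⁻¹ ^ 2 := by
  rw [inv_pow, ← div_eq_mul_inv, le_div_iff₀ (by positivity)]
  calc x * (1 + Y) ^ 2 ≤ (a + b) * (1 + Y) ^ 2 := by gcongr
    _ ≤ m := by linarith

lemma FB_close {F R X : ℂ} {B R2 Γ' Γ τ z : ℝ} (e : F = R - X) (hR : ‖R‖ ^ 2 ≤ R2) (hX : ‖X‖ ≤ B)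
    (hB : B = Γ' * τ * z) (hΓ : Γ' ≤ Γ) (hτ : 0 ≤ τ) (hz : 0 ≤ z) : ‖F‖ ≤ √R2 + Γ * τ * z := by
  rw [e]
  refine (norm_sub_le _ _).trans (add_le_add (Real.le_sqrt_of_sq_le hR) (hX.trans ?_))
  rw [hB]; gcongr

set_option maxHeartbeats 4000000 in
lemma mkSys (μ κ γ γbar γ₀ : ℝ) (hμ : 0 < μ) (hκ : 0 < κ)
    (hγ : 0 < γ) (hγγ : γ ≤ γbar) (hγ₀ : 0 < γ₀)
    (ϱ : ℝ) (hϱ : 0 < ϱ) (M : ℝ) (hM : 0 ≤ M) (ε : ℝ) (n : ℤ) (hε : ε ∈ Set.Ioc (0:ℝ) 1) (hn : n ≠ 0)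
    (Us Hs : ℝ → ℝ) (cU : ContDiff ℝ 3 Us) (cH : ContDiff ℝ 3 Hs)
    (hH : ∀ Y, 0 ≤ Y → γ ≤ |Hs Y| ∧ |Hs Y| ≤ γbar)
    (hG : ∀ Y, 0 ≤ Y → γ₀ ≤ Hs Y ^ 2 - Us Y ^ 2)
    (hD : ∀ Y, 0 ≤ Y → (1 + Y)^3 * (|deriv Us Y| + |deriv Hs Y|) ≤ M)
    (AU BU CU CH : ℝ → Matrix (Fin 2) (Fin 2) ℂ) (DU DH : ℝ → Fin 2 → ℂ)
    (hAB : ∀ Y, 0 ≤ Y → ∀ i j, (1 + Y) * (‖AU Y i j‖ + ‖BU Y i j‖) ≤ M)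
    (hCC : ∀ Y, 0 ≤ Y → ∀ i j, (1 + Y) * (‖CU Y i j‖ + ‖CH Y i j‖) ≤ M * (1 + M))
    (hDD : ∀ Y, 0 ≤ Y → ∀ i, (1 + Y)^2 * (‖DU Y i‖ + ‖DH Y i‖) ≤ M * (1 + M))
    (u v h g p R1 R2 R3 R4 : ℝ → ℂ)
    (cu : ContDiff ℝ 3 u) (cv : ContDiff ℝ 3 v) (ch : ContDiff ℝ 3 h) (cg : ContDiff ℝ 3 g)
    (cp : ContDiff ℝ 2 p)
    (iu : IntegrableOn (fun y => ‖u y‖ ^ 2) (Ioi 0))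
    (iv : IntegrableOn (fun y => ‖v y‖ ^ 2) (Ioi 0))
    (ih : IntegrableOn (fun y => ‖h y‖ ^ 2) (Ioi 0))
    (ig : IntegrableOn (fun y => ‖g y‖ ^ 2) (Ioi 0))
    (iu' : IntegrableOn (fun y => ‖deriv u y‖ ^ 2) (Ioi 0))
    (iv' : IntegrableOn (fun y => ‖deriv v y‖ ^ 2) (Ioi 0))
    (ih' : IntegrableOn (fun y => ‖deriv h y‖ ^ 2) (Ioi 0))
    (ig' : IntegrableOn (fun y => ‖deriv g y‖ ^ 2) (Ioi 0))
    (tW : Tendsto (fun y => ‖u y‖ + ‖v y‖ + ‖h y‖ + ‖g y‖) atTop (nhds 0))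
    (tW' : Tendsto (fun y => ‖deriv u y‖ + ‖deriv v y‖ + ‖deriv h y‖ + ‖deriv g y‖)
        atTop (nhds 0))
    (tp : Tendsto (fun y => ‖p y‖ * (‖u y‖ + ‖v y‖ + ‖h y‖ + ‖g y‖)) atTop (nhds 0))
    (iR1 : IntegrableOn (fun y => ‖R1 y‖ ^ 2) (Ioi 0))
    (iR2 : IntegrableOn (fun y => ‖R2 y‖ ^ 2) (Ioi 0))
    (iR3 : IntegrableOn (fun y => ‖R3 y‖ ^ 2) (Ioi 0))
    (iR4 : IntegrableOn (fun y => ‖R4 y‖ ^ 2) (Ioi 0))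
    (q1 : ∀ y, 0 < y →
        Complex.I * (((n:ℝ)/ϱ : ℝ) : ℂ) *
            ((((1 + μ/κ) * Us (y / Real.sqrt ε) : ℝ) : ℂ) * u y
              - ((Hs (y / Real.sqrt ε) ^ 2 - Us (y / Real.sqrt ε) ^ 2 : ℝ) : ℂ) * h y
              + ((Real.sqrt ε : ℝ) : ℂ) *
                  (AU (y / Real.sqrt ε) 0 0 * h y + AU (y / Real.sqrt ε) 0 1 * g y))
          + ((Real.sqrt ε : ℝ) : ℂ) *
              (BU (y / Real.sqrt ε) 0 0 * deriv h y + BU (y / Real.sqrt ε) 0 1 * deriv g y)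
          + (CU (y / Real.sqrt ε) 0 0 * h y + CU (y / Real.sqrt ε) 0 1 * g y)
          + (((Real.sqrt ε)⁻¹ : ℝ) : ℂ) * (∫ s in (0:ℝ)..y, h s) * DU (y / Real.sqrt ε) 0
          + Complex.I * (((n:ℝ)/ϱ : ℝ) : ℂ) * p y
          - ((μ * ε : ℝ) : ℂ) *
              (deriv (deriv u) y - (((n:ℝ)/ϱ : ℝ) : ℂ)^2 * u y)
          = R1 y)
    (q2 : ∀ y, 0 < y →
        Complex.I * (((n:ℝ)/ϱ : ℝ) : ℂ) *
            ((((1 + μ/κ) * Us (y / Real.sqrt ε) : ℝ) : ℂ) * v y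
              - ((Hs (y / Real.sqrt ε) ^ 2 - Us (y / Real.sqrt ε) ^ 2 : ℝ) : ℂ) * g y
              + ((Real.sqrt ε : ℝ) : ℂ) *
                  (AU (y / Real.sqrt ε) 1 0 * h y + AU (y / Real.sqrt ε) 1 1 * g y))
          + ((Real.sqrt ε : ℝ) : ℂ) *
              (BU (y / Real.sqrt ε) 1 0 * deriv h y + BU (y / Real.sqrt ε) 1 1 * deriv g y)
          + (CU (y / Real.sqrt ε) 1 0 * h y + CU (y / Real.sqrt ε) 1 1 * g y)
          + (((Real.sqrt ε)⁻¹ : ℝ) : ℂ) * (∫ s in (0:ℝ)..y, h s) * DU (y / Real.sqrt ε) 1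
          + deriv p y
          - ((μ * ε : ℝ) : ℂ) *
              (deriv (deriv v) y - (((n:ℝ)/ϱ : ℝ) : ℂ)^2 * v y)
          = R2 y)
    (q3 : ∀ y, 0 < y →
        -(Complex.I * (((n:ℝ)/ϱ : ℝ) : ℂ)) * u y
          - ((2 * κ * Real.sqrt ε *
              (deriv Hs (y / Real.sqrt ε) / Hs (y / Real.sqrt ε)) : ℝ) : ℂ) * deriv h y
          + (CH (y / Real.sqrt ε) 0 0 * h y + CH (y / Real.sqrt ε) 0 1 * g y)
          + (((Real.sqrt ε)⁻¹ : ℝ) : ℂ) * (∫ s in (0:ℝ)..y, h s) * DH (y / Real.sqrt ε) 0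
          - ((κ * ε : ℝ) : ℂ) *
              (deriv (deriv h) y - (((n:ℝ)/ϱ : ℝ) : ℂ)^2 * h y)
          = R3 y)
    (q4 : ∀ y, 0 < y →
        -(Complex.I * (((n:ℝ)/ϱ : ℝ) : ℂ)) * v y
          - ((2 * κ * Real.sqrt ε *
              (deriv Hs (y / Real.sqrt ε) / Hs (y / Real.sqrt ε)) : ℝ) : ℂ) * deriv g y
          + (CH (y / Real.sqrt ε) 1 0 * h y + CH (y / Real.sqrt ε) 1 1 * g y)
          + (((Real.sqrt ε)⁻¹ : ℝ) : ℂ) * (∫ s in (0:ℝ)..y, h s) * DH (y / Real.sqrt ε) 1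
          - ((κ * ε : ℝ) : ℂ) *
              (deriv (deriv g) y - (((n:ℝ)/ϱ : ℝ) : ℂ)^2 * g y)
          = R4 y)
    (hdiv : ∀ y, 0 < y →
        Complex.I * (((n:ℝ)/ϱ : ℝ) : ℂ) * u y + deriv v y = 0 ∧
        Complex.I * (((n:ℝ)/ϱ : ℝ) : ℂ) * h y + deriv g y = 0)
    (u0 : u 0 = 0) (v0 : v 0 = 0) (h0 : deriv h 0 = 0) (g0 : g 0 = 0) :
    ∃ S : Sys, S.FB ∧ S.Γ = GG μ κ γ γbar γ₀ ∧ S.M = M ∧ S.ε = ε ∧ S.nt = (n:ℝ)/ϱ ∧ S.K = 2 + ϱ ∧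
      S.u = u ∧ S.v = v ∧ S.h = h ∧ S.g = g ∧
      (S.R2 = fun y => ‖R1 y‖ ^ 2 + ‖R2 y‖ ^ 2 + ‖R3 y‖ ^ 2 + ‖R4 y‖ ^ 2) ∧
      ∀ y, 0 ≤ y → S.ω y ≤ S.Γ * S.K := by
  obtain ⟨f1, f2, f3, f4, f5, f6, f7, f8, f9, f10, f11, f12⟩ := GG_facts hμ hκ hγ hγγ hγ₀
  obtain ⟨Γ, hΓ⟩ : ∃ t, t = GG μ κ γ γbar γ₀ := ⟨_, rfl⟩
  rw [← hΓ] at f1 f2 f3 f4 f5 f6 f7 f8 f9 f10 f11 f12 ⊢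
  have Γ0 : 0 < Γ := by linarith
  obtain ⟨s, hs⟩ : ∃ t, t = √ε := ⟨_, rfl⟩
  rw [← hs] at q1 q2 q3 q4
  have s0 : 0 < s := by rw [hs]; exact Real.sqrt_pos.2 hε.1
  have ss : s ^ 2 = ε := by rw [hs]; exact Real.sq_sqrt hε.1.le
  obtain ⟨N, hN⟩ : ∃ t, t = (n:ℝ)/ϱ := ⟨_, rfl⟩
  rw [← hN] at q1 q2 q3 q4 hdiv ⊢
  have N0 : N ≠ 0 := by rw [hN]; exact div_ne_zero (by exact_mod_cast hn) hϱ.ne'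
  have Nϱ : 1 ≤ |N| * ϱ := by
    rw [hN, abs_div, abs_of_pos hϱ, div_mul_cancel₀ _ hϱ.ne']
    exact_mod_cast Int.one_le_abs hn
  have hb0 : 0 < γbar := by linarith
  obtain ⟨K, hK⟩ : ∃ t, t = 2 + ϱ := ⟨_, rfl⟩
  rw [← hK]
  have K2 : 2 ≤ K := by linarith
  have NK : 1 ≤ |N| * K := by
    have : 0 ≤ |N| := abs_nonneg N
    rw [hK]; linarith
  have hY : ∀ y, 0 ≤ y → 0 ≤ y / s := fun y hy => by positivity
  have dU := fun Y => ((cU.differentiable (by norm_num)) Y).hasDerivAt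
  have dH := fun Y => ((cH.differentiable (by norm_num)) Y).hasDerivAt
  have ds : ∀ y, HasDerivAt (fun y : ℝ => y / s) (1 / s) y := fun y => (hasDerivAt_id' y).div_const s
  have dUs : ∀ y, HasDerivAt (fun y => Us (y / s)) (deriv Us (y / s) * (1 / s)) y := fun y =>
    (dU (y / s)).comp y (ds y)
  have dHs : ∀ y, HasDerivAt (fun y => Hs (y / s)) (deriv Hs (y / s) * (1 / s)) y := fun y =>
    (dH (y / s)).comp y (ds y)
  have hU : ∀ Y, 0 ≤ Y → |Us Y| ≤ γbar := by
    intro Y hY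
    have h1 := hG Y hY
    have : |Us Y| ≤ |Hs Y| := sq_le_sq.1 (by linarith)
    exact this.trans (hH Y hY).2
  set G : ℝ → ℝ := fun y => Hs (y / s) ^ 2 - Us (y / s) ^ 2 with hGd
  set G1 : ℝ → ℝ := fun y => (2 * Hs (y / s) * deriv Hs (y / s) - 2 * Us (y / s) * deriv Us (y / s)) * (1 / s) with hG1d
  have dG : ∀ y, HasDerivAt G (G1 y) y := by
    intro y
    have : HasDerivAt G _ y := ((dHs y).pow 2).sub ((dUs y).pow 2)
    refine this.congr_deriv ?_
    simp only [hG1d]; norm_num; ring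
  have cG : Continuous G := continuous_iff_continuousAt.2 fun y => (dG y).continuousAt
  have Gl : ∀ y, 0 ≤ y → γ₀ ≤ G y := fun y hy => hG _ (hY y hy)
  have Gu : ∀ y, 0 ≤ y → G y ≤ γbar ^ 2 := fun y hy => by
    have h1 := (hH _ (hY y hy)).2
    have : Hs (y / s) ^ 2 ≤ γbar ^ 2 := sq_le_sq' (by linarith [abs_le.1 h1]) (abs_le.1 h1).2
    have h2 := sq_nonneg (Us (y / s))
    simp only [hGd]; linarith
  have Gu' : ∀ y, 0 ≤ y → G y ≤ Γ := fun y hy => (Gu y hy).trans f7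
  have G1b : ∀ y, 0 ≤ y → |G1 y| * s ≤ 2 * γbar * (|deriv Us (y / s)| + |deriv Hs (y / s)|) := by
    intro y hy
    have e : |G1 y| * s = |2 * Hs (y / s) * deriv Hs (y / s) - 2 * Us (y / s) * deriv Us (y / s)| := by
      simp only [hG1d]
      rw [abs_mul, abs_of_pos (show 0 < 1 / s by positivity)]
      field_simp
    rw [e]
    refine (abs_sub _ _).trans ?_
    simp only [abs_mul, abs_two]
    have a1 := (hH _ (hY y hy)).2
    have a2 := hU _ (hY y hy)
    have a3 := mul_le_mul_of_nonneg_right a1 (abs_nonneg (deriv Hs (y / s)))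
    have a4 := mul_le_mul_of_nonneg_right a2 (abs_nonneg (deriv Us (y / s)))
    linarith
  have G1M : ∀ y, 0 ≤ y → |G1 y| * s ≤ 2 * γbar * M ∧ |G1 y| * y ≤ 2 * γbar * M := by
    intro y hy
    obtain ⟨-, b2, b3⟩ := prof_bd (hY y hy) (by positivity) (hD _ (hY y hy)) le_rfl
    have h1 := G1b y hy
    constructor
    · exact h1.trans (by gcongr)
    · calc |G1 y| * y = |G1 y| * s * (y / s) := by field_simp
        _ ≤ 2 * γbar * (|deriv Us (y / s)| + |deriv Hs (y / s)|) * (y / s) := by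
          have := hY y hy
          gcongr
        _ = 2 * γbar * ((|deriv Us (y / s)| + |deriv Hs (y / s)|) * (y / s)) := by ring
        _ ≤ _ := by gcongr
  obtain ⟨ω, ω1, ω2, dω, dω1, cω, cω1, ω00, ω1e, ω2e, ωu, ωl⟩ :=
    weight K2 hγ₀ cG (fun y _ => dG y) Gl Gu
  have Kp : ∀ y, 0 ≤ y → 0 < K + y := fun y hy => by linarith
  have Kd : ∀ y, 0 ≤ y → 0 ≤ K / (K + y) ∧ K / (K + y) ≤ 1 := fun y hy => by
    have := Kp y hy
    refine ⟨by positivity, ?_⟩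
    rw [div_le_one this]; linarith
  have Ginv : ∀ y, 0 ≤ y → 0 < (G y)⁻¹ ∧ (G y)⁻¹ ≤ γ₀⁻¹ := fun y hy => by
    have := Gl y hy
    have : 0 < G y := by linarith
    refine ⟨by positivity, ?_⟩
    gcongr
  have li : γ₀⁻¹ ≤ Γ := by
    have : 0 < γ₀⁻¹ := by positivity
    linarith
  have ωnn : ∀ y, 0 ≤ y → 0 ≤ ω y := by
    intro y hy
    have h1 := ωl y hy
    have h2 : 0 ≤ y * (K / (K + y)) := mul_nonneg hy (Kd y hy).1
    by_contra hc
    push Not at hc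
    have : γbar ^ 2 * ω y < 0 := mul_neg_of_pos_of_neg (by positivity) hc
    linarith
  have ωK : ∀ y, 0 ≤ y → ω y ≤ Γ * K := by
    intro y hy
    have h1 := ωu y hy
    have h2 : y * (K / (K + y)) ≤ K := by
      rw [← mul_div_assoc, div_le_iff₀ (Kp y hy)]; nlinarith
    have h3 : 0 ≤ y * (K / (K + y)) := mul_nonneg hy (Kd y hy).1
    exact h1.trans (by gcongr)
  have χ1N : ∀ y, 0 ≤ y → 2 * K ^ 2 / (K + y) ^ 3 ≤ 2 * |N| * (K / (K + y)) ^ 2 := by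
    intro y hy
    have h1 := Kp y hy
    have h2 : 1 / (K + y) ≤ |N| := by
      rw [div_le_iff₀ h1]
      have : |N| * K ≤ |N| * (K + y) := by gcongr; linarith
      linarith
    calc 2 * K ^ 2 / (K + y) ^ 3 = 2 * (1 / (K + y)) * (K / (K + y)) ^ 2 := by field_simp
      _ ≤ _ := by gcongr
  have cI : ∀ {f : ℝ → ℝ}, (∀ y, 0 ≤ y → ContinuousAt f y) → ContinuousOn f (Ici 0) := fun hf y hy =>
    (hf y hy).continuousWithinAt
  have kI : -(Complex.I * (N:ℂ)) ≠ 0 := by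
    simp [N0]
  set ψ : ℝ → ℂ := fun y => (-(Complex.I * (N:ℂ)))⁻¹ * g y with hψ
  set φ : ℝ → ℂ := fun y => (-(Complex.I * (N:ℂ)))⁻¹ * v y with hφ
  have dφ : ∀ y, 0 < y → HasDerivAt φ (u y) y := by
    intro y hy
    have := ((cv.differentiable (by norm_num) y).hasDerivAt).const_mul (-(Complex.I * (N:ℂ)))⁻¹
    refine this.congr_deriv ?_
    rw [show deriv v y = -(Complex.I * N) * u y by linear_combination (hdiv y hy).1, inv_mul_cancel_left₀ kI]
  have dψ : ∀ y, 0 < y → HasDerivAt ψ (h y) y := by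
    intro y hy
    have := ((cg.differentiable (by norm_num) y).hasDerivAt).const_mul (-(Complex.I * (N:ℂ)))⁻¹
    refine this.congr_deriv ?_
    rw [show deriv g y = -(Complex.I * N) * h y by linear_combination (hdiv y hy).2, inv_mul_cancel_left₀ kI]
  have cψ : ContDiff ℝ 1 ψ := contDiff_const.mul (cg.of_le (by norm_num))
  have cφ : ContDiff ℝ 1 φ := contDiff_const.mul (cv.of_le (by norm_num))
  have ψ0 : ψ 0 = 0 := by simp [hψ, g0]
  have φ0 : φ 0 = 0 := by simp [hφ, v0]
  have intψ : ∀ y, 0 < y → ∫ t in (0:ℝ)..y, h t = ψ y := by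
    intro y hy
    rw [intervalIntegral.integral_eq_sub_of_hasDerivAt_of_le hy.le cψ.continuous.continuousOn
      (fun t ht => dψ t ht.1) (ch.continuous.intervalIntegrable _ _), ψ0, sub_zero]
  have Ki : ∀ y, 0 ≤ y → 1 / (K + y) ≤ |N| := by
    intro y hy
    have h1 := Kp y hy
    rw [div_le_iff₀ h1]
    have : |N| * K ≤ |N| * (K + y) := by gcongr; linarith
    linarith
  have ω2b : ∀ y, 0 < y → |ω2 y| ≤ Γ * (|N| + M / y) := by
    intro y hy
    have h1 := Gl y hy.le
    have g0 : 0 < G y := by linarith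
    have h2 := Ginv y hy.le
    have h3 := Kd y hy.le
    have h4 := Kp y hy.le
    have e : ω2 y = -(2 * K ^ 2 / (K + y) ^ 3) * (G y)⁻¹ - (K / (K + y)) ^ 2 * G1 y * (G y)⁻¹ ^ 2 := by
      rw [ω2e y hy]; field_simp
    have h5 : (K / (K + y)) ^ 2 ≤ 1 := pow_le_one₀ h3.1 h3.2
    have h6 : 2 * K ^ 2 / (K + y) ^ 3 ≤ 2 * |N| := (χ1N y hy.le).trans (by
      have : 2 * |N| * (K / (K + y)) ^ 2 ≤ 2 * |N| * 1 := by gcongr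
      linarith)
    have h7 : 0 ≤ 2 * K ^ 2 / (K + y) ^ 3 := by positivity
    have h8 : |G1 y| ≤ 2 * γbar * M / y := by rw [le_div_iff₀ hy]; exact (G1M y hy.le).2
    rw [e]
    refine (abs_sub _ _).trans ?_
    rw [abs_mul, abs_neg, abs_of_nonneg h7, abs_of_pos h2.1, abs_mul, abs_mul, abs_of_nonneg (sq_nonneg (K / (K + y))),
      abs_of_nonneg (sq_nonneg (G y)⁻¹)]
    calc _ ≤ 2 * |N| * γ₀⁻¹ + 1 * (2 * γbar * M / y) * γ₀⁻¹ ^ 2 := by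
          gcongr
      _ = (2 * γ₀⁻¹) * |N| + (2 * γbar * γ₀⁻¹ ^ 2) * (M / y) := by ring
      _ ≤ Γ * |N| + Γ * (M / y) := by gcongr
      _ = _ := by ring
  have χ2b : ∀ y, 0 < y → |6 * K ^ 2 / (K + y) ^ 4| ≤ 6 * N ^ 2 := by
    intro y hy
    have h1 := Kp y hy.le
    have h2 := Ki y hy.le
    have h3 := Kd y hy.le
    rw [abs_of_nonneg (by positivity)]
    calc 6 * K ^ 2 / (K + y) ^ 4 = 6 * (1 / (K + y)) ^ 2 * (K / (K + y)) ^ 2 := by field_simp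
      _ ≤ 6 * |N| ^ 2 * 1 ^ 2 := by
        gcongr
        exact h3.2
      _ = _ := by rw [sq_abs]; ring
  have b1b : ∀ y, 0 < y → |(1 + μ / κ) * (deriv Us (y / s) * (1 / s))| * y ≤ Γ * M := by
    intro y hy
    obtain ⟨-, b2, -⟩ := prof_bd (hY y hy.le) (abs_nonneg (deriv Us (y / s))) (hD _ (hY y hy.le))
      (le_add_of_nonneg_right (abs_nonneg _))
    rw [abs_mul, abs_mul, abs_of_pos (show 0 < 1 + μ / κ by positivity), abs_of_pos (show 0 < 1 / s by positivity)]
    calc (1 + μ / κ) * (|deriv Us (y / s)| * (1 / s)) * y = (1 + μ / κ) * (|deriv Us (y / s)| * (y / s)) := by ring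
      _ ≤ Γ * M := by gcongr
  obtain ⟨T, hT⟩ : ∃ T : Sys, T =
          { μ := μ, κ := κ, Γ := Γ, M := M, ε := ε, nt := N, K := K
            b := fun y => (1 + μ / κ) * Us (y / s)
            b1 := fun y => (1 + μ / κ) * (deriv Us (y / s) * (1 / s))
            G := G, G1 := G1, ω := ω, ω1 := ω1, ω2 := ω2
            χ := fun y => (K / (K + y)) ^ 2
            χ1 := fun y => -(2 * K ^ 2 / (K + y) ^ 3)
            χ2 := fun y => 6 * K ^ 2 / (K + y) ^ 4
            τ := fun y => (1 + y / s)⁻¹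
            R2 := fun y => ‖R1 y‖ ^ 2 + ‖R2 y‖ ^ 2 + ‖R3 y‖ ^ 2 + ‖R4 y‖ ^ 2
            φ := φ, ψ := ψ, u := u, v := v, h := h, g := g, p := p
            F1 := fun y => Complex.I * N * ((((1 + μ / κ) * Us (y / s) : ℝ) : ℂ) * u y - (G y : ℂ) * h y)
              + Complex.I * N * p y - (μ * ε : ℝ) * (deriv (deriv u) y - (N : ℂ) ^ 2 * u y)
            F2 := fun y => Complex.I * N * ((((1 + μ / κ) * Us (y / s) : ℝ) : ℂ) * v y - (G y : ℂ) * g y)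
              + deriv p y - (μ * ε : ℝ) * (deriv (deriv v) y - (N : ℂ) ^ 2 * v y)
            F3 := fun y => -(Complex.I * N * u y) - (κ * ε : ℝ) * (deriv (deriv h) y - (N : ℂ) ^ 2 * h y)
            F4 := fun y => -(Complex.I * N * v y) - (κ * ε : ℝ) * (deriv (deriv g) y - (N : ℂ) ^ 2 * g y)
            hμ0 := hμ, hκ0 := hκ, hΓ := by linarith, hμ := f2, hκ := f3
            hμ' := by rw [inv_le_iff_one_le_mul₀ hμ] at f4; exact f4
            hκ' := by rw [inv_le_iff_one_le_mul₀ hκ] at f5; exact f5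
            hM := hM, hε0 := hε.1, hε1 := hε.2, hnt := N0, hK := K2
            dG := fun y _ => dG y
            db := fun y _ => (dUs y).const_mul _
            dω := dω, dω1 := dω1
            dχ := fun y hy => dchi K2 hy.le
            dχ1 := fun y hy => dchi1 K2 hy.le
            cG := cG.continuousOn
            cb := cI fun y _ => ((dUs y).const_mul _).continuousAt
            cω := cω.continuousOn, cω1 := cω1.continuousOn
            cχ := cI fun y hy => (dchi K2 hy).continuousAt
            cχ1 := cI fun y hy => (dchi1 K2 hy).continuousAt
            ω_zero := ω00
            Gω1 := fun y hy => by
              have := Gl y hy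
              rw [ω1e y hy, mul_div_cancel₀ _ (by linarith)]
            ω_nn := ωnn
            ω_bdd := ⟨_, ωK⟩
            ω_le := fun y hy => by
              have h3 : 0 ≤ y * (K / (K + y)) := mul_nonneg hy (Kd y hy).1
              refine (ωu y hy).trans ?_
              have := mul_le_mul_of_nonneg_left (Kd y hy).2 hy
              rw [mul_one] at this
              gcongr
            ω_low := fun y hy => (ωl y hy.le).trans (mul_le_mul_of_nonneg_right f7 (ωnn y hy.le))
            ω1_nn := fun y hy => by
              have := Gl y hy
              rw [ω1e y hy]; exact div_nonneg (sq_nonneg _) (by linarith)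
            ω1_le := fun y hy => by
              rw [ω1e y hy, div_eq_mul_inv, mul_comm]
              have := (Ginv y hy).2.trans li
              gcongr
            ω2_le := ω2b
            χ_nn := fun y _ => sq_nonneg _
            χ_le := fun y hy => pow_le_one₀ (Kd y hy).1 (Kd y hy).2
            χ_le' := fun y hy => by
              have := Kd y hy
              show (K / (K + y)) ^ 2 ≤ _
              nlinarith
            χ1_np := fun y hy => by
              have := Kp y hy
              show -(2 * K ^ 2 / (K + y) ^ 3) ≤ 0
              have : 0 ≤ 2 * K ^ 2 / (K + y) ^ 3 := by positivity
              linarith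
            χ1_le := fun y hy => by rw [neg_neg]; exact χ1N y hy
            χ2_le := χ2b
            b_le := fun y hy => by
              rw [abs_mul, abs_of_pos (show 0 < 1 + μ / κ by positivity)]
              exact (mul_le_mul_of_nonneg_left (hU _ (hY y hy)) (by positivity)).trans f10
            b1_le := b1b
            G_low := fun y hy => by
              have := (Ginv y hy).2.trans li
              have h2 := Gl y hy
              rwa [inv_le_iff_one_le_mul₀ (by linarith)] at this
            G_le := Gu'
            G1_le := fun y hy => (G1M y hy.le).2.trans (by gcongr)
            G1_le' := fun y hy => by rw [← hs]; exact (G1M y hy.le).1.trans (by gcongr)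
            τ_nn := fun y hy => by positivity
            τ_le := fun y hy => by
              have := hY y hy.le
              exact inv_le_one_of_one_le₀ (by linarith)
            τ_le' := fun y hy => by
              rw [← hs, inv_mul_le_iff₀ (by positivity)]
              have : (1 + y / s) * s = s + y := by field_simp
              rw [this]; linarith
            cu := cu.of_le (by norm_num), cv := cv.of_le (by norm_num)
            ch := ch.of_le (by norm_num), cg := cg.of_le (by norm_num)
            cφ := cφ, cψ := cψ, cp := cp.of_le (by norm_num)
            vφ := fun y => by simp only [hφ]; rw [mul_inv_cancel_left₀ kI]
            gψ := fun y => by simp only [hψ]; rw [mul_inv_cancel_left₀ kI]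
            dφ := dφ, dψ := dψ, u0 := u0, φ0 := φ0, ψ0 := ψ0, h0 := h0
            iu := iu, iv := iv, ih := ih, ig := ig, iu' := iu', iv' := iv', ih' := ih', ig' := ig'
            tW := tW, tW' := tW', tp := tp
            iR := ((iR1.add iR2).add iR3).add iR4
            R_nn := fun y => by positivity
            e1 := fun y _ => rfl, e2 := fun y _ => rfl, e3 := fun y _ => rfl, e4 := fun y _ => rfl } := ⟨_, rfl⟩
  have t1 : T.Γ = Γ := by rw [hT]
  have t2 : T.M = M := by rw [hT]
  have t3 : T.ε = ε := by rw [hT]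
  have t4 : T.nt = N := by rw [hT]
  have t5 : T.u = u := by rw [hT]
  have t6 : T.v = v := by rw [hT]
  have t7 : T.h = h := by rw [hT]
  have t8 : T.g = g := by rw [hT]
  have t9 : T.R2 = fun y => ‖R1 y‖ ^ 2 + ‖R2 y‖ ^ 2 + ‖R3 y‖ ^ 2 + ‖R4 y‖ ^ 2 := by rw [hT]
  have t10 : T.ψ = ψ := by rw [hT]
  have t11 : ∀ y, T.τ y = (1 + y / s)⁻¹ := by rw [hT]; intro y; rfl
  have t12 : ∀ y, T.F1 y = Complex.I * N * ((((1 + μ / κ) * Us (y / s) : ℝ) : ℂ) * u y - (G y : ℂ) * h y)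
              + Complex.I * N * p y - (μ * ε : ℝ) * (deriv (deriv u) y - (N : ℂ) ^ 2 * u y) := by rw [hT]; intro y; rfl
  have t13 : ∀ y, T.F2 y = Complex.I * N * ((((1 + μ / κ) * Us (y / s) : ℝ) : ℂ) * v y - (G y : ℂ) * g y)
              + deriv p y - (μ * ε : ℝ) * (deriv (deriv v) y - (N : ℂ) ^ 2 * v y) := by rw [hT]; intro y; rfl
  have t14 : ∀ y, T.F3 y = -(Complex.I * N * u y) - (κ * ε : ℝ) * (deriv (deriv h) y - (N : ℂ) ^ 2 * h y) := by
    rw [hT]; intro y; rfl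
  have t15 : ∀ y, T.F4 y = -(Complex.I * N * v y) - (κ * ε : ℝ) * (deriv (deriv g) y - (N : ℂ) ^ 2 * g y) := by
    rw [hT]; intro y; rfl
  have t16 : ∀ y, 0 ≤ y → T.ω y ≤ T.Γ * T.K := by rw [hT]; exact ωK
  have t17 : T.K = K := by rw [hT]
  clear hT
  refine ⟨T, ?_, t1, t2, t3, t4, t17, t5, t6, t7, t8, t9, t16⟩
  intro y hy
  have hYy := hY y hy.le
  have τ0 : 0 ≤ (1 + y / s)⁻¹ := by positivity
  have m0 : 0 ≤ M * (1 + M) := by positivity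
  have na := fun (a : ℂ) => norm_nonneg a
  obtain ⟨a1, a2⟩ := (And.intro (fun i j => inv_bd hYy (hAB _ hYy i j) (le_add_of_nonneg_right (na _)))
    (fun i j => inv_bd hYy (hAB _ hYy i j) (le_add_of_nonneg_left (na _))))
  obtain ⟨a3, a4⟩ := (And.intro (fun i j => inv_bd hYy (hCC _ hYy i j) (le_add_of_nonneg_right (na _)))
    (fun i j => inv_bd hYy (hCC _ hYy i j) (le_add_of_nonneg_left (na _))))
  obtain ⟨a5, a6⟩ := (And.intro (fun i => inv_bd2 hYy (hDD _ hYy i) (le_add_of_nonneg_right (na _)))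
    (fun i => inv_bd2 hYy (hDD _ hYy i) (le_add_of_nonneg_left (na _))))
  have cb : |2 * κ * s * (deriv Hs (y / s) / Hs (y / s))| ≤ 2 * κ / γ * (s * (M * (1 + y / s)⁻¹)) := by
    obtain ⟨b1, -, -⟩ := prof_bd hYy (abs_nonneg (deriv Hs (y / s))) (hD _ hYy)
      (le_add_of_nonneg_left (abs_nonneg _))
    have h1 := (hH _ hYy).1
    rw [abs_mul, abs_of_pos (show 0 < 2 * κ * s by positivity), abs_div]
    calc 2 * κ * s * (|deriv Hs (y / s)| / |Hs (y / s)|) ≤ 2 * κ * s * (M * (1 + y / s)⁻¹ / γ) := by gcongr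
      _ = _ := by ring
  have e1 := q1 y hy
  have e2 := q2 y hy
  have e3 := q3 y hy
  have e4 := q4 y hy
  rw [intψ y hy] at e1 e2 e3 e4
  have k1 := (T.Nd_le (y := y)).2.2
  have k2 := (T.d_le (y := y)).2.2
  have k3 := (T.W_le (y := y)).2.2
  have k4 := T.Wq (y := y)
  have k5 := T.ψq hy
  have k6 := T.τ_le' y hy
  have d0 := T.d_nn y
  have q0 := T.q_nn y
  change _ ≤ T.d y ∧ _ ≤ T.d y at k1
  change _ ≤ T.d y ∧ _ ≤ T.d y at k2
  change _ ≤ T.q y at k4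
  change _ ≤ y * T.q y at k5
  rw [t4, t7, t8] at k1
  rw [t7, t8] at k2 k3
  rw [t10] at k5
  rw [t11, t3, ← hs] at k6
  have k7 : s⁻¹ * ‖ψ y‖ * (1 + y / s)⁻¹ ≤ T.q y := by
    calc s⁻¹ * ‖ψ y‖ * (1 + y / s)⁻¹ ≤ s⁻¹ * (y * T.q y) * (1 + y / s)⁻¹ := by gcongr
      _ = s⁻¹ * T.q y * ((1 + y / s)⁻¹ * y) := by ring
      _ ≤ s⁻¹ * T.q y * s := by gcongr
      _ = _ := by field_simp
  have z0 : 0 ≤ s * M * T.d y + M * (1 + M) * T.q y := by positivity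
  have r1 : ∀ i : Fin 2, _ := fun i => row1 (nt := N) (s := s) (M := M) s0 hM τ0 m0 d0 (a1 i 0) (a1 i 1) (a2 i 0) (a2 i 1)
    (a3 i 0) (a3 i 1) (a5 i) k1.1 k1.2 k2.1 k2.2 (k3.1.trans k4) (k3.2.trans k4) k7
  have r3 := row2 s0 hM τ0 m0 d0 (show 0 ≤ 2 * κ / γ by positivity) cb
    (a4 0 0) (a4 0 1) (a6 0) k2.1 (k3.1.trans k4) (k3.2.trans k4) k7
  have r4 := row2 s0 hM τ0 m0 d0 (show 0 ≤ 2 * κ / γ by positivity) cb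
    (a4 1 0) (a4 1 1) (a6 1) k2.2 (k3.1.trans k4) (k3.2.trans k4) k7
  have s1 := sq_nonneg ‖R1 y‖
  have s2 := sq_nonneg ‖R2 y‖
  have s3 := sq_nonneg ‖R3 y‖
  have s4 := sq_nonneg ‖R4 y‖
  have eΦ : T.Φ y = √(‖R1 y‖ ^ 2 + ‖R2 y‖ ^ 2 + ‖R3 y‖ ^ 2 + ‖R4 y‖ ^ 2) + Γ * (1 + y / s)⁻¹ *
      (s * M * T.d y + M * (1 + M) * T.q y) := by
    unfold Sys.Φ
    rw [t1, t2, t3, t9, t11, hs]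
  rw [eΦ, t12, t13, t14, t15]
  refine ⟨?_, ?_, ?_, ?_⟩
  · refine FB_close (R := R1 y) ?_ (by linarith) (r1 0) rfl f12 τ0 z0
    rw [← e1]; simp only [hGd]; ring
  · refine FB_close (R := R2 y) ?_ (by linarith) (r1 1) rfl f12 τ0 z0
    rw [← e2]; simp only [hGd]; ring
  · refine FB_close (R := R3 y) ?_ (by linarith) r3 rfl (by linarith) τ0 z0
    rw [← e3]; ring
  · refine FB_close (R := R4 y) ?_ (by linarith) r4 rfl (by linarith) τ0 z0
    rw [← e4]; ring


namespace Sys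
variable (S : Sys)

lemma scaled (hF : S.FB) {P e4 : ℝ} (he : 0 < e4) (he2 : e4 ^ 2 = √S.ε) (hP : 0 ≤ P)
    (hr : S.r ≤ P) (hrω : √(17 * S.Γ) * S.L * S.rω ≤ P * e4) :
    (√S.ε * S.a) ^ 2 ≤ 10000 * S.Γ ^ 11 * (P * S.w + S.M * (√S.ε * S.a * S.w) + S.M * (1 + S.M) * S.w ^ 2) ∧
    |S.nt| * (√S.b2 / e4) ^ 2 ≤ 10000 * S.Γ ^ 11 * (P * (√S.b2 / e4 + S.w)
      + (1 + S.M) * (√S.ε * S.a * S.w) + S.M * (1 + S.M) * S.w ^ 2) ∧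
    (∀ t, 0 < t → t ≤ S.K → S.w ^ 2 ≤ 10000 * S.Γ ^ 11 * (t * (√S.ε * S.a * S.w) + (√S.b2 / e4) ^ 2 / t)) := by
  have hΓ := S.hΓ
  have h0 : 0 < S.Γ := by linarith
  have hM := S.hM
  have w0 := S.w_nn
  have a0 := S.a_nn
  have r0 := S.r_nn
  have b0 := S.b2_nn
  have hsb : √S.b2 ^ 2 = S.b2 := Real.sq_sqrt b0
  have hs2 : √S.ε ^ 2 = S.ε := Real.sq_sqrt S.hε0.le
  have hs1 : √S.ε ≤ 1 := Real.sqrt_le_one.2 S.hε1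
  have eA := S.estA hF
  have eS := S.estS hF
  have eJ := S.intJ.2
  have eI := @S.estI
  have L1 := S.L_ge
  obtain ⟨s, hs⟩ : ∃ t, t = √S.ε := ⟨_, rfl⟩
  have s0 : 0 < s := by rw [hs]; exact Real.sqrt_pos.2 S.hε0
  obtain ⟨β, hβ⟩ : ∃ t, t = √S.b2 / e4 := ⟨_, rfl⟩
  have β0 : 0 ≤ β := by rw [hβ]; positivity
  have eb : S.b2 = s * β ^ 2 := by
    rw [hβ, div_pow, hsb, he2, ← hs]; field_simp
  rw [← hβ, ← hs]
  rw [← hs] at eA eJ hs2 he2 hs1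
  obtain ⟨α, hα⟩ : ∃ t, t = s * S.a := ⟨_, rfl⟩
  have α0 : 0 ≤ α := by rw [hα]; positivity
  rw [← hα]
  have p4 : S.Γ ^ 4 ≤ S.Γ ^ 11 := pow_le_pow_right₀ hΓ (by norm_num)
  have p1 : S.Γ ≤ S.Γ ^ 11 := le_self_pow₀ hΓ (by norm_num)
  have p11 : 0 < S.Γ ^ 11 := by positivity
  refine ⟨?_, ?_, ?_⟩
  · have e : α ^ 2 = S.ε * S.a ^ 2 := by rw [hα, mul_pow, hs2]
    rw [e]
    refine eA.trans ?_
    have e2 : s * S.M * (S.a * S.w) = S.M * (α * S.w) := by rw [hα]; ring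
    rw [e2]
    gcongr
    norm_num
  · have h1 : √(17 * S.Γ * S.L ^ 2 * (S.b2 + s * S.w ^ 2)) ≤ √(17 * S.Γ) * S.L * (e4 * (β + S.w)) := by
      refine Real.sqrt_le_iff.2 ⟨by positivity, ?_⟩
      rw [mul_pow, mul_pow, mul_pow, Real.sq_sqrt (by positivity), he2, eb]
      have : s * β ^ 2 + s * S.w ^ 2 ≤ s * (β + S.w) ^ 2 := by
        have : 0 ≤ s * (β * S.w) := by positivity
        linarith
      gcongr
    have h2 : S.rω * √(17 * S.Γ * S.L ^ 2 * (S.b2 + s * S.w ^ 2)) ≤ s * (P * (β + S.w)) := by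
      have rn : 0 ≤ S.rω := Real.sqrt_nonneg _
      calc _ ≤ S.rω * (√(17 * S.Γ) * S.L * (e4 * (β + S.w))) := by gcongr
        _ = √(17 * S.Γ) * S.L * S.rω * (e4 * (β + S.w)) := by ring
        _ ≤ P * e4 * (e4 * (β + S.w)) := by gcongr
        _ = e4 ^ 2 * (P * (β + S.w)) := by ring
        _ = _ := by rw [he2]
    have e3 : 3 * (1 + S.M) * S.ε * (S.a * S.w) = s * (3 * ((1 + S.M) * (α * S.w))) := by
      rw [hα, ← hs2]; ring
    have h3 : |S.nt| * S.b2 ≤ s * (10000 * S.Γ ^ 11 * (P * (β + S.w)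
      + (1 + S.M) * (α * S.w) + S.M * (1 + S.M) * S.w ^ 2)) := by
      calc |S.nt| * S.b2 ≤ 2000 * S.Γ ^ 11 * (s * (P * (β + S.w)) + s * (3 * ((1 + S.M) * (α * S.w)))
            + 5 * s * (S.M * (1 + S.M)) * S.w ^ 2) := by
            refine eS.trans ?_
            rw [e3] at eJ
            gcongr
            linarith
        _ ≤ 2000 * S.Γ ^ 11 * (5 * (s * (P * (β + S.w)
          + (1 + S.M) * (α * S.w) + S.M * (1 + S.M) * S.w ^ 2))) := by
            have i1 : 0 ≤ s * (P * (β + S.w)) := by positivity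
            have i2 : 0 ≤ s * ((1 + S.M) * (α * S.w)) := by positivity
            gcongr
            linarith
        _ = _ := by ring
    rw [eb] at h3
    have h4 : s * (|S.nt| * β ^ 2) ≤ s * (10000 * S.Γ ^ 11 * (P * (β + S.w)
      + (1 + S.M) * (α * S.w) + S.M * (1 + S.M) * S.w ^ 2)) := by
      calc _ = |S.nt| * (s * β ^ 2) := by ring
        _ ≤ _ := h3
    exact le_of_mul_le_mul_left h4 s0
  · intro t ht htK
    have h1 := eI (t := s * t) (by positivity) (by nlinarith)
    rw [eb] at h1
    have e : s * t * (S.a * S.w) + s * β ^ 2 / (s * t) = t * (α * S.w) + β ^ 2 / t := by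
      rw [hα]; field_simp
    rw [e] at h1
    refine h1.trans ?_
    gcongr
    norm_num

end Sys


lemma nrm4_eq {a b c d : ℝ → ℂ} (ha : ML2 a) (hb : ML2 b) (hc : ML2 c) (hd : ML2 d) :
    nrm4 a b c d = √(∫ y in Ioi (0:ℝ), (‖a y‖ ^ 2 + ‖b y‖ ^ 2 + ‖c y‖ ^ 2 + ‖d y‖ ^ 2)) := by
  unfold nrm4 nsq
  unfold ML2 at ha hb hc hd
  have I1 : Integrable (fun y => ‖a y‖ ^ 2 + ‖b y‖ ^ 2) (volume.restrict (Ioi 0)) := ha.add hb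
  have I2 : Integrable (fun y => ‖a y‖ ^ 2 + ‖b y‖ ^ 2 + ‖c y‖ ^ 2) (volume.restrict (Ioi 0)) := I1.add hc
  rw [← integral_add ha hb, ← integral_add I1 hc, ← integral_add I2 hd]

lemma iZ {Z : ℝ → ℝ} {C₀ : ℝ} (cZ : Continuous Z) (hZ : ∀ y, 0 ≤ y → 0 ≤ Z y ∧ Z y ≤ C₀) {f : ℝ → ℝ}
    (hf : IntegrableOn f (Ioi 0)) : IntegrableOn (fun y => Z y * f y) (Ioi 0) := by
  refine Integrable.bdd_mul (c := C₀) hf cZ.aestronglyMeasurable ?_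
  filter_upwards [ae_restrict_mem measurableSet_Ioi] with y hy
  rw [Real.norm_of_nonneg (hZ y (le_of_lt hy)).1]
  exact (hZ y (le_of_lt hy)).2

lemma wt_sq {Z : ℝ → ℝ} {f : ℝ → ℂ} {y : ℝ} (hZ : 0 ≤ Z y) : ‖wt Z f y‖ ^ 2 = Z y * ‖f y‖ ^ 2 := by
  unfold wt
  rw [norm_mul, Complex.norm_real, Real.norm_of_nonneg (Real.sqrt_nonneg _), mul_pow, Real.sq_sqrt hZ]

lemma nrm4_wt {Z : ℝ → ℝ} {C₀ : ℝ} (cZ : Continuous Z) (hZ : ∀ y, 0 ≤ y → 0 ≤ Z y ∧ Z y ≤ C₀)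
    {a b c d : ℝ → ℂ} (ha : ML2 a) (hb : ML2 b) (hc : ML2 c) (hd : ML2 d) :
    nrm4 (wt Z a) (wt Z b) (wt Z c) (wt Z d) =
      √(∫ y in Ioi (0:ℝ), Z y * (‖a y‖ ^ 2 + ‖b y‖ ^ 2 + ‖c y‖ ^ 2 + ‖d y‖ ^ 2)) := by
  have key : ∀ f : ℝ → ℂ, ML2 f → ML2 (wt Z f) := by
    intro f hf
    unfold ML2
    refine (integrableOn_congr_fun (fun y hy => wt_sq (hZ y (le_of_lt hy)).1) measurableSet_Ioi).2 ?_
    exact iZ cZ hZ hf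
  rw [nrm4_eq (key a ha) (key b hb) (key c hc) (key d hd)]
  congr 1
  refine setIntegral_congr_fun measurableSet_Ioi fun y hy => ?_
  have h := (hZ y (le_of_lt hy)).1
  rw [wt_sq h, wt_sq h, wt_sq h, wt_sq h]; ring

namespace Sys
variable (S : Sys)

lemma rω_le {Z : ℝ → ℝ} {C₀ B e4 : ℝ} (cZ : Continuous Z) (hZ : ∀ y, 0 ≤ y → 0 ≤ Z y ∧ Z y ≤ C₀)
    (hB : 1 ≤ B) (hω : ∀ y, 0 ≤ y → S.ω y ≤ B * Z y) (he : 0 < e4) (he2 : e4 ^ 2 = √S.ε) :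
    S.rω ≤ √B * e4 * (S.r + e4⁻¹ * √(∫ y in Ioi (0:ℝ), Z y * S.R2 y)) := by
  have iz := iZ cZ hZ S.iR
  have zn : 0 ≤ ∫ y in Ioi (0:ℝ), Z y * S.R2 y :=
    setIntegral_nonneg measurableSet_Ioi fun y hy => mul_nonneg (hZ y (le_of_lt hy)).1 (S.R_nn y)
  have rn : 0 ≤ ∫ y in Ioi (0:ℝ), S.R2 y := setIntegral_nonneg measurableSet_Ioi fun y _ => S.R_nn y
  have h1 : ∫ y in Ioi (0:ℝ), (S.ω y + √S.ε) * S.R2 y ≤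
      B * ∫ y in Ioi (0:ℝ), (Z y * S.R2 y + √S.ε * S.R2 y) := by
    rw [← integral_const_mul]
    refine setIntegral_mono_on (S.iωs S.iR) ((iz.add (S.iR.const_mul _)).const_mul _) measurableSet_Ioi ?_
    intro y hy
    have h2 := hω y (le_of_lt hy)
    have h3 := S.R_nn y
    have h4 : √S.ε ≤ B * √S.ε := le_mul_of_one_le_left (Real.sqrt_nonneg _) hB
    calc (S.ω y + √S.ε) * S.R2 y ≤ (B * Z y + B * √S.ε) * S.R2 y := by gcongr
      _ = _ := by ring
  rw [integral_add iz (S.iR.const_mul _), integral_const_mul] at h1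
  have hr : S.r ^ 2 = ∫ y in Ioi (0:ℝ), S.R2 y := Real.sq_sqrt rn
  obtain ⟨z, hz⟩ : ∃ t, t = √(∫ y in Ioi (0:ℝ), Z y * S.R2 y) := ⟨_, rfl⟩
  have z0 : 0 ≤ z := by rw [hz]; positivity
  have hz2 : z ^ 2 = ∫ y in Ioi (0:ℝ), Z y * S.R2 y := by rw [hz]; exact Real.sq_sqrt zn
  have r0 := S.r_nn
  rw [← hr, ← hz2, ← he2] at h1
  rw [← hz]
  unfold rω
  refine Real.sqrt_le_iff.2 ⟨by positivity, ?_⟩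
  rw [← he2]
  refine h1.trans ?_
  have e : √B * e4 * (S.r + e4⁻¹ * z) = √B * (e4 * S.r + z) := by field_simp
  rw [e, mul_pow, Real.sq_sqrt (by linarith)]
  have : 0 ≤ e4 * S.r * z := by positivity
  gcongr
  linarith

lemma zW_le {Z : ℝ → ℝ} {C₀ B : ℝ} (cZ : Continuous Z) (hZ : ∀ y, 0 ≤ y → 0 ≤ Z y ∧ Z y ≤ C₀)
    (hB : 0 ≤ B) (hω : ∀ y, 0 < y → Z y ≤ B * S.ω y) :
    √(∫ y in Ioi (0:ℝ), Z y * S.W2 y) ≤ √B * √S.b2 := by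
  rw [← Real.sqrt_mul hB]
  refine Real.sqrt_le_sqrt ?_
  unfold b2
  rw [← integral_const_mul]
  refine setIntegral_mono_on (iZ cZ hZ S.iW2) ((S.iω S.iW2).const_mul _) measurableSet_Ioi ?_
  intro y hy
  have h3 := S.W2_nn y
  calc Z y * S.W2 y ≤ B * S.ω y * S.W2 y := by gcongr; exact hω y hy
    _ = _ := by ring

lemma D_le : √(∫ y in Ioi (0:ℝ), S.D2 y) ≤ S.a := by
  refine Real.sqrt_le_sqrt (setIntegral_mono_on S.iD2 S.id2 measurableSet_Ioi fun y _ => ?_)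
  have := S.W2_nn y
  unfold d2
  have : 0 ≤ S.nt ^ 2 * S.W2 y := by positivity
  linarith

lemma Nw_le : |S.nt| * S.w ≤ S.a := by
  refine Real.le_sqrt_of_sq_le ?_
  rw [mul_pow, sq_abs, S.w_sq, ← integral_const_mul]
  refine setIntegral_mono_on (S.iW2.const_mul _) S.id2 measurableSet_Ioi fun y _ => ?_
  have := S.D2_nn y
  unfold d2
  linarith

lemma L_le (he : S.ε < Real.exp (-1)) : 1 ≤ |Real.log S.ε| ∧ S.L ≤ (Real.log S.K + 2) * |Real.log S.ε| := by
  have h1 : Real.log S.ε < -1 := (Real.log_lt_iff_lt_exp S.hε0).2 he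
  have h2 : |Real.log S.ε| = -Real.log S.ε := abs_of_neg (by linarith)
  have hK := S.hK
  have h3 : 0 ≤ Real.log S.K := Real.log_nonneg (by linarith)
  refine ⟨by rw [h2]; linarith, ?_⟩
  unfold L
  rw [Real.log_div (by linarith) (Real.sqrt_pos.2 S.hε0).ne', Real.log_sqrt S.hε0.le, h2]
  nlinarith

lemma Zω {Z : ℝ → ℝ} {C₀ : ℝ} (hC : 1 ≤ C₀) (hZ : ∀ y, 0 ≤ y → 0 ≤ Z y ∧ Z y ≤ C₀)
    (h2 : ∀ y ∈ Set.Icc (0:ℝ) 2, C₀⁻¹ * y ≤ Z y ∧ Z y ≤ C₀ * y) (h3 : ∀ y, 2 ≤ y → Z y = Z 2)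
    (hω : ∀ y, 0 ≤ y → S.ω y ≤ S.Γ * S.K) :
    (∀ y, 0 < y → Z y ≤ 2 * S.Γ * C₀ * S.ω y) ∧ ∀ y, 0 ≤ y → S.ω y ≤ S.Γ * S.K * C₀ * Z y := by
  have hΓ := S.hΓ
  have hK := S.hK
  have h0 : 0 < S.Γ := by linarith
  have c0 : 0 < C₀ := by linarith
  constructor
  · intro y hy
    have h4 := S.ω_low y hy
    have k0 : 0 < S.K + y := by linarith
    rcases le_total y 2 with h | h
    · have h5 : 1 / 2 ≤ S.K / (S.K + y) := by
        rw [le_div_iff₀ k0]; linarith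
      calc Z y ≤ C₀ * y := (h2 y ⟨hy.le, h⟩).2
        _ = 2 * C₀ * (y * (1 / 2)) := by ring
        _ ≤ 2 * C₀ * (y * (S.K / (S.K + y))) := by gcongr
        _ ≤ 2 * C₀ * (S.Γ * S.ω y) := by gcongr
        _ = _ := by ring
    · have h5 : 1 / 2 ≤ y * (S.K / (S.K + y)) := by
        rw [← mul_div_assoc, le_div_iff₀ k0]; nlinarith
      calc Z y ≤ C₀ := (hZ y hy.le).2
        _ = 2 * C₀ * (1 / 2) := by ring
        _ ≤ 2 * C₀ * (y * (S.K / (S.K + y))) := by gcongr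
        _ ≤ 2 * C₀ * (S.Γ * S.ω y) := by gcongr
        _ = _ := by ring
  · intro y hy
    have key : ∀ t, t ∈ Set.Icc (0:ℝ) 2 → t ≤ C₀ * Z t := by
      intro t ht
      have := (h2 t ht).1
      rwa [inv_mul_le_iff₀ c0] at this
    rcases le_total y 2 with h | h
    · have h5 := key y ⟨hy, h⟩
      have hz := (hZ y hy).1
      calc S.ω y ≤ S.Γ * y := S.ω_le y hy
        _ ≤ S.Γ * (C₀ * Z y) := by gcongr
        _ ≤ S.K * (S.Γ * (C₀ * Z y)) := le_mul_of_one_le_left (by positivity) (by linarith)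
        _ = _ := by ring
    · have h5 := key 2 ⟨by norm_num, le_rfl⟩
      rw [h3 y h]
      calc S.ω y ≤ S.Γ * S.K * 1 := by rw [mul_one]; exact hω y hy
        _ ≤ S.Γ * S.K * (C₀ * Z 2) := by gcongr; linarith
        _ = _ := by ring

end Sys


lemma pow_facts {N ε : ℝ} (hN : 0 < N) (hε : 0 < ε) : ∃ x e4 : ℝ, 0 < x ∧ 0 < e4 ∧ x ^ 3 = N ∧ e4 ^ 2 = √ε ∧
    N ^ ((1:ℝ)/3) = x ∧ N ^ ((2:ℝ)/3) = x ^ 2 ∧ N ^ ((5:ℝ)/6) = √(x ^ 5) ∧ ε ^ (-(1:ℝ)/4) = e4⁻¹ := by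
  refine ⟨N ^ ((1:ℝ)/3), ε ^ ((1:ℝ)/4), by positivity, by positivity, ?_, ?_, rfl, ?_, ?_, ?_⟩
  · rw [← Real.rpow_natCast, ← Real.rpow_mul hN.le]; norm_num
  · rw [← Real.rpow_natCast, ← Real.rpow_mul hε.le, Real.sqrt_eq_rpow]; norm_num
  · rw [← Real.rpow_natCast, ← Real.rpow_mul hN.le]; norm_num
  · rw [Real.sqrt_eq_rpow, ← Real.rpow_natCast, ← Real.rpow_mul hN.le, ← Real.rpow_mul hN.le]; norm_num
  · rw [← Real.rpow_neg hε.le]; norm_num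

lemma final_est (S : Sys) (hF : S.FB) {C₀ ϱ C6 : ℝ} (hC : 1 ≤ C₀) (hϱ : 0 < ϱ) (C60 : 0 < C6)
    (hKϱ : S.K = 2 + ϱ) (hNϱ : 1 ≤ |S.nt| * ϱ)
    (halg : ∀ x w α β P : ℝ, 0 < x → 1 ≤ x ^ 3 * ϱ →
      0 ≤ w → 0 ≤ α → 0 ≤ β → 0 ≤ P →
      α ^ 2 ≤ 10000 * S.Γ ^ 11 * (P * w + S.M * (α * w) + S.M * (1 + S.M) * w ^ 2) →
      x ^ 3 * β ^ 2 ≤ 10000 * S.Γ ^ 11 * (P * (β + w) + (1 + S.M) * (α * w) + S.M * (1 + S.M) * w ^ 2) →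
      (∀ s, 0 < s → s ≤ 2 + ϱ → w ^ 2 ≤ 10000 * S.Γ ^ 11 * (s * (α * w) + β ^ 2 / s)) →
      x * α ≤ C6 * P ∧ x ^ 2 * w ≤ C6 * P ∧ x ^ 5 * β ^ 2 ≤ (C6 * P) ^ 2)
    {Z : ℝ → ℝ} (cZ : Continuous Z) (hZ : ∀ y, 0 ≤ y → 0 ≤ Z y ∧ Z y ≤ C₀)
    (h2 : ∀ y ∈ Set.Icc (0:ℝ) 2, C₀⁻¹ * y ≤ Z y ∧ Z y ≤ C₀ * y) (h3 : ∀ y, 2 ≤ y → Z y = Z 2)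
    (hω : ∀ y, 0 ≤ y → S.ω y ≤ S.Γ * S.K) (he : S.ε < Real.exp (-1)) {η : ℝ} (hη : 0 < η) :
    √S.ε * |S.nt| ^ ((1:ℝ)/3) * (√(∫ y in Ioi (0:ℝ), S.D2 y) + |S.nt| * S.w) + |S.nt| ^ ((2:ℝ)/3) * S.w
      + S.ε ^ (-(1:ℝ)/4) * |S.nt| ^ ((5:ℝ)/6) * √(∫ y in Ioi (0:ℝ), Z y * S.W2 y)
    ≤ (3 + √(2 * S.Γ * C₀)) * C6 * (√(17 * S.Γ) * √(S.Γ * S.K * C₀)) * (Real.log S.K + 2)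
      * |Real.log S.ε| ^ ((1:ℝ) + η / 3) *
      (S.r + S.ε ^ (-(1:ℝ)/4) * √(∫ y in Ioi (0:ℝ), Z y * S.R2 y)) := by
  obtain ⟨x, e4, x0, e0, hx3, he2, x1, x2, x5, ee⟩ := pow_facts S.N_pos S.hε0
  rw [x1, x2, x5, ee]
  obtain ⟨z1, z2⟩ := S.Zω hC hZ h2 h3 hω
  obtain ⟨l1, l2⟩ := S.L_le he
  have hΓ := S.hΓ
  have hK := S.hK
  have h0 : 0 < S.Γ := by linarith
  have lK : 0 ≤ Real.log S.K := Real.log_nonneg (by linarith)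
  have c0 : 0 < C₀ := by linarith
  have B1 : 1 ≤ S.Γ * S.K * C₀ := by
    have : 1 ≤ S.Γ * S.K := one_le_mul_of_one_le_of_one_le hΓ (by linarith)
    exact one_le_mul_of_one_le_of_one_le this hC
  have hr := S.rω_le cZ hZ B1 z2 e0 he2
  have hz := S.zW_le cZ hZ (B := 2 * S.Γ * C₀) (by positivity) z1
  have hD := S.D_le
  have hw := S.Nw_le
  have r0 := S.r_nn
  have w0 := S.w_nn
  have a0 := S.a_nn
  have L1 := S.L_ge
  obtain ⟨ρ, hρ⟩ : ∃ t, t = S.r + e4⁻¹ * √(∫ y in Ioi (0:ℝ), Z y * S.R2 y) := ⟨_, rfl⟩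
  have ρr : S.r ≤ ρ := by
    rw [hρ]
    have : 0 ≤ e4⁻¹ * √(∫ y in Ioi (0:ℝ), Z y * S.R2 y) := by positivity
    linarith
  have ρ0 : 0 ≤ ρ := r0.trans ρr
  rw [← hρ] at hr ⊢
  obtain ⟨c, hc⟩ : ∃ t, t = √(17 * S.Γ) * √(S.Γ * S.K * C₀) := ⟨_, rfl⟩
  have c1 : 1 ≤ c := by
    rw [hc]
    refine one_le_mul_of_one_le_of_one_le (Real.one_le_sqrt.2 (by linarith)) (Real.one_le_sqrt.2 B1)
  obtain ⟨P, hP⟩ : ∃ t, t = c * S.L * ρ := ⟨_, rfl⟩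
  have cL : 1 ≤ c * S.L := one_le_mul_of_one_le_of_one_le c1 L1
  have P0 : 0 ≤ P := by rw [hP]; positivity
  have rP : S.r ≤ P := by
    rw [hP]; exact ρr.trans (le_mul_of_one_le_left ρ0 cL)
  have rωP : √(17 * S.Γ) * S.L * S.rω ≤ P * e4 := by
    calc √(17 * S.Γ) * S.L * S.rω ≤ √(17 * S.Γ) * S.L * (√(S.Γ * S.K * C₀) * e4 * ρ) := by gcongr
      _ = P * e4 := by rw [hP, hc]; ring
  obtain ⟨sA, sS, sI⟩ := S.scaled hF e0 he2 P0 rP rωP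
  rw [← hx3] at sS
  rw [hKϱ] at sI
  obtain ⟨y1, y2, y3⟩ := halg x S.w (√S.ε * S.a) (√S.b2 / e4) P x0 (by rw [hx3]; exact hNϱ) w0 (by positivity)
    (by positivity) P0 sA sS sI
  have y4 : √(x ^ 5) * (√S.b2 / e4) ≤ C6 * P := by
    refine abs_le_of_sq_le_sq' ?_ (by positivity) |>.2
    rw [mul_pow, Real.sq_sqrt (by positivity)]
    exact y3
  obtain ⟨ℓ, hℓ⟩ : ∃ t, t = |Real.log S.ε| := ⟨_, rfl⟩
  rw [← hℓ] at l1 l2 ⊢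
  have l3 : ℓ ≤ ℓ ^ ((1:ℝ) + η / 3) := by
    calc ℓ = ℓ ^ (1:ℝ) := (Real.rpow_one _).symm
      _ ≤ _ := Real.rpow_le_rpow_of_exponent_le l1 (by linarith)
  have PP : P ≤ c * (Real.log S.K + 2) * ℓ ^ ((1:ℝ) + η / 3) * ρ := by
    rw [hP]
    calc c * S.L * ρ ≤ c * ((Real.log S.K + 2) * ℓ ^ ((1:ℝ) + η / 3)) * ρ := by
          gcongr
          exact l2.trans (by gcongr)
      _ = _ := by ring
  rw [← hc]
  have t1 : √S.ε * x * (√(∫ y in Ioi (0:ℝ), S.D2 y) + |S.nt| * S.w) ≤ 2 * (C6 * P) := by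
    calc _ ≤ √S.ε * x * (S.a + S.a) := by gcongr
      _ = 2 * (x * (√S.ε * S.a)) := by ring
      _ ≤ _ := by gcongr
  have t3 : e4⁻¹ * √(x ^ 5) * √(∫ y in Ioi (0:ℝ), Z y * S.W2 y) ≤ √(2 * S.Γ * C₀) * (C6 * P) := by
    calc _ ≤ e4⁻¹ * √(x ^ 5) * (√(2 * S.Γ * C₀) * √S.b2) := by gcongr
      _ = √(2 * S.Γ * C₀) * (√(x ^ 5) * (√S.b2 / e4)) := by ring
      _ ≤ _ := by gcongr
  calc _ ≤ 2 * (C6 * P) + C6 * P + √(2 * S.Γ * C₀) * (C6 * P) := by gcongr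
    _ = (3 + √(2 * S.Γ * C₀)) * C6 * P := by ring
    _ ≤ (3 + √(2 * S.Γ * C₀)) * C6 * (c * (Real.log S.K + 2) * ℓ ^ ((1:ℝ) + η / 3) * ρ) := by gcongr
    _ = _ := by ring


end Aux

/-- the full L² estimate under the smallness condition
`ϱ(M̄ + M̄⁴) ≤ δ₁`, for solutions of the transformed linearized MHD system on
one Fourier mode. -/
theorem stmt17
    (μ κ γ γbar γ₀ C₀ : ℝ) (hμ : 0 < μ) (hκ : 0 < κ)
    (hγ : 0 < γ) (hγγ : γ ≤ γbar) (hγ₀ : 0 < γ₀) (hC₀ : 1 ≤ C₀) :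
    ∃ δ₁ ε₁ : ℝ, 0 < δ₁ ∧ 0 < ε₁ ∧
    ∀ ϱ : ℝ, 0 < ϱ → ∀ Mbar : ℝ, ϱ * (Mbar + Mbar ^ 4) ≤ δ₁ →
    ∀ η : ℝ, 0 < η → ∃ C₆ : ℝ, 0 < C₆ ∧
    ∀ (ε : ℝ) (n : ℤ), ε ∈ Set.Ioc (0:ℝ) 1 → ε < ε₁ → n ≠ 0 →
    ∀ Us Hs : ℝ → ℝ, ContDiff ℝ 3 Us → ContDiff ℝ 3 Hs → Us 0 = 0 →
      (∀ Y, 0 ≤ Y → γ ≤ |Hs Y| ∧ |Hs Y| ≤ γbar) →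
      (∀ Y, 0 ≤ Y → γ₀ ≤ Hs Y ^ 2 - Us Y ^ 2) →
      (∀ Y, 0 ≤ Y → ∀ k : ℕ, 1 ≤ k → k ≤ 3 →
        (1 + Y)^3 * (|iteratedDeriv k Us Y| + |iteratedDeriv k Hs Y|) ≤ Mbar) →
    ∀ (AU BU CU CH : ℝ → Matrix (Fin 2) (Fin 2) ℂ) (DU DH : ℝ → Fin 2 → ℂ),
      Continuous AU → Continuous BU → Continuous CU → Continuous CH →
      Continuous DU → Continuous DH →
      (∀ Y, 0 ≤ Y → ∀ i j, (1 + Y) * (‖AU Y i j‖ + ‖BU Y i j‖) ≤ Mbar) →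
      (∀ Y, 0 ≤ Y → ∀ i j, (1 + Y) * (‖CU Y i j‖ + ‖CH Y i j‖) ≤ Mbar * (1 + Mbar)) →
      (∀ Y, 0 ≤ Y → ∀ i, (1 + Y)^2 * (‖DU Y i‖ + ‖DH Y i‖) ≤ Mbar * (1 + Mbar)) →
    ∀ Z : ℝ → ℝ, ContDiff ℝ 2 Z →
      (∀ y, 0 ≤ y → 0 ≤ Z y ∧ Z y ≤ C₀ ∧ 0 ≤ deriv Z y) →
      (∀ y ∈ Set.Icc (0:ℝ) 2, C₀⁻¹ * y ≤ Z y ∧ Z y ≤ C₀ * y) →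
      (∀ y, 2 ≤ y → Z y = Z 2) →
      (∀ y ∈ Set.Icc (0:ℝ) 1,
        (Hs (y / Real.sqrt ε) ^ 2 - Us (y / Real.sqrt ε) ^ 2) * deriv Z y = 1) →
      (∀ y ∈ Set.Icc (0:ℝ) (3/2), ∀ k : ℕ, k ≤ 3 →
        |y ^ k * deriv (deriv Z) y| ≤ C₀ * Mbar * ε ^ (((k:ℝ) - 1)/2)) →
      (∀ y, 1 ≤ y → -(C₀ * Mbar * ε) ≤
        -(deriv (fun t => (Hs (t / Real.sqrt ε) ^ 2 - Us (t / Real.sqrt ε) ^ 2)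
            * deriv Z t) y)) →
      (∀ y, 3/2 ≤ y → deriv (deriv Z) y ≤ 0) →
      (∀ y, 0 ≤ y → (1 + y) * |deriv Z y| ≤ C₀ ∧
        y * |deriv (deriv Z) y| ≤ C₀ * (Mbar + 1)) →
    ∀ u v h g p R1 R2 R3 R4 : ℝ → ℂ,
      ContDiff ℝ 3 u → ContDiff ℝ 3 v → ContDiff ℝ 3 h → ContDiff ℝ 3 g →
      ContDiff ℝ 2 p →
      (ML2 u ∧ ML2 v ∧ ML2 h ∧ ML2 g) →
      (ML2 (deriv u) ∧ ML2 (deriv v) ∧ ML2 (deriv h) ∧ ML2 (deriv g)) →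
      (ML2 (deriv (deriv u)) ∧ ML2 (deriv (deriv v)) ∧
        ML2 (deriv (deriv h)) ∧ ML2 (deriv (deriv g))) →
      Tendsto (fun y => ‖u y‖ + ‖v y‖ + ‖h y‖ + ‖g y‖) atTop (nhds 0) →
      Tendsto (fun y => ‖deriv u y‖ + ‖deriv v y‖ + ‖deriv h y‖ + ‖deriv g y‖)
        atTop (nhds 0) →
      Tendsto (fun y => ‖deriv (deriv u) y‖ + ‖deriv (deriv v) y‖
        + ‖deriv (deriv h) y‖ + ‖deriv (deriv g) y‖) atTop (nhds 0) →
      Tendsto (fun y => ‖p y‖ * (‖u y‖ + ‖v y‖ + ‖h y‖ + ‖g y‖)) atTop (nhds 0) →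
      (ML2 R1 ∧ ML2 R2 ∧ ML2 R3 ∧ ML2 R4) →
      -- equation (E1), first and second components
      (∀ y, 0 < y →
        Complex.I * (((n:ℝ)/ϱ : ℝ) : ℂ) *
            ((((1 + μ/κ) * Us (y / Real.sqrt ε) : ℝ) : ℂ) * u y
              - ((Hs (y / Real.sqrt ε) ^ 2 - Us (y / Real.sqrt ε) ^ 2 : ℝ) : ℂ) * h y
              + ((Real.sqrt ε : ℝ) : ℂ) *
                  (AU (y / Real.sqrt ε) 0 0 * h y + AU (y / Real.sqrt ε) 0 1 * g y))
          + ((Real.sqrt ε : ℝ) : ℂ) *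
              (BU (y / Real.sqrt ε) 0 0 * deriv h y + BU (y / Real.sqrt ε) 0 1 * deriv g y)
          + (CU (y / Real.sqrt ε) 0 0 * h y + CU (y / Real.sqrt ε) 0 1 * g y)
          + (((Real.sqrt ε)⁻¹ : ℝ) : ℂ) * (∫ s in (0:ℝ)..y, h s) * DU (y / Real.sqrt ε) 0
          + Complex.I * (((n:ℝ)/ϱ : ℝ) : ℂ) * p y
          - ((μ * ε : ℝ) : ℂ) *
              (deriv (deriv u) y - (((n:ℝ)/ϱ : ℝ) : ℂ)^2 * u y)
          = R1 y) →
      (∀ y, 0 < y →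
        Complex.I * (((n:ℝ)/ϱ : ℝ) : ℂ) *
            ((((1 + μ/κ) * Us (y / Real.sqrt ε) : ℝ) : ℂ) * v y
              - ((Hs (y / Real.sqrt ε) ^ 2 - Us (y / Real.sqrt ε) ^ 2 : ℝ) : ℂ) * g y
              + ((Real.sqrt ε : ℝ) : ℂ) *
                  (AU (y / Real.sqrt ε) 1 0 * h y + AU (y / Real.sqrt ε) 1 1 * g y))
          + ((Real.sqrt ε : ℝ) : ℂ) *
              (BU (y / Real.sqrt ε) 1 0 * deriv h y + BU (y / Real.sqrt ε) 1 1 * deriv g y)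
          + (CU (y / Real.sqrt ε) 1 0 * h y + CU (y / Real.sqrt ε) 1 1 * g y)
          + (((Real.sqrt ε)⁻¹ : ℝ) : ℂ) * (∫ s in (0:ℝ)..y, h s) * DU (y / Real.sqrt ε) 1
          + deriv p y
          - ((μ * ε : ℝ) : ℂ) *
              (deriv (deriv v) y - (((n:ℝ)/ϱ : ℝ) : ℂ)^2 * v y)
          = R2 y) →
      -- equation (E2), first and second components
      (∀ y, 0 < y →
        -(Complex.I * (((n:ℝ)/ϱ : ℝ) : ℂ)) * u y
          - ((2 * κ * Real.sqrt ε *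
              (deriv Hs (y / Real.sqrt ε) / Hs (y / Real.sqrt ε)) : ℝ) : ℂ) * deriv h y
          + (CH (y / Real.sqrt ε) 0 0 * h y + CH (y / Real.sqrt ε) 0 1 * g y)
          + (((Real.sqrt ε)⁻¹ : ℝ) : ℂ) * (∫ s in (0:ℝ)..y, h s) * DH (y / Real.sqrt ε) 0
          - ((κ * ε : ℝ) : ℂ) *
              (deriv (deriv h) y - (((n:ℝ)/ϱ : ℝ) : ℂ)^2 * h y)
          = R3 y) →
      (∀ y, 0 < y →
        -(Complex.I * (((n:ℝ)/ϱ : ℝ) : ℂ)) * v y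
          - ((2 * κ * Real.sqrt ε *
              (deriv Hs (y / Real.sqrt ε) / Hs (y / Real.sqrt ε)) : ℝ) : ℂ) * deriv g y
          + (CH (y / Real.sqrt ε) 1 0 * h y + CH (y / Real.sqrt ε) 1 1 * g y)
          + (((Real.sqrt ε)⁻¹ : ℝ) : ℂ) * (∫ s in (0:ℝ)..y, h s) * DH (y / Real.sqrt ε) 1
          - ((κ * ε : ℝ) : ℂ) *
              (deriv (deriv g) y - (((n:ℝ)/ϱ : ℝ) : ℂ)^2 * g y)
          = R4 y) →
      -- equation (E3): divergence-free conditions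
      (∀ y, 0 < y →
        Complex.I * (((n:ℝ)/ϱ : ℝ) : ℂ) * u y + deriv v y = 0 ∧
        Complex.I * (((n:ℝ)/ϱ : ℝ) : ℂ) * h y + deriv g y = 0) →
      -- equation (E4): boundary conditions
      u 0 = 0 → v 0 = 0 → deriv h 0 = 0 → g 0 = 0 →
      Real.sqrt ε * |(n:ℝ)/ϱ| ^ ((1:ℝ)/3) *
            (nrm4 (deriv u) (deriv v) (deriv h) (deriv g)
              + |(n:ℝ)/ϱ| * nrm4 u v h g)
          + |(n:ℝ)/ϱ| ^ ((2:ℝ)/3) * nrm4 u v h g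
          + ε ^ (-(1:ℝ)/4) * |(n:ℝ)/ϱ| ^ ((5:ℝ)/6) *
              nrm4 (wt Z u) (wt Z v) (wt Z h) (wt Z g)
        ≤ C₆ * |Real.log ε| ^ ((1:ℝ) + η/3) *
            (nrm4 R1 R2 R3 R4
              + ε ^ (-(1:ℝ)/4) * nrm4 (wt Z R1) (wt Z R2) (wt Z R3) (wt Z R4)) := by
  obtain ⟨f1, f2, f3, f4, f5, f6, f7, f8, f9, f10, f11, f12⟩ := GG_facts hμ hκ hγ hγγ hγ₀
  have hΓ1 : 1 ≤ GG μ κ γ γbar γ₀ := by linarith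
  have hC1 : 1 ≤ 10000 * GG μ κ γ γbar γ₀ ^ 11 := by
    have := one_le_pow₀ hΓ1 (n := 11)
    linarith
  obtain ⟨δ, hδ, H⟩ := alg_final hC1
  refine ⟨δ, Real.exp (-1), hδ, Real.exp_pos _, ?_⟩
  intro ϱ hϱ M hsm η hη
  rcases lt_or_ge M 0 with hM | hM
  · refine ⟨1, one_pos, ?_⟩
    intro ε n hε hε1 hn Us Hs cU cH U0 hH hG hD
    exfalso
    have := hD 0 le_rfl 1 le_rfl (by norm_num)
    have h1 := abs_nonneg (deriv Us 0)
    have h2 := abs_nonneg (deriv Hs 0)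
    norm_num at this
    linarith
  obtain ⟨C6, C60, halg⟩ := H ϱ M hϱ hM hsm
  have lK : 0 ≤ Real.log (2 + ϱ) := Real.log_nonneg (by linarith)
  have hC0 : 0 < C₀ := by linarith
  have hΓ0 : 0 < GG μ κ γ γbar γ₀ := by linarith
  refine ⟨(3 + √(2 * GG μ κ γ γbar γ₀ * C₀)) * C6 * (√(17 * GG μ κ γ γbar γ₀) *
    √(GG μ κ γ γbar γ₀ * (2 + ϱ) * C₀)) * (Real.log (2 + ϱ) + 2), by positivity, ?_⟩
  intro ε n hε hε1 hn Us Hs cU cH U0 hH hG hD AU BU CU CH DU DH _ _ _ _ _ _ hAB hCC hDD Z cZ hZ hZ2 hZ3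
    _ _ _ _ _ u v h g p R1 R2 R3 R4 cu cv ch cg cp hW hW' hW'' tW tW' tW'' tp hR q1 q2 q3 q4 hdiv u0 v0 h0 g0
  have hD1 : ∀ Y, 0 ≤ Y → (1 + Y)^3 * (|deriv Us Y| + |deriv Hs Y|) ≤ M := by
    intro Y hY
    have := hD Y hY 1 le_rfl (by norm_num)
    rwa [iteratedDeriv_one, iteratedDeriv_one] at this
  obtain ⟨S, hF, sΓ, sM, sε, sN, sK, su, sv, sh, sg, sR, sω⟩ :=
    mkSys μ κ γ γbar γ₀ hμ hκ hγ hγγ hγ₀ ϱ hϱ M hM ε n hε hn Us Hs cU cH hH hG hD1 AU BU CU CH DU DH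
      hAB hCC hDD u v h g p R1 R2 R3 R4 cu cv ch cg cp hW.1 hW.2.1 hW.2.2.1 hW.2.2.2
      hW'.1 hW'.2.1 hW'.2.2.1 hW'.2.2.2 tW tW' tp hR.1 hR.2.1 hR.2.2.1 hR.2.2.2 q1 q2 q3 q4 hdiv u0 v0 h0 g0
  have hZb : ∀ y, 0 ≤ y → 0 ≤ Z y ∧ Z y ≤ C₀ := fun y hy => ⟨(hZ y hy).1, (hZ y hy).2.1⟩
  have Nϱ : 1 ≤ |S.nt| * ϱ := by
    rw [sN, abs_div, abs_of_pos hϱ, div_mul_cancel₀ _ hϱ.ne']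
    exact_mod_cast Int.one_le_abs hn
  have key := final_est S hF (C₀ := C₀) (ϱ := ϱ) (C6 := C6) hC₀ hϱ C60 sK Nϱ
    (by rw [sΓ, sM]; exact halg) cZ.continuous hZb hZ2 hZ3 sω (by rw [sε]; exact hε1) hη
  have eW : S.W2 = fun y => ‖u y‖ ^ 2 + ‖v y‖ ^ 2 + ‖h y‖ ^ 2 + ‖g y‖ ^ 2 := by
    funext y; unfold Sys.W2; rw [su, sv, sh, sg]
  have eD : S.D2 = fun y => ‖deriv u y‖ ^ 2 + ‖deriv v y‖ ^ 2 + ‖deriv h y‖ ^ 2 + ‖deriv g y‖ ^ 2 := by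
    funext y; unfold Sys.D2; rw [su, sv, sh, sg]
  rw [nrm4_wt cZ.continuous hZb hW.1 hW.2.1 hW.2.2.1 hW.2.2.2,
    nrm4_wt cZ.continuous hZb hR.1 hR.2.1 hR.2.2.1 hR.2.2.2,
    nrm4_eq hW.1 hW.2.1 hW.2.2.1 hW.2.2.2, nrm4_eq hW'.1 hW'.2.1 hW'.2.2.1 hW'.2.2.2,
    nrm4_eq hR.1 hR.2.1 hR.2.2.1 hR.2.2.2]
  unfold Sys.w Sys.r at key
  rw [eW, eD, sR, sΓ, sε, sN, sK] at key
  exact key
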